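/- Let 𝒰 ⊂ {(A, B, C) ∈ ℝ³ : B² − 4AC = 1} be a nonempty set which is open in the subspace topology of the hyperboloid and has compact closure in ℝ³. Then there exists D such that for every integer d ≥ D with d not a perfect square and d ≡ 0 or 1 (mod 4), there exists (a, b, c) ∈ ℤ³ with b² − 4ac = d, gcd(a, b, c) = 1, and (a/√d, b/√d, c/√d) ∈ 𝒰. -/

import Mathlib

/-- The one-sheeted hyperboloid `V = {(A,B,C) : B² − 4AC = 1}` in `ℝ³`. -/
def hypV : Set (ℝ × ℝ × ℝ) := {p | p.2.1 ^ 2 - 4 * p.1 * p.2.2 = 1}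


/-! ## Part D: covering lemma -/

structure SBNode where
  p : ℤ
  q : ℤ
  p' : ℤ
  q' : ℤ

namespace SBNode

def ok (n : SBNode) : Prop := n.p' * n.q - n.p * n.q' = 1 ∧ 1 ≤ n.q ∧ 1 ≤ n.q'

/-- `true` raises the lower endpoint to the mediant, `false` lowers the upper endpoint. -/
def step (b : Bool) (n : SBNode) : SBNode :=
  if b then ⟨n.p + n.p', n.q + n.q', n.p', n.q'⟩ else ⟨n.p, n.q, n.p + n.p', n.q + n.q'⟩

def path : SBNode → List Bool → SBNode
  | n, [] => n
  | n, b :: w => path (step b n) w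

noncomputable def lo (n : SBNode) : ℝ := n.p / n.q
noncomputable def hi (n : SBNode) : ℝ := n.p' / n.q'
noncomputable def len (n : SBNode) : ℝ := 1 / (n.q * n.q')
noncomputable def sg (n : SBNode) : ℝ := n.q + n.q'

lemma ok.stepOk {n : SBNode} (h : n.ok) (b : Bool) : (n.step b).ok := by
  obtain ⟨h1, h2, h3⟩ := h
  cases b
  · refine ⟨?_, ?_, ?_⟩ <;> simp [SBNode.step] <;> linarith
  · refine ⟨?_, ?_, ?_⟩ <;> simp [SBNode.step] <;> linarith

lemma ok.pathOk {n : SBNode} (h : n.ok) (w : List Bool) : (n.path w).ok := by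
  induction w generalizing n with
  | nil => exact h
  | cons b w ih => exact ih (h.stepOk b)

lemma ok.q_pos {n : SBNode} (h : n.ok) : (1:ℝ) ≤ n.q := by exact_mod_cast h.2.1
lemma ok.q'_pos {n : SBNode} (h : n.ok) : (1:ℝ) ≤ n.q' := by exact_mod_cast h.2.2

lemma ok.len_pos {n : SBNode} (h : n.ok) : 0 < n.len := by
  have := h.q_pos; have := h.q'_pos
  unfold len; positivity

lemma ok.hi_sub_lo {n : SBNode} (h : n.ok) : n.hi - n.lo = n.len := by
  have h1 := h.q_pos; have h2 := h.q'_pos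
  have h3 : (n.p':ℝ) * n.q - n.p * n.q' = 1 := by exact_mod_cast h.1
  unfold hi lo len
  have : (n.q:ℝ) ≠ 0 := by positivity
  have : (n.q':ℝ) ≠ 0 := by positivity
  field_simp
  linarith

lemma ok.len_step {n : SBNode} (h : n.ok) : (n.step true).len + (n.step false).len = n.len := by
  have h1 := h.q_pos; have h2 := h.q'_pos
  have : (n.q:ℝ) ≠ 0 := by positivity
  have : (n.q':ℝ) ≠ 0 := by positivity
  have : (n.q:ℝ) + n.q' ≠ 0 := by positivity
  simp [len, step]
  field_simp

lemma ok.sg_step {n : SBNode} (h : n.ok) (b : Bool) :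
    n.sg + 1 ≤ (n.step b).sg ∧ (n.step b).sg ≤ 2 * n.sg := by
  have h1 := h.q_pos; have h2 := h.q'_pos
  cases b <;> simp [sg, step] <;> constructor <;> linarith

lemma ok.sg_path {n : SBNode} (h : n.ok) (w : List Bool) :
    n.sg ≤ (n.path w).sg ∧ (n.path w).sg ≤ 2 ^ w.length * n.sg := by
  induction w generalizing n with
  | nil => simp [path]
  | cons b w ih =>
    have h1 := h.sg_step b
    have h2 := ih (h.stepOk b)
    simp only [path, List.length_cons, pow_succ]
    refine ⟨by linarith, h2.2.trans ?_⟩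
    have : (0:ℝ) < 2 ^ w.length := by positivity
    nlinarith

lemma ok.two_le_sg {n : SBNode} (h : n.ok) : 2 ≤ n.sg := by
  have h1 := h.q_pos; have h2 := h.q'_pos
  unfold sg; linarith

lemma ok.len_ge {n : SBNode} (h : n.ok) : 4 / n.sg ^ 2 ≤ n.len := by
  have h1 := h.q_pos; have h2 := h.q'_pos
  unfold len sg
  rw [div_le_div_iff₀ (by positivity) (by positivity)]
  nlinarith [sq_nonneg ((n.q:ℝ) - n.q')]

lemma ok.lo_le_med {n : SBNode} (h : n.ok) : n.lo ≤ (n.step true).lo ∧ (n.step true).lo ≤ n.hi ∧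
    (n.step false).hi = (n.step true).lo ∧ (n.step true).hi = n.hi ∧ (n.step false).lo = n.lo := by
  have h1 := (h.stepOk true).hi_sub_lo
  have h2 := (h.stepOk false).hi_sub_lo
  have h3 := (h.stepOk true).len_pos
  have h4 := (h.stepOk false).len_pos
  have e1 : (n.step false).hi = (n.step true).lo := by simp [step, hi, lo]
  have e2 : (n.step true).hi = n.hi := by simp [step, hi]
  have e3 : (n.step false).lo = n.lo := by simp [step, lo]
  refine ⟨by linarith, by linarith, e1, e2, e3⟩

def Cov (S : Finset ℝ) (L : ℝ) (n : SBNode) (c : ℝ) : Prop :=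
  ∃ T : Finset ℝ, (T.card : ℝ) ≤ c ∧ ∀ x ∈ S, n.lo ≤ x → x ≤ n.hi → ∃ t ∈ T, |x - t| ≤ L

lemma Cov.mono {S : Finset ℝ} {L : ℝ} {n : SBNode} {c c' : ℝ} (h : Cov S L n c) (hc : c ≤ c') :
    Cov S L n c' := by
  obtain ⟨T, h1, h2⟩ := h
  exact ⟨T, h1.trans hc, h2⟩

lemma Cov.join {S : Finset ℝ} {L : ℝ} {n : SBNode} (hn : n.ok) {c c' : ℝ}
    (h : Cov S L (n.step true) c) (h' : Cov S L (n.step false) c') : Cov S L n (c + c') := by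
  classical
  obtain ⟨T, h1, h2⟩ := h
  obtain ⟨T', h1', h2'⟩ := h'
  obtain ⟨a1, a2, a3, a4, a5⟩ := hn.lo_le_med
  refine ⟨T ∪ T', ?_, ?_⟩
  · have : ((T ∪ T').card : ℝ) ≤ T.card + T'.card := by exact_mod_cast Finset.card_union_le T T'
    linarith
  · intro x hx hl hh
    rcases le_total x (n.step true).lo with hm | hm
    · obtain ⟨t, ht, htx⟩ := h2' x hx (by rw [a5]; exact hl) (by rw [a3]; exact hm)
      exact ⟨t, Finset.mem_union_right _ ht, htx⟩
    · obtain ⟨t, ht, htx⟩ := h2 x hx hm (by rw [a4]; exact hh)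
      exact ⟨t, Finset.mem_union_left _ ht, htx⟩

lemma cov_base (S : Finset ℝ) {L : ℝ} (hL : 0 < L) {n : SBNode} (hn : n.ok) :
    Cov S L n (1 + n.len / L) := by
  classical
  refine ⟨(Finset.range (⌊n.len / L⌋₊ + 1)).image (fun i : ℕ => n.lo + i * L), ?_, ?_⟩
  · have h1 : (((Finset.range (⌊n.len / L⌋₊ + 1)).image (fun i : ℕ => n.lo + i * L)).card : ℝ)
        ≤ (⌊n.len / L⌋₊ + 1 : ℕ) := by
      exact_mod_cast Finset.card_image_le.trans (by simp)
    have h2 := Nat.floor_le (div_nonneg hn.len_pos.le hL.le)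
    push_cast at h1
    linarith
  · intro x hx hl hh
    have hlen := hn.hi_sub_lo
    have h0 : 0 ≤ (x - n.lo) / L := div_nonneg (by linarith) hL.le
    refine ⟨n.lo + (⌊(x - n.lo) / L⌋₊ : ℕ) * L, Finset.mem_image.2 ⟨_, ?_, rfl⟩, ?_⟩
    · rw [Finset.mem_range]
      apply Nat.lt_succ_of_le
      apply Nat.floor_mono
      gcongr; linarith
    · have h1 := Nat.floor_le h0
      have h2 := Nat.lt_floor_add_one ((x - n.lo) / L)
      rw [le_div_iff₀ hL] at h1
      rw [div_lt_iff₀ hL] at h2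
      rw [abs_le]; constructor <;> nlinarith

noncomputable def phi (η q q' : ℝ) : ℝ :=
  1 / (q * q') * ((q + q') ^ 2) ^ η * (1 + 24 * η * ((q' - q) / (q + q')) ^ 2)

lemma phi_symm (η q q' : ℝ) : phi η q q' = phi η q' q := by
  unfold phi
  rw [mul_comm q q', add_comm q q', div_pow, div_pow, ← neg_sub q q', neg_sq]

lemma cusp_poly (a : ℝ) (h0 : 0 ≤ a) (h1 : a ≤ 1/20) :
    8 * a * (1 - a) + 24 * ((1 - a) * ((1 - a) / (1 + a)) ^ 2 + a * (a / (2 - a)) ^ 2) ≤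
      24 * (1 - 2 * a) ^ 2 := by
  have e1 : (1 - a) * ((1 - a) / (1 + a)) ^ 2 ≤ 1 - 5 * a + 12 * a ^ 2 := by
    rw [div_pow, mul_div_assoc', div_le_iff₀ (by positivity)]
    nlinarith [mul_nonneg h0 h0, mul_nonneg (mul_nonneg h0 h0) h0,
      mul_nonneg (mul_nonneg (mul_nonneg h0 h0) h0) h0]
  have e2 : a * (a / (2 - a)) ^ 2 ≤ a ^ 2 := by
    have h2 : a / (2 - a) ≤ a := by
      rw [div_le_iff₀ (by linarith)]; nlinarith
    have h3 : 0 ≤ a / (2 - a) := div_nonneg h0 (by linarith)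
    nlinarith
  nlinarith

set_option maxHeartbeats 1000000 in
lemma phi_cusp {η q q' : ℝ} (hη : 0 < η) (hη' : 24 * η ≤ 1) (hq : 0 < q) (hq' : 0 < q')
    (hc : 20 * q ≤ q + q') : phi η (q + q') q' + phi η q (q + q') ≤ phi η q q' := by
  set s := q + q' with hs
  have hs0 : 0 < s := by positivity
  set a := q / s with ha
  have ha0 : 0 < a := by positivity
  have ha1 : a ≤ 1 / 20 := by rw [ha, div_le_iff₀ hs0]; linarith
  have hqa : q = a * s := by rw [ha]; field_simp
  have hqa' : q' = (1 - a) * s := by linarith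
  have e1 : (s + q') = (2 - a) * s := by rw [hqa']; ring
  have e2 : (q + s) = (1 + a) * s := by rw [hqa]; ring
  unfold phi
  have b1 : ((q + s) ^ 2) ^ η ≤ (1 + 2 * η * a) * (s ^ 2) ^ η := by
    rw [e2, mul_pow, Real.mul_rpow (by positivity) (by positivity)]
    gcongr
    rw [← Real.rpow_natCast, ← Real.rpow_mul (by positivity)]
    have := rpow_one_add_le_one_add_mul_self (s := a) (by linarith) (p := 2 * η)
      (by positivity) (by linarith)
    push_cast
    linarith
  have b2 : ((s + q') ^ 2) ^ η ≤ (1 + 2 * η * (1 - a)) * (s ^ 2) ^ η := by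
    have h2a : 0 ≤ 2 - a := by linarith
    rw [e1, mul_pow, Real.mul_rpow (by positivity) (by positivity)]
    gcongr
    rw [← Real.rpow_natCast, ← Real.rpow_mul (by positivity)]
    have := rpow_one_add_le_one_add_mul_self (s := 1 - a) (by linarith) (p := 2 * η)
      (by positivity) (by linarith)
    push_cast
    have h3 : 1 + (1 - a) = 2 - a := by ring
    rw [h3] at this
    linarith
  have g1 : ((s - q) / (q + s)) ^ 2 = ((1 - a) / (1 + a)) ^ 2 := by
    have : (s - q) / (q + s) = (1 - a) / (1 + a) := by
      rw [e2, hqa]; field_simp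
    rw [this]
  have g2 : ((q' - s) / (s + q')) ^ 2 = (a / (2 - a)) ^ 2 := by
    have h2a : 0 < 2 - a := by linarith
    have : (q' - s) / (s + q') = - (a / (2 - a)) := by
      rw [e1, hqa']; field_simp; ring
    rw [this, neg_sq]
  have g3 : ((q' - q) / s) ^ 2 = (1 - 2 * a) ^ 2 := by
    have : (q' - q) / s = 1 - 2 * a := by
      rw [hqa, hqa']; field_simp; ring
    rw [this]
  rw [g1, g2, ← hs, g3]
  have l1 : 1 / (s * q') = a * (1 / (q * q')) := by rw [hqa, hqa']; field_simp
  have l2 : 1 / (q * s) = (1 - a) * (1 / (q * q')) := by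
    have : 0 < 1 - a := by linarith
    rw [hqa, hqa']; field_simp
  rw [l1, l2]
  set P := 1 / (q * q') with hP
  have hP0 : 0 < P := by positivity
  set Z := (s ^ 2) ^ η
  have hZ : 0 < Z := by positivity
  have k1 : ((1 - a) / (1 + a)) ^ 2 ≤ 1 := by
    have : (1 - a) / (1 + a) ≤ 1 := by rw [div_le_one (by positivity)]; linarith
    have h0 : 0 ≤ (1 - a) / (1 + a) := div_nonneg (by linarith) (by linarith)
    nlinarith
  have k2 : (a / (2 - a)) ^ 2 ≤ 1 := by
    have : a / (2 - a) ≤ 1 := by rw [div_le_one (by linarith)]; linarith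
    have h0 : 0 ≤ a / (2 - a) := div_nonneg (by linarith) (by linarith)
    nlinarith
  have key := cusp_poly a ha0.le ha1
  set G1 := ((1 - a) / (1 + a)) ^ 2
  set G2 := (a / (2 - a)) ^ 2
  have hG1 : 0 ≤ G1 := by positivity
  have hG2 : 0 ≤ G2 := by positivity
  have h1a : 0 ≤ 1 - a := by linarith
  calc a * P * ((s + q') ^ 2) ^ η * (1 + 24 * η * G2) +
      (1 - a) * P * ((q + s) ^ 2) ^ η * (1 + 24 * η * G1)
      ≤ a * P * ((1 + 2 * η * (1 - a)) * Z) * (1 + 24 * η * G2) +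
      (1 - a) * P * ((1 + 2 * η * a) * Z) * (1 + 24 * η * G1) := by gcongr
    _ = P * Z * (a * (1 + 2 * η * (1 - a)) * (1 + 24 * η * G2) +
      (1 - a) * (1 + 2 * η * a) * (1 + 24 * η * G1)) := by ring
    _ ≤ P * Z * (1 + 24 * η * (1 - 2 * a) ^ 2) := by
      refine mul_le_mul_of_nonneg_left ?_ (by positivity)
      have m1 : 24 * η * G1 ≤ 1 := by nlinarith
      have m2 : 24 * η * G2 ≤ 1 := by nlinarith
      have m3 : 0 ≤ η * a * (1 - a) := by positivity
      have m4 := mul_le_mul_of_nonneg_left key hη.le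
      nlinarith [mul_le_mul_of_nonneg_left m1 m3, mul_le_mul_of_nonneg_left m2 m3]
    _ = _ := by ring

lemma path_cov {S : Finset ℝ} {L B : ℝ} (w : List Bool) (Q : SBNode → Prop)
    (hQ : ∀ n, Q n → n.ok → Cov S L n (B * n.len)) (n : SBNode) (hn : n.ok)
    (hsib : ∀ (u : List Bool) (b : Bool), u.length < w.length → Q ((n.path u).step b))
    (hw : ∀ x ∈ S, (n.path w).lo ≤ x → x ≤ (n.path w).hi → False) :
    Cov S L n (B * (n.len - (n.path w).len)) := by
  induction w generalizing n with
  | nil =>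
    refine ⟨∅, by simp [path], fun x hx h1 h2 => (hw x hx h1 h2).elim⟩
  | cons b w ih =>
    have h1 := ih (n.step b) (hn.stepOk b) (fun u c hu => by
      have := hsib (b :: u) c (by simpa using hu)
      simpa [path] using this) (by simpa [path] using hw)
    have h2 : Cov S L (n.step (!b)) (B * (n.step (!b)).len) :=
      hQ _ (hsib [] (!b) (by simp)) (hn.stepOk _)
    have hl := hn.len_step
    simp only [path]
    cases b
    · simp only [Bool.not_false] at h2
      refine (Cov.join hn h2 h1).mono (le_of_eq ?_)
      rw [← hl]; ring
    · simp only [Bool.not_true] at h2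
      refine (Cov.join hn h1 h2).mono (le_of_eq ?_)
      rw [← hl]; ring

lemma exists_eta (m : ℕ) : ∃ η : ℝ, 0 < η ∧ 24 * η ≤ 1 ∧
    ((4:ℝ) ^ m) ^ η * (1 + 24 * η) * (1 - 1 / (22 * 4 ^ m)) ≤ 1 := by
  have hc : ContinuousAt (fun η : ℝ => ((4:ℝ) ^ m) ^ η * (1 + 24 * η) * (1 - 1 / (22 * 4 ^ m))) 0 := by
    have : ((4:ℝ) ^ m) ≠ 0 := by positivity
    have h1 : ContinuousAt (fun η : ℝ => ((4:ℝ) ^ m) ^ η) 0 :=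
      Real.continuousAt_const_rpow this
    fun_prop
  have hlt : ((4:ℝ) ^ m) ^ (0:ℝ) * (1 + 24 * 0) * (1 - 1 / (22 * 4 ^ m)) < 1 := by
    have : (0:ℝ) < 1 / (22 * 4 ^ m) := by positivity
    simp only [Real.rpow_zero]; linarith
  have h2 := hc.eventually (Iio_mem_nhds hlt)
  have h3 : ∀ᶠ η : ℝ in nhds 0, η < 1 / 24 := Iio_mem_nhds (by norm_num)
  have h4 := (h2.and h3).filter_mono (nhdsWithin_le_nhds (s := Set.Ioi (0:ℝ)))
  obtain ⟨η, h5, h6⟩ := (h4.and self_mem_nhdsWithin).exists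
  exact ⟨η, h6, by linarith [h5.2], le_of_lt h5.1⟩


lemma len_phi_le {η : ℝ} (hη : 0 < η) {n : SBNode} (hn : n.ok) :
    n.len * (n.sg ^ 2) ^ η ≤ phi η n.q n.q' ∧
    phi η n.q n.q' ≤ (1 + 24 * η) * (n.sg ^ 2) ^ η * n.len := by
  have h1 := hn.q_pos; have h2 := hn.q'_pos
  have hl := hn.len_pos
  have hz : 0 < (n.sg ^ 2) ^ η := by
    have := hn.two_le_sg
    positivity
  have hG : (((n.q':ℝ) - n.q) / (n.q + n.q')) ^ 2 ≤ 1 := by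
    rw [sq_le_one_iff_abs_le_one, abs_le, le_div_iff₀ (by positivity), div_le_iff₀ (by positivity)]
    constructor <;> linarith
  have hG0 : 0 ≤ (((n.q':ℝ) - n.q) / (n.q + n.q')) ^ 2 := by positivity
  have e : phi η n.q n.q' = n.len * (n.sg ^ 2) ^ η *
      (1 + 24 * η * (((n.q':ℝ) - n.q) / (n.q + n.q')) ^ 2) := rfl
  rw [e]
  have hp : 0 < n.len * (n.sg ^ 2) ^ η := by positivity
  constructor
  · have : 0 ≤ 24 * η * (((n.q':ℝ) - n.q) / (n.q + n.q')) ^ 2 := by positivity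
    nlinarith
  · have : 24 * η * (((n.q':ℝ) - n.q) / (n.q + n.q')) ^ 2 ≤ 24 * η := by nlinarith
    nlinarith

set_option maxHeartbeats 1000000 in
lemma cov_main (w : List Bool) {η : ℝ} (hη : 0 < η) (hη' : 24 * η ≤ 1)
    (hη'' : ((4:ℝ) ^ w.length) ^ η * (1 + 24 * η) * (1 - 1 / (22 * 4 ^ w.length)) ≤ 1)
    (S : Finset ℝ) {L ℓ : ℝ} (hL : 0 < L) (hℓ : 0 < ℓ)
    (hS : ∀ n : SBNode, n.ok → n.len < ℓ → ∀ x ∈ S, (n.path w).lo ≤ x → x ≤ (n.path w).hi → False)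
    (k : ℕ) : ∀ n : SBNode, n.ok → 1 ≤ L * (n.sg + k) ^ 2 → n.sg ^ 2 * L ≤ 1 → 25 ≤ n.sg ^ 2 * ℓ →
      Cov S L n (2 * 4 ^ (w.length + 1) * L ^ (-1 + η) * phi η n.q n.q') := by
  set C1 := 2 * 4 ^ (w.length + 1) * L ^ (-1 + η) with hC1
  have hC1p : 0 < C1 := by positivity
  induction k using Nat.strong_induction_on with
  | _ k ih =>
  intro n hn hk hub hlb
  have hs2 := hn.two_le_sg
  have hlen := hn.len_pos
  have h1 := hn.q_pos
  have h2 := hn.q'_pos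
  by_cases hbase : 1 ≤ n.sg ^ 2 * L * 4 ^ (w.length + 1)
  · refine (cov_base S hL hn).mono ?_
    have ha : 4 * L ≤ n.len := by
      refine le_trans ?_ hn.len_ge
      rw [le_div_iff₀ (by positivity)]
      nlinarith
    have hb : 1 + n.len / L ≤ 2 * n.len / L := by
      rw [mul_div_assoc, two_mul]
      have : 1 ≤ n.len / L := by rw [le_div_iff₀ hL]; linarith
      linarith
    have hc : L ^ (-η) ≤ 4 ^ (w.length + 1) * (n.sg ^ 2) ^ η := by
      have e1 : L⁻¹ ≤ n.sg ^ 2 * 4 ^ (w.length + 1) := by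
        rw [inv_le_iff_one_le_mul₀ hL]; linarith
      rw [Real.rpow_neg hL.le, ← Real.inv_rpow hL.le]
      calc L⁻¹ ^ η ≤ (n.sg ^ 2 * 4 ^ (w.length + 1)) ^ η := by gcongr
        _ = (n.sg ^ 2) ^ η * (4 ^ (w.length + 1)) ^ η :=
          Real.mul_rpow (by positivity) (by positivity)
        _ ≤ (n.sg ^ 2) ^ η * (4 ^ (w.length + 1)) ^ (1:ℝ) := by
          gcongr
          · exact one_le_pow₀ (by norm_num)
          · linarith
        _ = _ := by rw [Real.rpow_one]; ring
    have hd := (len_phi_le hη hn).1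
    have e2 : L ^ (-1 + η) * L ^ (-η) = L⁻¹ := by
      rw [← Real.rpow_add hL]; ring_nf; rw [Real.rpow_neg_one]
    calc 1 + n.len / L ≤ 2 * n.len / L := hb
      _ = 2 * n.len * (L ^ (-1 + η) * L ^ (-η)) := by rw [e2]; rfl
      _ ≤ 2 * n.len * (L ^ (-1 + η) * (4 ^ (w.length + 1) * (n.sg ^ 2) ^ η)) := by gcongr
      _ = C1 * (n.len * (n.sg ^ 2) ^ η) := by rw [hC1]; ring
      _ ≤ _ := by gcongr
  push Not at hbase
  -- descendants obey the induction hypothesis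
  have hdesc : ∀ (u : List Bool) (b : Bool), u.length ≤ w.length →
      Cov S L ((n.path u).step b) (C1 * phi η ((n.path u).step b).q ((n.path u).step b).q') := by
    intro u b hu
    have hk0 : 1 ≤ k := by
      by_contra hcon
      have : k = 0 := by omega
      subst this
      have h4 : (1:ℝ) ≤ 4 ^ (w.length + 1) := one_le_pow₀ (by norm_num)
      simp only [Nat.cast_zero, add_zero] at hk
      nlinarith [mul_pos hL (by positivity : 0 < n.sg ^ 2)]
    have hok := (hn.pathOk u)
    have s1 := hn.sg_path u
    have s2 := hok.sg_step b
    have hge : n.sg + 1 ≤ ((n.path u).step b).sg := by linarith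
    have hle : ((n.path u).step b).sg ≤ 2 ^ (w.length + 1) * n.sg := by
      have : (2:ℝ) ^ u.length ≤ 2 ^ w.length := pow_le_pow_right₀ (by norm_num) hu
      rw [pow_succ]; nlinarith
    refine ih (k - 1) (by omega) _ (hok.stepOk b) ?_ ?_ ?_
    · refine hk.trans ?_
      have : ((k - 1 : ℕ) : ℝ) = k - 1 := by push_cast [hk0]; ring
      rw [this]
      have : n.sg + k ≤ ((n.path u).step b).sg + (k - 1) := by linarith
      gcongr
    · have e : ((2:ℝ) ^ (w.length + 1) * n.sg) ^ 2 = 4 ^ (w.length + 1) * n.sg ^ 2 := by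
        rw [mul_pow, ← pow_mul, mul_comm (w.length + 1) 2, pow_mul]; norm_num
      calc _ ≤ (2 ^ (w.length + 1) * n.sg) ^ 2 * L := by gcongr; linarith
        _ ≤ 1 := by rw [e]; linarith
    · refine hlb.trans ?_
      gcongr; linarith
  by_cases hcusp1 : 20 * (n.q:ℝ) ≤ n.q + n.q'
  · have a1 := hdesc [] true (by simp)
    have a2 := hdesc [] false (by simp)
    refine (Cov.join hn a1 a2).mono ?_
    simp only [path, step, if_true, Bool.false_eq_true, if_false]
    push_cast
    rw [← mul_add]
    exact mul_le_mul_of_nonneg_left (phi_cusp hη hη' (by linarith) (by linarith) hcusp1) hC1p.le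
  by_cases hcusp2 : 20 * (n.q':ℝ) ≤ n.q + n.q'
  · have a1 := hdesc [] true (by simp)
    have a2 := hdesc [] false (by simp)
    refine (Cov.join hn a1 a2).mono ?_
    simp only [path, step, if_true, Bool.false_eq_true, if_false]
    push_cast
    rw [← mul_add]
    refine mul_le_mul_of_nonneg_left ?_ hC1p.le
    have := phi_cusp (q := n.q') (q' := n.q) hη hη' (by linarith) (by linarith) (by linarith)
    rw [phi_symm η n.q n.q', phi_symm η ((n.q:ℝ) + n.q') n.q', phi_symm η n.q ((n.q:ℝ) + n.q'),
      add_comm (n.q:ℝ)]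
    linarith
  push Not at hcusp1 hcusp2
  -- core
  set α : ℝ := n.sg with hα
  have hsg : n.sg = n.q + n.q' := rfl
  have hcore : 19 * n.sg ^ 2 ≤ 400 * (n.q * n.q') := by
    rw [hsg]; nlinarith
  have hlen1 : n.len * (19 * n.sg ^ 2) ≤ 400 := by
    unfold len
    rw [div_mul_eq_mul_div, div_le_iff₀ (by positivity)]; linarith
  have hlenℓ : n.len < ℓ := by
    have : 0 < n.sg ^ 2 := by positivity
    by_contra hcon
    push Not at hcon
    have : n.sg ^ 2 * ℓ ≤ n.sg ^ 2 * n.len := by gcongr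
    nlinarith
  have hns := hS n hn hlenℓ
  set B := C1 * (1 + 24 * η) * ((4:ℝ) ^ w.length * n.sg ^ 2) ^ η with hB
  have hBp : 0 < B := by positivity
  have hpath := path_cov (B := B) w (fun n' => Cov S L n' (B * n'.len)) (fun _ h _ => h) n hn
    (fun u b hu => by
      refine (hdesc u b hu.le).mono ?_
      have hok := (hn.pathOk u)
      have s1 := hn.sg_path u
      have s2 := hok.sg_step b
      have hle : ((n.path u).step b).sg ≤ 2 ^ w.length * n.sg := by
        have : (2:ℝ) ^ (u.length + 1) ≤ 2 ^ w.length := pow_le_pow_right₀ (by norm_num) hu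
        rw [pow_succ] at this; nlinarith
      have hge0 : 0 ≤ ((n.path u).step b).sg := by linarith
      have hle2 : ((n.path u).step b).sg ^ 2 ≤ 4 ^ w.length * n.sg ^ 2 := by
        calc _ ≤ (2 ^ w.length * n.sg) ^ 2 := by gcongr
          _ = _ := by rw [mul_pow, ← pow_mul, mul_comm w.length 2, pow_mul]; norm_num
      have hlen' := (hok.stepOk b).len_pos
      calc _ ≤ C1 * ((1 + 24 * η) * (((n.path u).step b).sg ^ 2) ^ η * ((n.path u).step b).len) := by
            gcongr; exact (len_phi_le hη (hok.stepOk b)).2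
        _ ≤ C1 * ((1 + 24 * η) * ((4:ℝ) ^ w.length * n.sg ^ 2) ^ η * ((n.path u).step b).len) := by
            gcongr
        _ = _ := by rw [hB]; ring) hns
  refine hpath.mono ?_
  have hd := (len_phi_le hη hn).1
  have hwl : 1 / (22 * 4 ^ w.length) * n.len ≤ (n.path w).len := by
    refine le_trans ?_ (hn.pathOk w).len_ge
    have s1 := hn.sg_path w
    have hle2 : (n.path w).sg ^ 2 ≤ 4 ^ w.length * n.sg ^ 2 := by
      have : 0 ≤ (n.path w).sg := by linarith
      calc _ ≤ (2 ^ w.length * n.sg) ^ 2 := by gcongr; exact s1.2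
        _ = _ := by rw [mul_pow, ← pow_mul, mul_comm w.length 2, pow_mul]; norm_num
    have hp0 : 0 < (n.path w).sg := by linarith
    rw [le_div_iff₀ (by positivity), one_div, inv_mul_eq_div, div_mul_eq_mul_div,
      div_le_iff₀ (by positivity)]
    have h4 : (0:ℝ) < 4 ^ w.length := by positivity
    calc n.len * (n.path w).sg ^ 2 ≤ n.len * (4 ^ w.length * n.sg ^ 2) := by gcongr
      _ = 4 ^ w.length * (n.len * n.sg ^ 2) := by ring
      _ ≤ 4 ^ w.length * 88 := by gcongr; linarith
      _ = _ := by ring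
  have hZ : 0 < (n.sg ^ 2) ^ η := by positivity
  calc B * (n.len - (n.path w).len) ≤ B * (n.len - 1 / (22 * 4 ^ w.length) * n.len) := by gcongr
    _ = C1 * (n.len * (n.sg ^ 2) ^ η) *
        (((4:ℝ) ^ w.length) ^ η * (1 + 24 * η) * (1 - 1 / (22 * 4 ^ w.length))) := by
      rw [hB, Real.mul_rpow (by positivity) (by positivity)]; ring
    _ ≤ C1 * (n.len * (n.sg ^ 2) ^ η) * 1 := by
      gcongr
    _ ≤ _ := by rw [mul_one]; gcongr

/-- The covering lemma. -/
theorem covering (w : List Bool) : ∃ η C : ℝ, 0 < η ∧ 0 < C ∧ ∀ (S : Finset ℝ) (L ℓ : ℝ),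
    0 < L → 100 * L ≤ ℓ → ℓ ≤ 1 → (∀ x ∈ S, 0 ≤ x ∧ x ≤ 1) →
    (∀ n : SBNode, n.ok → n.len < ℓ → ∀ x ∈ S, (n.path w).lo ≤ x → x ≤ (n.path w).hi → False) →
    ∃ T : Finset ℝ, (T.card : ℝ) ≤ C / L * (L / ℓ) ^ η ∧ ∀ x ∈ S, ∃ t ∈ T, |x - t| ≤ L := by
  obtain ⟨η, hη, hη', hη''⟩ := exists_eta w.length
  refine ⟨η, 2 * 4 ^ (w.length + 1) * (1 + 24 * η) * 100 ^ η, hη, by positivity, ?_⟩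
  intro S L ℓ hL hLℓ hℓ1 hS01 hS
  have hℓ : 0 < ℓ := by linarith
  set C1 := 2 * 4 ^ (w.length + 1) * L ^ (-1 + η) with hC1
  have hC1p : 0 < C1 := by positivity
  set B1 := C1 * (1 + 24 * η) * (100 / ℓ) ^ η with hB1
  have phase : ∀ k : ℕ, ∀ n : SBNode, n.ok → 25 ≤ (n.sg + k) ^ 2 * ℓ → n.sg ^ 2 * ℓ ≤ 100 →
      Cov S L n (B1 * n.len) := by
    intro k
    induction k with
    | zero =>
      intro n hn h1 h2
      simp only [Nat.cast_zero, add_zero] at h1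
      obtain ⟨k, hk⟩ := exists_nat_ge (1 / L)
      have hs2 := hn.two_le_sg
      have hlen := hn.len_pos
      have := cov_main w hη hη' hη'' S hL hℓ hS (k + 1) n hn (by
        push_cast
        rw [div_le_iff₀ hL] at hk
        have : (0:ℝ) ≤ k := by positivity
        nlinarith) (by nlinarith [mul_le_mul_of_nonneg_left hLℓ (sq_nonneg n.sg)]) h1
      refine this.mono ?_
      calc _ ≤ C1 * ((1 + 24 * η) * (n.sg ^ 2) ^ η * n.len) := by
            gcongr; exact (len_phi_le hη hn).2
        _ ≤ C1 * ((1 + 24 * η) * (100 / ℓ) ^ η * n.len) := by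
            gcongr
            rw [le_div_iff₀ hℓ]; exact h2
        _ = _ := by rw [hB1]; ring
    | succ k ih =>
      intro n hn h1 h2
      have hs2 := hn.two_le_sg
      by_cases h25 : 25 ≤ n.sg ^ 2 * ℓ
      · refine ih n hn (h25.trans ?_) h2
        have : (0:ℝ) ≤ k := by positivity
        gcongr; linarith
      · push Not at h25
        have hc : ∀ b, Cov S L (n.step b) (B1 * (n.step b).len) := by
          intro b
          have s := hn.sg_step b
          refine ih _ (hn.stepOk b) (h1.trans ?_) ?_
          · push_cast
            gcongr ?_ ^ 2 * ℓ
            linarith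
          · calc _ ≤ (2 * n.sg) ^ 2 * ℓ := by gcongr; linarith; exact s.2
              _ ≤ 100 := by nlinarith
        refine (Cov.join hn (hc true) (hc false)).mono ?_
        rw [← mul_add, hn.len_step]
  have hroot : (⟨0, 1, 1, 1⟩ : SBNode).ok := by simp [ok]
  obtain ⟨k, hk⟩ := exists_nat_ge (25 / ℓ)
  have := phase (k + 1) ⟨0, 1, 1, 1⟩ hroot (by
    simp only [sg]
    push_cast
    rw [div_le_iff₀ hℓ] at hk
    have : (0:ℝ) ≤ k := by positivity
    nlinarith) (by simp only [sg]; norm_num; linarith)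
  obtain ⟨T, hT, hx⟩ := this
  refine ⟨T, hT.trans (le_of_eq ?_), ?_⟩
  · rw [hB1, hC1]
    simp only [len]
    rw [Real.div_rpow (by norm_num) hℓ.le, Real.div_rpow hL.le hℓ.le, Real.rpow_add hL,
      Real.rpow_neg_one]
    push_cast
    field_simp
  · intro x hxS
    have := hS01 x hxS
    exact hx x hxS (by simpa [lo] using this.1) (by simpa [hi] using this.2)

end SBNode

/-! ## Part E: from the open set to a word -/

section QF
variable {R : Type*} [CommRing R]

def qfA (p q r s a b c : R) : R := a * p ^ 2 + b * p * r + c * r ^ 2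
def qfB (p q r s a b c : R) : R := 2 * a * p * q + b * (p * s + q * r) + 2 * c * r * s
def qfC (p q r s a b c : R) : R := a * q ^ 2 + b * q * s + c * s ^ 2

lemma qf_disc (p q r s a b c : R) (h : p * s - q * r = 1) :
    (qfB p q r s a b c) ^ 2 - 4 * qfA p q r s a b c * qfC p q r s a b c = b ^ 2 - 4 * a * c := by
  have : (qfB p q r s a b c) ^ 2 - 4 * qfA p q r s a b c * qfC p q r s a b c
      = (b ^ 2 - 4 * a * c) * (p * s - q * r) ^ 2 := by
    unfold qfA qfB qfC; ring
  rw [this, h]; ring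

end QF

lemma qf_prim (p q r s a b c : ℤ) (h : p * s - q * r = 1)
    (hg : Int.gcd a (Int.gcd b c) = 1) :
    Int.gcd (qfA p q r s a b c) (Int.gcd (qfB p q r s a b c) (qfC p q r s a b c)) = 1 := by
  set A := qfA p q r s a b c with hA
  set B := qfB p q r s a b c with hB
  set C := qfC p q r s a b c with hC
  set g := Int.gcd A (Int.gcd B C) with hgd
  have h1 : (g:ℤ) ∣ A := Int.gcd_dvd_left ..
  have h2' : (g:ℤ) ∣ (Int.gcd B C : ℤ) := Int.gcd_dvd_right ..
  have h2 : (g:ℤ) ∣ B := h2'.trans (Int.gcd_dvd_left ..)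
  have h3 : (g:ℤ) ∣ C := h2'.trans (Int.gcd_dvd_right ..)
  have hD : (p * s - q * r) ^ 2 = 1 := by rw [h]; ring
  have e1 : a = A * s ^ 2 - B * s * r + C * r ^ 2 := by
    have : A * s ^ 2 - B * s * r + C * r ^ 2 = a * (p * s - q * r) ^ 2 := by
      rw [hA, hB, hC]; unfold qfA qfB qfC; ring
    rw [this, hD]; ring
  have e2 : b = -2 * A * s * q + B * (p * s + q * r) - 2 * C * r * p := by
    have : -2 * A * s * q + B * (p * s + q * r) - 2 * C * r * p = b * (p * s - q * r) ^ 2 := by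
      rw [hA, hB, hC]; unfold qfA qfB qfC; ring
    rw [this, hD]; ring
  have e3 : c = A * q ^ 2 - B * q * p + C * p ^ 2 := by
    have : A * q ^ 2 - B * q * p + C * p ^ 2 = c * (p * s - q * r) ^ 2 := by
      rw [hA, hB, hC]; unfold qfA qfB qfC; ring
    rw [this, hD]; ring
  have d1 : (g:ℤ) ∣ a := by
    rw [e1]; exact dvd_add (dvd_sub (h1.mul_right _) (by rw [mul_assoc]; exact h2.mul_right _)) (h3.mul_right _)
  have d2 : (g:ℤ) ∣ b := by
    rw [e2]
    refine dvd_sub (dvd_add ?_ (h2.mul_right _)) ?_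
    · rw [mul_assoc, mul_assoc]; exact (h1.mul_right _).mul_left _
    · rw [mul_assoc, mul_assoc]; exact (h3.mul_right _).mul_left _
  have d3 : (g:ℤ) ∣ c := by
    rw [e3]; exact dvd_add (dvd_sub (h1.mul_right _) (by rw [mul_assoc]; exact h2.mul_right _)) (h3.mul_right _)
  have := Int.dvd_coe_gcd d1 (Int.dvd_coe_gcd d2 d3)
  rw [hg] at this
  have := Int.natCast_dvd_natCast.1 (by exact_mod_cast this : (g:ℤ) ∣ ((1:ℕ):ℤ))
  exact Nat.dvd_one.1 this

namespace SBNode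

def mulN (n m : SBNode) : SBNode :=
  ⟨n.p' * m.p + n.p * m.q, n.q' * m.p + n.q * m.q, n.p' * m.p' + n.p * m.q',
    n.q' * m.p' + n.q * m.q'⟩

def root : SBNode := ⟨0, 1, 1, 0⟩

lemma step_mulN (b : Bool) (n m : SBNode) : (mulN n m).step b = mulN n (m.step b) := by
  cases b <;> simp [mulN, step] <;> constructor <;> ring

lemma path_mulN (w : List Bool) (n m : SBNode) : (mulN n m).path w = mulN n (m.path w) := by
  induction w generalizing m with
  | nil => rfl
  | cons b w ih => simp only [path, step_mulN, ih]

lemma path_eq_mulN (w : List Bool) (n : SBNode) : n.path w = mulN n (root.path w) := by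
  rw [← path_mulN]
  congr 1
  simp [mulN, root]

lemma path_append (u w : List Bool) (n : SBNode) : n.path (u ++ w) = (n.path u).path w := by
  induction u generalizing n with
  | nil => rfl
  | cons b u ih => simp only [List.cons_append, path, ih]

lemma exists_word_mediant (k : ℕ) : ∀ u v : ℕ, u + v ≤ k → 1 ≤ u → 1 ≤ v → Nat.Coprime u v →
    ∃ w : List Bool, (root.path w).p + (root.path w).p' = u ∧ (root.path w).q + (root.path w).q' = v := by
  induction k with
  | zero => intro u v h h1 h2; omega
  | succ k ih =>
    intro u v h h1 h2 hc
    rcases lt_trichotomy u v with huv | huv | huv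
    · obtain ⟨w, hw1, hw2⟩ := ih u (v - u) (by omega) h1 (by omega)
        ((Nat.coprime_sub_self_right huv.le).2 hc)
      refine ⟨false :: w, ?_⟩
      have : root.path (false :: w) = mulN (root.step false) (root.path w) := by
        rw [← path_eq_mulN]; rfl
      rw [this]
      simp only [mulN, step, root, Bool.false_eq_true, if_false] at hw1 hw2 ⊢
      push_cast [huv.le] at hw2
      constructor <;> linarith
    · subst huv
      have : u = 1 := by simpa using hc
      subst this
      exact ⟨[], by simp [path, root], by simp [path, root]⟩
    · obtain ⟨w, hw1, hw2⟩ := ih (u - v) v (by omega) (by omega) h2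
        ((Nat.coprime_sub_self_left huv.le).2 hc)
      refine ⟨true :: w, ?_⟩
      have : root.path (true :: w) = mulN (root.step true) (root.path w) := by
        rw [← path_eq_mulN]; rfl
      rw [this]
      simp only [mulN, step, root, if_true] at hw1 hw2 ⊢
      push_cast [huv.le] at hw1
      constructor <;> linarith

lemma path_false (k : ℕ) (n : SBNode) : n.path (List.replicate k false) =
    ⟨n.p, n.q, n.p' + k * n.p, n.q' + k * n.q⟩ := by
  induction k generalizing n with
  | zero => simp [path]
  | succ k ih =>
    simp only [List.replicate_succ, path, ih]
    simp only [step, Bool.false_eq_true, if_false]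
    push_cast
    congr 1 <;> ring

def semiok (n : SBNode) : Prop := n.p' * n.q - n.p * n.q' = 1 ∧ 0 ≤ n.p ∧ 1 ≤ n.q ∧ 1 ≤ n.p' ∧ 0 ≤ n.q'

lemma semiok_path (w : List Bool) (n : SBNode) (h : n.semiok) : (n.path w).semiok := by
  induction w generalizing n with
  | nil => exact h
  | cons b w ih =>
    apply ih
    obtain ⟨h1, h2, h3, h4, h5⟩ := h
    cases b
    · refine ⟨?_, ?_, ?_, ?_, ?_⟩ <;> simp [SBNode.step] <;> linarith
    · refine ⟨?_, ?_, ?_, ?_, ?_⟩ <;> simp [SBNode.step] <;> linarith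

lemma exists_word (z₁ z₂ : ℝ) (h0 : 0 < z₁) (h12 : z₁ < z₂) : ∃ w : List Bool,
    1 ≤ (root.path w).q ∧ 1 ≤ (root.path w).q' ∧
    z₁ * (root.path w).q < (root.path w).p ∧ (root.path w).p' < z₂ * (root.path w).q' := by
  obtain ⟨t, ht1, ht2⟩ := exists_rat_btwn h12
  have htpos : 0 < t := by exact_mod_cast h0.trans ht1
  have hnum : 0 < t.num := Rat.num_pos.2 htpos
  obtain ⟨w, hw1, hw2⟩ := exists_word_mediant (t.num.natAbs + t.den) t.num.natAbs t.den le_rfl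
    (by omega) t.den_pos t.reduced
  have hnA : ((t.num.natAbs : ℕ) : ℤ) = t.num := Int.natAbs_of_nonneg hnum.le
  rw [hnA] at hw1
  obtain ⟨k, hk⟩ := exists_nat_gt (1 / (z₂ - t))
  have hz : 0 < z₂ - t := by linarith
  rw [div_lt_iff₀ hz] at hk
  have hso := semiok_path w root (by simp [semiok, root])
  set m := root.path w with hm
  refine ⟨w ++ (true :: List.replicate k false), ?_⟩
  have e : root.path (w ++ (true :: List.replicate k false)) =
      ⟨t.num, t.den, m.p' + k * t.num, m.q' + k * t.den⟩ := by
    rw [path_append, ← hm, path, path_false]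
    simp only [step, if_true, hw1, hw2]
  rw [e]
  obtain ⟨s1, s2, s3, s4, s5⟩ := hso
  have hden : (1:ℤ) ≤ t.den := by exact_mod_cast t.den_pos
  have hdenR : (1:ℝ) ≤ t.den := by exact_mod_cast t.den_pos
  have htR : (t:ℝ) * t.den = t.num := by exact_mod_cast Rat.mul_den_eq_num t
  have hkpos : 1 ≤ k := by
    by_contra hcon
    have : k = 0 := by omega
    subst this; simp at hk; linarith
  have hkZ : (1:ℤ) ≤ k := by exact_mod_cast hkpos
  have hdet : m.p' * (t.den:ℤ) - t.num * m.q' = 1 := by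
    rw [← hw1, ← hw2]; linarith
  have hdetR : (m.p':ℝ) * t.den - t.num * m.q' = 1 := by exact_mod_cast hdet
  refine ⟨hden, by simp only; nlinarith, ?_, ?_⟩
  · simp only; push_cast; rw [← htR]; nlinarith
  · simp only
    push_cast
    have hq'R : (0:ℝ) ≤ m.q' := by exact_mod_cast s5
    -- p' ≤ t q' + 1
    have hp' : (m.p':ℝ) ≤ t * m.q' + 1 := by
      have : (m.p':ℝ) * t.den = (t * m.q') * t.den + 1 := by rw [← htR] at hdetR; linarith
      have h3 : ((m.p':ℝ) - t * m.q') * t.den = 1 := by linarith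
      nlinarith
    have hkR : (1:ℝ) ≤ k := by exact_mod_cast hkpos
    rw [← htR]
    have : (k:ℝ) * (z₂ - t) ≤ k * t.den * (z₂ - t) := by
      have : (k:ℝ) ≤ k * t.den := by nlinarith
      gcongr
    nlinarith [mul_nonneg hq'R hz.le]

end SBNode

lemma psi_mob {e P f N y y' : ℝ} (h : e * N - f * P = 1) (h1 : f * y + N ≠ 0)
    (h2 : f * y' + N ≠ 0) (hy : y - y' ≠ 0) :
    1 / ((e * y + P) / (f * y + N) - (e * y' + P) / (f * y' + N)) =
      (f * y + N) * (f * y' + N) / (y - y') ∧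
    -((e * y + P) / (f * y + N) + (e * y' + P) / (f * y' + N)) /
      ((e * y + P) / (f * y + N) - (e * y' + P) / (f * y' + N)) =
      -((e * y + P) * (f * y' + N) + (e * y' + P) * (f * y + N)) / (y - y') ∧
    ((e * y + P) / (f * y + N) * ((e * y' + P) / (f * y' + N))) /
      ((e * y + P) / (f * y + N) - (e * y' + P) / (f * y' + N)) =
      (e * y + P) * (e * y' + P) / (y - y') := by
  have hs : (e * y + P) / (f * y + N) - (e * y' + P) / (f * y' + N) =
      (y - y') / ((f * y + N) * (f * y' + N)) := by
    rw [div_sub_div _ _ h1 h2]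
    congr 1
    linear_combination (y - y') * h
  rw [hs]
  refine ⟨?_, ?_, ?_⟩
  · rw [one_div_div]
  · rw [div_add_div _ _ h1 h2, ← neg_div,
      div_div_div_cancel_right₀ (mul_ne_zero h1 h2)]
    congr 2
    ring
  · rw [div_mul_div_comm, div_div_div_cancel_right₀ (mul_ne_zero h1 h2)]

lemma mob_sub_cusp {e P f N y : ℝ} (h : e * N - f * P = 1) (h1 : f * y + N ≠ 0) (h2 : N ≠ 0) :
    (e * y + P) / (f * y + N) - P / N = y / (N * (f * y + N)) := by
  rw [div_sub_div _ _ h1 h2, mul_comm N]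
  congr 1
  linear_combination y * h

lemma mob_inv {e P f N y : ℝ} (h : e * N - f * P = 1) (h1 : e - f * y ≠ 0) :
    f * ((N * y - P) / (e - f * y)) + N = 1 / (e - f * y) ∧
    (e * ((N * y - P) / (e - f * y)) + P) / (f * ((N * y - P) / (e - f * y)) + N) = y := by
  have a1 : f * ((N * y - P) / (e - f * y)) + N = 1 / (e - f * y) := by
    rw [eq_div_iff h1, add_mul, mul_assoc, div_mul_cancel₀ _ h1]
    linear_combination h
  have a2 : e * ((N * y - P) / (e - f * y)) + P = y / (e - f * y) := by
    rw [eq_div_iff h1, add_mul, mul_assoc, div_mul_cancel₀ _ h1]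
    linear_combination y * h
  refine ⟨a1, ?_⟩
  rw [a1, a2, div_div_div_cancel_right₀ h1, div_one]

set_option maxHeartbeats 1000000 in
/-- Existence of a good base change. -/
lemma exists_base_change {W : Set (ℝ × ℝ × ℝ)} (hW : IsOpen W) {A B C : ℝ} (hA : A ≠ 0)
    (hd : B ^ 2 - 4 * A * C = 1) (hmem : (A, B, C) ∈ W) :
    ∃ (p q r s : ℤ) (z₁ z₂ : ℝ), p * s - q * r = 1 ∧ 0 < z₁ ∧ z₁ < z₂ ∧
      ∀ y y' : ℝ, z₁ < y → y < z₂ → y' < 0 →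
        (qfA (p:ℝ) q r s (1 / (y - y')) (-(y + y') / (y - y')) (y * y' / (y - y')),
         qfB (p:ℝ) q r s (1 / (y - y')) (-(y + y') / (y - y')) (y * y' / (y - y')),
         qfC (p:ℝ) q r s (1 / (y - y')) (-(y + y') / (y - y')) (y * y' / (y - y'))) ∈ W := by
  set y0 := (-B + 1) / (2 * A) with hy0
  set y0' := (-B - 1) / (2 * A) with hy0'
  have hdiff : y0 - y0' = 1 / A := by rw [hy0, hy0']; field_simp; ring
  have hne : y0 - y0' ≠ 0 := by rw [hdiff]; positivity
  let Ψ : ℝ × ℝ → ℝ × ℝ × ℝ := fun z =>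
    (1 / (z.1 - z.2), -(z.1 + z.2) / (z.1 - z.2), z.1 * z.2 / (z.1 - z.2))
  have hΨ0 : Ψ (y0, y0') = (A, B, C) := by
    simp only [Ψ, hdiff]
    have h1 : y0 + y0' = -B / A := by rw [hy0, hy0']; field_simp; ring
    have h2 : y0 * y0' = C / A := by
      rw [hy0, hy0']; field_simp; linarith
    rw [h1, h2]
    field_simp
  have hcont : ContinuousAt Ψ (y0, y0') := by
    have : (y0, y0').1 - (y0, y0').2 ≠ 0 := hne
    refine ContinuousAt.prodMk ?_ (ContinuousAt.prodMk ?_ ?_)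
    · exact continuousAt_const.div (by fun_prop) this
    · exact ContinuousAt.div (by fun_prop) (by fun_prop) this
    · exact ContinuousAt.div (by fun_prop) (by fun_prop) this
  have hev : Ψ ⁻¹' W ∈ nhds (y0, y0') := hcont (hW.mem_nhds (by rw [hΨ0]; exact hmem))
  obtain ⟨δ, hδ, hball⟩ := Metric.mem_nhds_iff.1 hev
  -- the radius
  set δ' := min δ (|y0 - y0'| / 2) with hδ'
  have hδ'0 : 0 < δ' := lt_min hδ (by positivity)
  obtain ⟨t, ht1, ht2⟩ := exists_rat_btwn (show y0' - δ' / 2 < y0' by linarith)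
  set P : ℤ := t.num with hP
  set N : ℤ := (t.den : ℤ) with hN
  have hN1 : 1 ≤ N := by rw [hN]; exact_mod_cast t.den_pos
  have hNR : (1:ℝ) ≤ N := by exact_mod_cast hN1
  have htR : (t:ℝ) * N = P := by rw [hN, hP]; exact_mod_cast Rat.mul_den_eq_num t
  have hcop : IsCoprime P N := by
    rw [Int.isCoprime_iff_gcd_eq_one]; simpa [Int.gcd, hP, hN] using t.reduced
  obtain ⟨u, v, huv⟩ := hcop
  have hsep : |y0 - t| > δ' / 2 := by
    have h1 : |y0 - y0'| ≤ |y0 - t| + |t - y0'| := abs_sub_le _ _ _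
    have h2 : |(t:ℝ) - y0'| ≤ δ' / 2 := by rw [abs_le]; constructor <;> linarith
    have h3 : δ' ≤ |y0 - y0'| / 2 := min_le_right _ _
    linarith
  -- f = -u - j N, e = v - j P
  obtain ⟨j, hj⟩ := exists_nat_gt (|(u:ℝ)| + 4 / δ' + 2 / δ')
  set f : ℤ := -u - j * N with hf
  set e : ℤ := v - j * P with he
  have hdet : e * N - f * P = 1 := by rw [hf, he]; linarith
  have hdetR : (e:ℝ) * N - f * P = 1 := by exact_mod_cast hdet
  have hfR : (f:ℝ) < - (4 / δ' + 2 / δ') := by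
    rw [hf]; push_cast
    have := neg_abs_le (u:ℝ)
    have : (j:ℝ) ≤ j * N := by nlinarith [(Nat.cast_nonneg j : (0:ℝ) ≤ j)]
    linarith
  have h4δ : 0 < 4 / δ' := by positivity
  have h2δ : 0 < 2 / δ' := by positivity
  have hf0 : (f:ℝ) < 0 := by linarith
  have hfδ1 : - (f:ℝ) * δ' > 4 := by
    have : (-(f:ℝ)) > 4 / δ' := by linarith
    rw [gt_iff_lt, div_lt_iff₀ hδ'0] at this; linarith
  -- z0
  have hden : (e:ℝ) - f * y0 = 1 / N + (-f) * (y0 - t) := by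
    have hN0 : (N:ℝ) ≠ 0 := by positivity
    field_simp
    linear_combination hdetR - f * htR
  have hnum : (N:ℝ) * y0 - P = N * (y0 - t) := by rw [← htR]; ring
  have h1N : 1 / (N:ℝ) ≤ 1 := by rw [div_le_one (by positivity)]; exact hNR
  have h1N0 : 0 < 1 / (N:ℝ) := by positivity
  set z0 := (N * y0 - P) / (e - f * y0) with hz0
  have hsgn : (e:ℝ) - f * y0 ≠ 0 ∧ 0 < z0 := by
    rcases lt_or_ge 0 (y0 - t) with h | h
    · have h1 : 0 < (e:ℝ) - f * y0 := by
        rw [hden]; have : 0 < -(f:ℝ) * (y0 - t) := mul_pos (by linarith) h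
        linarith
      exact ⟨h1.ne', div_pos (by rw [hnum]; positivity) h1⟩
    · rw [abs_of_nonpos h] at hsep
      have h1 : (e:ℝ) - f * y0 < 0 := by
        rw [hden]; nlinarith
      refine ⟨h1.ne, div_pos_of_neg_of_neg ?_ h1⟩
      rw [hnum]; nlinarith
  obtain ⟨hden0, hz0pos⟩ := hsgn
  have hfz : (f:ℝ) * z0 + N = 1 / (e - f * y0) := (mob_inv hdetR hden0).1
  have hfz0 : (f:ℝ) * z0 + N ≠ 0 := by rw [hfz]; exact one_div_ne_zero hden0
  have hhz0 : ((e:ℝ) * z0 + P) / (f * z0 + N) = y0 := (mob_inv hdetR hden0).2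
  have hc2 : ContinuousAt (fun z : ℝ => ((e:ℝ) * z + P) / (f * z + N)) z0 :=
    ContinuousAt.div (by fun_prop) (by fun_prop) hfz0
  have hev2 : ∀ᶠ z in nhds z0, |((e:ℝ) * z + P) / (f * z + N) - y0| < δ' := by
    have := hc2.eventually (Metric.ball_mem_nhds _ hδ'0)
    simpa [Real.dist_eq, hhz0] using this
  have hev3 : ∀ᶠ z in nhds z0, (f:ℝ) * z + N ≠ 0 :=
    (by fun_prop : ContinuousAt (fun z : ℝ => (f:ℝ) * z + N) z0).eventually_ne hfz0
  obtain ⟨ρ, hρ, hρb⟩ := Metric.eventually_nhds_iff.1 (hev2.and hev3)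
  refine ⟨N, -P, -f, e, max (z0 / 2) (z0 - ρ), z0 + ρ, by linarith, ?_, ?_, ?_⟩
  · exact lt_max_of_lt_left (by linarith)
  · exact max_lt (by linarith) (by linarith)
  intro y y' hy1 hy2 hy'
  have hyz1 : z0 / 2 < y := lt_of_le_of_lt (le_max_left _ _) hy1
  have hyz2 : z0 - ρ < y := lt_of_le_of_lt (le_max_right _ _) hy1
  obtain ⟨k1, k2⟩ := hρb (show dist y z0 < ρ by rw [Real.dist_eq, abs_lt]; constructor <;> linarith)
  have hD' : 0 < (f:ℝ) * y' + N := by nlinarith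
  have k3 : |((e:ℝ) * y' + P) / (f * y' + N) - y0'| < δ' := by
    have e1 : ((e:ℝ) * y' + P) / (f * y' + N) - t = y' / (N * (f * y' + N)) := by
      have hN0 : (N:ℝ) ≠ 0 := by positivity
      have : (t:ℝ) = P / N := by rw [← htR]; field_simp
      rw [this]
      exact mob_sub_cusp hdetR hD'.ne' hN0
    have e2 : |y' / (N * (f * y' + N))| < δ' / 4 := by
      rw [abs_div, abs_of_neg hy', abs_of_pos (by positivity), div_lt_iff₀ (by positivity)]
      have : -y' * 4 < δ' * (f * y' + N) := by nlinarith
      nlinarith [mul_pos hδ'0 hD']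
    have e3 : |(t:ℝ) - y0'| ≤ δ' / 2 := by rw [abs_le]; constructor <;> linarith
    have := abs_sub_le (((e:ℝ) * y' + P) / (f * y' + N)) t y0'
    rw [e1] at this
    linarith
  have hyy : y - y' ≠ 0 := by
    have : 0 < y - y' := by linarith
    exact this.ne'
  set Y := ((e:ℝ) * y + P) / (f * y + N) with hY
  set Y' := ((e:ℝ) * y' + P) / (f * y' + N) with hY'
  have hin : Ψ (Y, Y') ∈ W := by
    apply hball
    rw [Metric.mem_ball, Prod.dist_eq, Real.dist_eq, Real.dist_eq]
    exact max_lt (k1.trans_le (min_le_left _ _)) (k3.trans_le (min_le_left _ _))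
  convert hin using 1
  obtain ⟨g1, g2, g3⟩ := psi_mob hdetR k2 hD'.ne' hyy
  simp only [Ψ, hY, hY', g1, g2, g3, qfA, qfB, qfC]
  refine Prod.ext ?_ (Prod.ext ?_ ?_)
  · simp only; push_cast; field_simp; ring
  · simp only; push_cast; field_simp; ring
  · simp only; push_cast; field_simp; ring

lemma exists_nonzero_point {W : Set (ℝ × ℝ × ℝ)} (hW : IsOpen W) {A B C : ℝ}
    (hd : B ^ 2 - 4 * A * C = 1) (hmem : (A, B, C) ∈ W) :
    ∃ A' B' C' : ℝ, A' ≠ 0 ∧ B' ^ 2 - 4 * A' * C' = 1 ∧ (A', B', C') ∈ W := by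
  by_cases hA : A = 0
  · subst hA
    have hc : Continuous (fun ε : ℝ => ((ε, B * √(1 + 4 * ε * C), C) : ℝ × ℝ × ℝ)) := by fun_prop
    have h1 : ∀ᶠ ε in nhds (0:ℝ), ((ε, B * √(1 + 4 * ε * C), C) : ℝ × ℝ × ℝ) ∈ W :=
      hc.continuousAt.eventually (hW.mem_nhds (by simpa using hmem))
    have h2 : ∀ᶠ ε in nhds (0:ℝ), 0 < 1 + 4 * ε * C :=
      (by fun_prop : Continuous (fun ε : ℝ => 1 + 4 * ε * C)).continuousAt.eventually
        (Ioi_mem_nhds (by norm_num))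
    have h3 := (h1.and h2).filter_mono (nhdsWithin_le_nhds (s := Set.Ioi (0:ℝ)))
    obtain ⟨ε, ⟨h4, h5⟩, h6⟩ := (h3.and self_mem_nhdsWithin).exists
    refine ⟨ε, _, C, (Set.mem_Ioi.1 h6).ne', ?_, h4⟩
    rw [mul_pow, Real.sq_sqrt h5.le]
    have : B ^ 2 = 1 := by linarith
    rw [this]; ring
  · exact ⟨A, B, C, hA, hd, hmem⟩

set_option maxHeartbeats 1000000 in
theorem exists_good_word {W : Set (ℝ × ℝ × ℝ)} (hW : IsOpen W) {A B C : ℝ}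
    (hd : B ^ 2 - 4 * A * C = 1) (hmem : (A, B, C) ∈ W) :
    ∃ w : List Bool, ∀ (n : SBNode) (a b c d : ℤ), n.ok → 0 < a → b ^ 2 - 4 * a * c = d → 0 < d →
      Int.gcd a (Int.gcd b c) = 1 →
      (n.path w).lo ≤ (-b + √d) / (2 * a) → (-b + √d) / (2 * a) ≤ (n.path w).hi →
      (-b - √d) / (2 * a) < n.lo →
      ∃ a' b' c' : ℤ, b' ^ 2 - 4 * a' * c' = d ∧ Int.gcd a' (Int.gcd b' c') = 1 ∧
        ((a' : ℝ) / √d, (b' : ℝ) / √d, (c' : ℝ) / √d) ∈ W := by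
  obtain ⟨A, B, C, hA, hd, hmem⟩ := exists_nonzero_point hW hd hmem
  obtain ⟨p, q, r, s, z₁, z₂, hdet, hz1, hz12, hbc⟩ := exists_base_change hW hA hd hmem
  obtain ⟨w, hq, hq', hw1, hw2⟩ := SBNode.exists_word z₁ z₂ hz1 hz12
  refine ⟨w, ?_⟩
  intro n a b c d hn ha hdisc hdpos hprim hlo hhi hx'
  have hdet2 : n.p' * n.q - n.p * n.q' = 1 := hn.1
  refine ⟨_, _, _, ?_, qf_prim p q r s _ _ _ hdet (qf_prim n.p' n.p n.q' n.q a b c (by linarith) hprim),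
    ?_⟩
  · rw [qf_disc p q r s _ _ _ hdet, qf_disc n.p' n.p n.q' n.q a b c (by linarith), hdisc]
  set m := SBNode.root.path w with hm
  rw [SBNode.path_eq_mulN, ← hm] at hlo hhi
  set D : ℝ := √(d:ℝ) with hD
  have hD0 : 0 < D := Real.sqrt_pos.2 (by exact_mod_cast hdpos)
  have hDD : D ^ 2 = d := Real.sq_sqrt (by exact_mod_cast hdpos.le)
  have haR : (0:ℝ) < a := by exact_mod_cast ha
  have hdiscR : (b:ℝ) ^ 2 - 4 * a * c = D ^ 2 := by rw [hDD]; exact_mod_cast hdisc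
  set x := (-(b:ℝ) + D) / (2 * a) with hx
  set x' := (-(b:ℝ) - D) / (2 * a) with hxx'
  have hsub : x - x' = D / a := by rw [hx, hxx']; field_simp; ring
  have hb : (b:ℝ) = - a * (x + x') := by rw [hx, hxx']; field_simp; ring
  have hc : (c:ℝ) = a * (x * x') := by
    rw [hx, hxx']; field_simp; linear_combination (-1) * hdiscR
  have hqR := hn.q_pos
  have hqR' := hn.q'_pos
  have hdetR : (n.p':ℝ) * n.q - n.p * n.q' = 1 := by exact_mod_cast hdet2
  have hmq : (1:ℝ) ≤ m.q := by exact_mod_cast hq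
  have hmq' : (1:ℝ) ≤ m.q' := by exact_mod_cast hq'
  have hmso := SBNode.semiok_path w SBNode.root (by simp [SBNode.semiok, SBNode.root])
  rw [← hm] at hmso
  have hmp : (0:ℝ) ≤ m.p := by exact_mod_cast hmso.2.1
  have hmp' : (1:ℝ) ≤ m.p' := by exact_mod_cast hmso.2.2.2.1
  simp only [SBNode.lo, SBNode.hi, SBNode.mulN] at hlo hhi hx'
  push_cast at hlo hhi
  rw [div_le_iff₀ (by positivity)] at hlo
  rw [le_div_iff₀ (by positivity)] at hhi
  rw [lt_div_iff₀ (by positivity)] at hx'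
  -- key quantities
  have hden : 0 < (n.p':ℝ) - n.q' * x := by
    have h1 : x * n.q' * (n.q' * m.p' + n.q * m.q') ≤ n.q' * (n.p' * m.p' + n.p * m.q') := by
      nlinarith
    have h2 : (n.p':ℝ) * (n.q' * m.p' + n.q * m.q') = n.q' * (n.p' * m.p' + n.p * m.q') + m.q' := by
      linear_combination (m.q':ℝ) * hdetR
    have h3 : 0 < ((n.p':ℝ) - n.q' * x) * (n.q' * m.p' + n.q * m.q') := by nlinarith
    exact (pos_iff_pos_of_mul_pos h3).2 (by positivity)
  have hden' : 0 < (n.p':ℝ) - n.q' * x' := by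
    have h1 : (n.q':ℝ) * (x' * n.q) < n.q' * n.p := by gcongr
    have h3 : 0 < ((n.p':ℝ) - n.q' * x') * n.q := by nlinarith
    exact (pos_iff_pos_of_mul_pos h3).2 (by positivity)
  set y := ((n.q:ℝ) * x - n.p) / (n.p' - n.q' * x) with hy
  set y' := ((n.q:ℝ) * x' - n.p) / (n.p' - n.q' * x') with hy'
  have hyneg : y' < 0 := div_neg_of_neg_of_pos (by linarith) hden'
  have hy1 : z₁ < y := by
    rw [hy, lt_div_iff₀ hden]
    have h1 : m.p * (n.p' - n.q' * x) ≤ (n.q * x - n.p) * m.q := by linarith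
    have h2 : z₁ * m.q * (n.p' - n.q' * x) < m.p * (n.p' - n.q' * x) := by gcongr
    have h3 : z₁ * (n.p' - n.q' * x) * m.q < (n.q * x - n.p) * m.q := by linarith
    exact lt_of_mul_lt_mul_right h3 (by positivity)
  have hy2 : y < z₂ := by
    rw [hy, div_lt_iff₀ hden]
    have h1 : (n.q * x - n.p) * m.q' ≤ m.p' * (n.p' - n.q' * x) := by linarith
    have h2 : m.p' * (n.p' - n.q' * x) < z₂ * m.q' * (n.p' - n.q' * x) := by gcongr
    have h3 : (n.q * x - n.p) * m.q' < z₂ * (n.p' - n.q' * x) * m.q' := by linarith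
    exact lt_of_mul_lt_mul_right h3 (by positivity)
  have hxx0 : x - x' ≠ 0 := by rw [hsub]; positivity
  have hDa : D = a * (x - x') := by rw [hsub]; field_simp
  have k1 : (-(n.q':ℝ)) * x + n.p' = n.p' - n.q' * x := by ring
  have k2 : (-(n.q':ℝ)) * x' + n.p' = n.p' - n.q' * x' := by ring
  obtain ⟨g1, g2, g3⟩ := psi_mob (e := (n.q:ℝ)) (P := -(n.p:ℝ)) (f := -(n.q':ℝ)) (N := n.p')
    (y := x) (y' := x') (by linarith) (by rw [k1]; exact hden.ne') (by rw [k2]; exact hden'.ne') hxx0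
  rw [k1, k2, ← sub_eq_add_neg, ← sub_eq_add_neg, ← hy, ← hy'] at g1 g2 g3
  have ha0 := haR.ne'
  have eA : (1:ℝ) / (y - y') = (qfA n.p' n.p n.q' n.q a b c : ℤ) / D := by
    unfold qfA
    push_cast
    rw [g1, hb, hc, hDa, div_eq_div_iff hxx0 (mul_ne_zero ha0 hxx0)]
    ring
  have eB : -(y + y') / (y - y') = (qfB n.p' n.p n.q' n.q a b c : ℤ) / D := by
    unfold qfB
    push_cast
    rw [g2, hb, hc, hDa, div_eq_div_iff hxx0 (mul_ne_zero ha0 hxx0)]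
    ring
  have eC : (y * y') / (y - y') = (qfC n.p' n.p n.q' n.q a b c : ℤ) / D := by
    unfold qfC
    push_cast
    rw [g3, hb, hc, hDa, div_eq_div_iff hxx0 (mul_ne_zero ha0 hxx0)]
    ring
  have := hbc y y' hy1 hy2 hyneg
  rw [eA, eB, eC] at this
  convert this using 1
  generalize qfA n.p' n.p n.q' n.q a b c = a0
  generalize qfB n.p' n.p n.q' n.q a b c = b0
  generalize qfC n.p' n.p n.q' n.q a b c = c0
  clear_value D
  refine Prod.ext ?_ (Prod.ext ?_ ?_)
  · simp only [qfA]; push_cast; ring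
  · simp only [qfB]; push_cast; ring
  · simp only [qfC]; push_cast; ring

/-- The divisor bound. -/
theorem divisor_bound (ε : ℝ) (hε : 0 < ε) :
    ∃ C : ℝ, 1 ≤ C ∧ ∀ n : ℕ, n ≠ 0 → (n.divisors.card : ℝ) ≤ C * (n : ℝ) ^ ε := by
  set K : ℝ := max 1 (1 / (ε * Real.log 2)) with hK
  have hl2 : 0 < Real.log 2 := Real.log_pos (by norm_num)
  have hK1 : 1 ≤ K := le_max_left _ _
  have hK2 : 1 ≤ K * (ε * Real.log 2) := by
    have : 1 / (ε * Real.log 2) ≤ K := le_max_right _ _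
    rwa [div_le_iff₀ (by positivity)] at this
  obtain ⟨B, hB⟩ := exists_nat_gt ((2:ℝ) ^ (1 / ε))
  refine ⟨K ^ B, one_le_pow₀ hK1, ?_⟩
  intro n hn
  rw [Nat.card_divisors hn]
  have hfac : ∀ p ∈ n.primeFactors, ((n.factorization p + 1 : ℕ) : ℝ) ≤
      (if p < B then K else 1) * ((p ^ n.factorization p : ℕ) : ℝ) ^ ε := by
    intro p hp
    have hpp := Nat.prime_of_mem_primeFactors hp
    have hp0 : (0:ℝ) < p := by exact_mod_cast hpp.pos
    have hp2 : (2:ℝ) ≤ p := by exact_mod_cast hpp.two_le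
    set k := n.factorization p
    have e1 : ((p ^ k : ℕ) : ℝ) ^ ε = ((p:ℝ) ^ ε) ^ k := by
      push_cast
      rw [← Real.rpow_natCast, ← Real.rpow_mul hp0.le, mul_comm, Real.rpow_mul hp0.le,
        Real.rpow_natCast]
    rw [e1]
    split_ifs with hlt
    · have h2 : ((2:ℝ) ^ ε) ^ k ≤ ((p:ℝ) ^ ε) ^ k := by gcongr
      have h3 : 1 + (k:ℝ) * (ε * Real.log 2) ≤ ((2:ℝ) ^ ε) ^ k := by
        rw [← Real.rpow_natCast, ← Real.rpow_mul (by norm_num),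
          Real.rpow_def_of_pos (by norm_num)]
        have := Real.add_one_le_exp (Real.log 2 * (ε * k))
        nlinarith
      have h4 : K * (1 + (k:ℝ) * (ε * Real.log 2)) ≤ K * ((p:ℝ) ^ ε) ^ k := by
        gcongr; exact h3.trans h2
      refine le_trans ?_ h4
      push_cast
      have hk0 : (0:ℝ) ≤ k := by positivity
      nlinarith
    · rw [one_mul]
      push Not at hlt
      have h2 : (2:ℝ) ≤ (p:ℝ) ^ ε := by
        have hBp : (2:ℝ) ^ (1 / ε) ≤ p := hB.le.trans (by exact_mod_cast hlt)
        calc (2:ℝ) = ((2:ℝ) ^ (1 / ε)) ^ ε := by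
              rw [← Real.rpow_mul (by norm_num), one_div, inv_mul_cancel₀ hε.ne', Real.rpow_one]
          _ ≤ _ := by gcongr
      calc ((k + 1 : ℕ) : ℝ) ≤ (2:ℝ) ^ k := by
            have : k + 1 ≤ 2 ^ k := Nat.lt_two_pow_self
            exact_mod_cast this
        _ ≤ _ := by gcongr
  push_cast
  calc ∏ p ∈ n.primeFactors, ((n.factorization p : ℝ) + 1)
      ≤ ∏ p ∈ n.primeFactors, ((if p < B then K else 1) * ((p ^ n.factorization p : ℕ) : ℝ) ^ ε) := by
        apply Finset.prod_le_prod
        · intro i _; positivity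
        · intro i hi
          have := hfac i hi
          push_cast at this ⊢
          exact this
    _ = (∏ p ∈ n.primeFactors, (if p < B then K else 1)) * (n:ℝ) ^ ε := by
        rw [Finset.prod_mul_distrib, Real.finset_prod_rpow _ _ (fun i _ => by positivity)]
        congr 2
        have := Nat.prod_factorization_pow_eq_self hn
        rw [Nat.prod_factorization_eq_prod_primeFactors] at this
        conv_rhs => rw [← this]
        push_cast
        rfl
    _ ≤ K ^ B * (n:ℝ) ^ ε := by
        gcongr
        rw [← Finset.prod_filter, Finset.prod_const]
        apply pow_le_pow_right₀ hK1
        calc _ ≤ (Finset.range B).card := by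
              apply Finset.card_le_card
              intro p hp
              simp only [Finset.mem_filter] at hp
              exact Finset.mem_range.2 hp.2
          _ = B := Finset.card_range B

/-! ## Part C: counting pairs -/

lemma label_aux (n D : ℤ) (hn : n ≠ 0) : ∃ lab : ℤ → ℤ → ℕ,
    (∀ u v, lab u v ∣ n.natAbs) ∧
    ∀ u1 v1 u2 v2 : ℤ, n ∣ u1 ^ 2 - D * v1 ^ 2 → n ∣ u2 ^ 2 - D * v2 ^ 2 →
      IsCoprime v1 n → IsCoprime v2 n → lab u1 v1 = lab u2 v2 →
      n ∣ 2 * D * (u1 * v2 - u2 * v1) := by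
  by_cases hex : ∃ u0 v0 : ℤ, n ∣ u0 ^ 2 - D * v0 ^ 2 ∧ IsCoprime v0 n
  · obtain ⟨u0, v0, h0, hc0⟩ := hex
    refine ⟨fun u v => Int.gcd n (u0 * v - u * v0), fun u v => ?_, ?_⟩
    · exact Int.natCast_dvd.1 (Int.gcd_dvd_left ..)
    intro u1 v1 u2 v2 h1 h2 hc1 hc2 hlab
    simp only at hlab
    set m : ℤ := (Int.gcd n (u0 * v1 - u1 * v0) : ℤ) with hm
    have hm' : m = (Int.gcd n (u0 * v2 - u2 * v0) : ℤ) := by rw [hm, hlab]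
    obtain ⟨m', hmm'⟩ : m ∣ n := Int.gcd_dvd_left ..
    have hm0 : m ≠ 0 := fun h => hn (by rw [hmm', h, zero_mul])
    have hd1 : m ∣ u0 * v1 - u1 * v0 := Int.gcd_dvd_right ..
    have hd2 : m ∣ u0 * v2 - u2 * v0 := by rw [hm']; exact Int.gcd_dvd_right ..
    -- n/m divides the sums
    have key : ∀ u v : ℤ, n ∣ u ^ 2 - D * v ^ 2 → m = (Int.gcd n (u0 * v - u * v0) : ℤ) →
        m' ∣ u0 * v + u * v0 := by
      intro u v huv hmv
      have hprod : n ∣ (u0 * v - u * v0) * (u0 * v + u * v0) := by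
        have : (u0 * v - u * v0) * (u0 * v + u * v0) =
            (u0 ^ 2 - D * v0 ^ 2) * v ^ 2 - (u ^ 2 - D * v ^ 2) * v0 ^ 2 := by ring
        rw [this]
        exact dvd_sub (h0.mul_right _) (huv.mul_right _)
      have hbez := Int.gcd_eq_gcd_ab n (u0 * v - u * v0)
      rw [← hmv] at hbez
      have : n ∣ m * (u0 * v + u * v0) := by
        rw [hbez, add_mul]
        refine dvd_add ?_ ?_
        · rw [mul_assoc]; exact dvd_mul_right _ _
        · rw [mul_right_comm]; exact hprod.mul_right _
      rw [hmm'] at this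
      exact (mul_dvd_mul_iff_left hm0).1 (by simpa using this)
    have hs1 := key u1 v1 h1 hm
    have hs2 := key u2 v2 h2 hm'
    have hmn : m ∣ n := ⟨m', hmm'⟩
    have hm'n : m' ∣ n := ⟨m, by rw [hmm']; ring⟩
    have hcm : IsCoprime v0 m := hc0.of_isCoprime_of_dvd_right hmn
    have hcm' : IsCoprime v0 m' := hc0.of_isCoprime_of_dvd_right hm'n
    set Δ := u1 * v2 - u2 * v1 with hΔ
    have hmΔ : m ∣ Δ := by
      apply hcm.symm.dvd_of_dvd_mul_left
      have : v0 * Δ = -((u0 * v1 - u1 * v0) * v2 - (u0 * v2 - u2 * v0) * v1) := by rw [hΔ]; ring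
      rw [this]
      exact (dvd_sub (hd1.mul_right _) (hd2.mul_right _)).neg_right
    have hm'Δ : m' ∣ Δ := by
      apply hcm'.symm.dvd_of_dvd_mul_left
      have : v0 * Δ = ((u0 * v1 + u1 * v0) * v2 - (u0 * v2 + u2 * v0) * v1) := by rw [hΔ]; ring
      rw [this]
      exact (dvd_sub (hs1.mul_right _) (hs2.mul_right _))
    -- g = gcd m m'
    set g : ℤ := (Int.gcd m m' : ℤ) with hg
    have hgm : g ∣ m := Int.gcd_dvd_left ..
    have hgm' : g ∣ m' := Int.gcd_dvd_right ..
    have hgn : g ∣ n := hgm.trans hmn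
    have hg2u : g ∣ 2 * u0 := by
      apply (hc1.of_isCoprime_of_dvd_right hgn).symm.dvd_of_dvd_mul_left
      have : v1 * (2 * u0) = (u0 * v1 - u1 * v0) + (u0 * v1 + u1 * v0) := by ring
      rw [this]
      exact dvd_add (hgm.trans hd1) (hgm'.trans hs1)
    have hg2D : g ∣ 2 * D := by
      have hcg := (hc0.of_isCoprime_of_dvd_right hgn).symm
      apply hcg.dvd_of_dvd_mul_left
      apply hcg.dvd_of_dvd_mul_left
      have : v0 * (v0 * (2 * D)) = (2 * u0) * u0 - 2 * (u0 ^ 2 - D * v0 ^ 2) := by ring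
      rw [this]
      exact dvd_sub (hg2u.mul_right _) ((hgn.trans h0).mul_left _)
    have hngΔ : n ∣ g * Δ := by
      have hbez := Int.gcd_eq_gcd_ab m m'
      rw [← hg] at hbez
      rw [hbez, add_mul]
      refine dvd_add ?_ ?_
      · rw [hmm', mul_assoc]; exact mul_dvd_mul_left _ (hm'Δ.mul_left _)
      · rw [hmm', mul_comm m, mul_assoc]; exact mul_dvd_mul_left _ (hmΔ.mul_left _)
    exact hngΔ.trans (mul_dvd_mul_right hg2D _)
  · refine ⟨fun _ _ => 1, fun _ _ => one_dvd _, ?_⟩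
    intro u1 v1 u2 v2 h1 h2 hc1
    exact (hex ⟨u1, v1, h1, hc1⟩).elim

lemma label_conic (k D : ℤ) (hk : k ≠ 0) : ∃ lab : ℤ → ℤ → ℕ × ℕ,
    ∀ u1 s1 v1 : ℤ, u1 ^ 2 - D * v1 ^ 2 = k * s1 ^ 2 → Int.gcd (Int.gcd u1 v1) s1 = 1 →
    ((lab u1 v1).1 ∣ k.natAbs ∧ (lab u1 v1).2 ∣ k.natAbs) ∧
    ∀ u2 s2 v2 : ℤ, u2 ^ 2 - D * v2 ^ 2 = k * s2 ^ 2 → Int.gcd (Int.gcd u2 v2) s2 = 1 →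
      lab u1 v1 = lab u2 v2 →
      k ∣ 2 * (Int.gcd k D) * (u1 * v2 - u2 * v1) := by
  classical
  have hlab : ∀ j : ℕ, ∃ lab : ℤ → ℤ → ℕ, ((j:ℤ) ^ 2 ∣ k →
    (∀ u v, lab u v ∣ (k / (j:ℤ) ^ 2).natAbs) ∧
    ∀ u1 v1 u2 v2 : ℤ, (k / (j:ℤ) ^ 2) ∣ u1 ^ 2 - D * v1 ^ 2 → (k / (j:ℤ) ^ 2) ∣ u2 ^ 2 - D * v2 ^ 2 →
      IsCoprime v1 (k / (j:ℤ) ^ 2) → IsCoprime v2 (k / (j:ℤ) ^ 2) → lab u1 v1 = lab u2 v2 →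
      (k / (j:ℤ) ^ 2) ∣ 2 * D * (u1 * v2 - u2 * v1)) := by
    intro j
    by_cases hj : (j:ℤ) ^ 2 ∣ k
    · have hn : k / (j:ℤ) ^ 2 ≠ 0 := by
        obtain ⟨n, hn⟩ := hj
        have hj0 : (j:ℤ) ^ 2 ≠ 0 := fun h => hk (by rw [hn, h, zero_mul])
        rw [hn, Int.mul_ediv_cancel_left _ hj0]
        rintro rfl
        simp at hn; exact hk hn
      obtain ⟨lab, h⟩ := label_aux (k / (j:ℤ) ^ 2) D hn
      exact ⟨lab, fun _ => h⟩
    · exact ⟨fun _ _ => 0, fun h => (hj h).elim⟩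
  choose lab hlab using hlab
  refine ⟨fun u v => (Int.gcd u v, lab (Int.gcd u v) (u / Int.gcd u v) (v / Int.gcd u v)), ?_⟩
  -- facts about one triple
  have facts : ∀ u s v : ℤ, u ^ 2 - D * v ^ 2 = k * s ^ 2 → Int.gcd (Int.gcd u v) s = 1 →
      ∃ u' v' n : ℤ, (Int.gcd u v : ℤ) ≠ 0 ∧ u = Int.gcd u v * u' ∧ v = Int.gcd u v * v' ∧
        k = (Int.gcd u v : ℤ) ^ 2 * n ∧ n ∣ u' ^ 2 - D * v' ^ 2 ∧ IsCoprime v' n := by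
    intro u s v h hg
    set j : ℤ := (Int.gcd u v : ℤ) with hj
    obtain ⟨u', hu'⟩ : j ∣ u := Int.gcd_dvd_left ..
    obtain ⟨v', hv'⟩ : j ∣ v := Int.gcd_dvd_right ..
    have hjs : IsCoprime j s := by rw [Int.isCoprime_iff_gcd_eq_one]; exact hg
    have hjk : j ^ 2 ∣ k := by
      have : j ^ 2 ∣ s ^ 2 * k := ⟨u' ^ 2 - D * v' ^ 2, by rw [mul_comm, ← h, hu', hv']; ring⟩
      exact hjs.pow.dvd_of_dvd_mul_left this
    obtain ⟨n, hn⟩ := hjk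
    have hj0 : j ≠ 0 := by rintro h0; rw [h0] at hn; simp at hn; exact hk hn
    have heq : u' ^ 2 - D * v' ^ 2 = n * s ^ 2 := by
      have : j ^ 2 * (u' ^ 2 - D * v' ^ 2) = j ^ 2 * (n * s ^ 2) := by
        rw [← mul_assoc, ← hn, ← h]; linear_combination (-(u + j * u')) * hu' + D * (v + j * v') * hv'
      exact mul_left_cancel₀ (pow_ne_zero 2 hj0) this
    have hco : IsCoprime u' v' := by
      have hb := Int.gcd_eq_gcd_ab u v
      rw [← hj] at hb
      refine ⟨Int.gcdA u v, Int.gcdB u v, ?_⟩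
      have : j * (Int.gcdA u v * u' + Int.gcdB u v * v') = j * 1 := by
        calc j * (Int.gcdA u v * u' + Int.gcdB u v * v')
            = (j * u') * Int.gcdA u v + (j * v') * Int.gcdB u v := by ring
          _ = j := by rw [← hu', ← hv']; exact hb.symm
          _ = j * 1 := by ring
      exact mul_left_cancel₀ hj0 this
    refine ⟨u', v', n, hj0, hu', hv', hn, ⟨s ^ 2, heq⟩, ?_⟩
    -- coprimality of v' and n
    have h2 : IsCoprime v' (n * s ^ 2) := by
      rw [← heq]
      have h3 : IsCoprime v' (u' ^ 2) := hco.symm.pow_right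
      have : u' ^ 2 - D * v' ^ 2 = u' ^ 2 + v' * (-(D * v')) := by ring
      rw [this]
      exact h3.add_mul_left_right _
    exact h2.of_mul_right_left
  intro u1 s1 v1 h1 hg1
  obtain ⟨u1', v1', n, hj0, hu1, hv1, hkn, hd1, hc1⟩ := facts u1 s1 v1 h1 hg1
  set j : ℕ := Int.gcd u1 v1 with hj
  have hjk : (j:ℤ) ^ 2 ∣ k := ⟨n, hkn⟩
  have hkj : k / (j:ℤ) ^ 2 = n := by rw [hkn, Int.mul_ediv_cancel_left _ (pow_ne_zero 2 hj0)]
  have hnk : n ∣ k := ⟨(j:ℤ) ^ 2, by rw [hkn]; ring⟩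
  refine ⟨⟨?_, ?_⟩, ?_⟩
  · simp only
    exact Int.natCast_dvd.1 ((dvd_pow_self _ two_ne_zero).trans hjk)
  · have := (hlab j hjk).1 (u1 / j) (v1 / j)
    rw [hkj] at this
    exact this.trans (Int.natAbs_dvd_natAbs.2 hnk)
  intro u2 s2 v2 h2 hg2 heq
  obtain ⟨u2', v2', n2, hj02, hu2, hv2, hkn2, hd2, hc2⟩ := facts u2 s2 v2 h2 hg2
  simp only [Prod.mk.injEq] at heq
  obtain ⟨e1, e2⟩ := heq
  rw [← e1] at e2 hu2 hv2 hkn2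
  have hn2 : n2 = n := by
    have := hkn.symm.trans hkn2
    exact (mul_left_cancel₀ (pow_ne_zero 2 hj0) this).symm
  subst hn2
  have q1 : u1 / (j:ℤ) = u1' := by rw [hu1, Int.mul_ediv_cancel_left _ hj0]
  have q2 : v1 / (j:ℤ) = v1' := by rw [hv1, Int.mul_ediv_cancel_left _ hj0]
  have q3 : u2 / (j:ℤ) = u2' := by rw [hu2, Int.mul_ediv_cancel_left _ hj0]
  have q4 : v2 / (j:ℤ) = v2' := by rw [hv2, Int.mul_ediv_cancel_left _ hj0]
  rw [q1, q2, q3, q4] at e2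
  have hfin := (hlab j hjk).2 u1' v1' u2' v2' (by rw [hkj]; exact hd1) (by rw [hkj]; exact hd2)
    (by rw [hkj]; exact hc1) (by rw [hkj]; exact hc2) e2
  rw [hkj] at hfin
  have hG : n2 ∣ 2 * (Int.gcd k D) * (u1' * v2' - u2' * v1') := by
    rw [Int.gcd_eq_gcd_ab k D]
    have : 2 * (k * Int.gcdA k D + D * Int.gcdB k D) * (u1' * v2' - u2' * v1') =
      k * (2 * Int.gcdA k D * (u1' * v2' - u2' * v1')) +
      (2 * D * (u1' * v2' - u2' * v1')) * Int.gcdB k D := by ring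
    rw [this]
    exact dvd_add (hnk.mul_right _) (hfin.mul_right _)
  have : 2 * (Int.gcd k D : ℤ) * (u1 * v2 - u2 * v1) =
      (j:ℤ) ^ 2 * (2 * (Int.gcd k D) * (u1' * v2' - u2' * v1')) := by
    rw [hu1, hv1, hu2, hv2]; ring
  rw [this]
  nth_rewrite 1 [hkn]
  exact mul_dvd_mul_left _ hG

def det3 {R : Type*} [CommRing R] (u1 s1 v1 u2 s2 v2 u3 s3 v3 : R) : R :=
  u1 * (s2 * v3 - s3 * v2) - s1 * (u2 * v3 - u3 * v2) + v1 * (u2 * s3 - u3 * s2)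

lemma det3_dvd {k D G u1 s1 v1 u2 s2 v2 u3 s3 v3 : ℤ} (hG : G = Int.gcd k D)
    (a1 : k ∣ 2 * G * (u1 * v2 - u2 * v1)) (a2 : k ∣ 2 * G * (u1 * v3 - u3 * v1))
    (a3 : k ∣ 2 * G * (u2 * v3 - u3 * v2))
    (b1 : D ∣ 2 * G * (u1 * s2 - u2 * s1)) (b2 : D ∣ 2 * G * (u1 * s3 - u3 * s1))
    (b3 : D ∣ 2 * G * (u2 * s3 - u3 * s2)) :
    k * D ∣ 2 * G ^ 2 * det3 u1 s1 v1 u2 s2 v2 u3 s3 v3 := by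
  set Δ := det3 u1 s1 v1 u2 s2 v2 u3 s3 v3 with hΔ
  have h1 : k ∣ 2 * G * Δ := by
    have : 2 * G * Δ = -(s1 * (2 * G * (u2 * v3 - u3 * v2))) + s2 * (2 * G * (u1 * v3 - u3 * v1))
        - s3 * (2 * G * (u1 * v2 - u2 * v1)) := by rw [hΔ, det3]; ring
    rw [this]
    exact dvd_sub (dvd_add (a3.mul_left _).neg_right (a2.mul_left _)) (a1.mul_left _)
  have h2 : D ∣ 2 * G * Δ := by
    have : 2 * G * Δ = (v1 * (2 * G * (u2 * s3 - u3 * s2))) - v2 * (2 * G * (u1 * s3 - u3 * s1))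
        + v3 * (2 * G * (u1 * s2 - u2 * s1)) := by rw [hΔ, det3]; ring
    rw [this]
    exact dvd_add (dvd_sub (b3.mul_left _) (b2.mul_left _)) (b1.mul_left _)
  have : 2 * G ^ 2 * Δ = (2 * G * Δ) * (k * Int.gcdA k D + D * Int.gcdB k D) := by
    rw [← Int.gcd_eq_gcd_ab, ← hG]; ring
  rw [this, mul_add]
  refine dvd_add ?_ ?_
  · rw [← mul_assoc, mul_comm k D]
    exact (mul_dvd_mul_right h2 k).mul_right _
  · rw [← mul_assoc]
    exact (mul_dvd_mul_right h1 D).mul_right _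

/-- Two positive or two negative numbers with close logarithms are close. -/
lemma close_of_log {t x y : ℝ} (ht : 1 ≤ t) (hx : x ≠ 0) (hy : y ≠ 0) (hs : (0 < x) ↔ (0 < y))
    (h : ⌊t * Real.log |x|⌋ = ⌊t * Real.log |y|⌋) : |x - y| ≤ |y| * (2 / t) := by
  have ht0 : 0 < t := by linarith
  have h1 := Int.abs_sub_lt_one_of_floor_eq_floor h
  rw [← mul_sub, abs_mul, abs_of_pos ht0] at h1
  set δ := Real.log |x| - Real.log |y| with hδ
  have hδ1 : |δ| ≤ 1 / t := by rw [le_div_iff₀ ht0]; linarith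
  have hδ2 : |δ| ≤ 1 := hδ1.trans (by rw [div_le_one ht0]; exact ht)
  have h2 := Real.abs_exp_sub_one_le hδ2
  have h3 : Real.exp δ = |x| / |y| := by
    rw [hδ, Real.exp_sub, Real.exp_log (abs_pos.2 hx), Real.exp_log (abs_pos.2 hy)]
  have h4 : |x| / |y| = x / y := by
    rw [← abs_div]
    apply abs_of_nonneg
    rcases lt_or_gt_of_ne hx with hx1 | hx1
    · have : y < 0 := by
        rcases lt_or_gt_of_ne hy with h | h
        · exact h
        · exact absurd (hs.2 h) (by linarith)
      exact div_nonneg_of_nonpos hx1.le this.le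
    · exact div_nonneg hx1.le (hs.1 hx1).le
  rw [h3, h4] at h2
  have h5 : x - y = y * (x / y - 1) := by field_simp
  rw [h5, abs_mul]
  gcongr
  calc _ ≤ 2 * |δ| := h2
    _ ≤ 2 * (1 / t) := by gcongr
    _ = 2 / t := by ring

lemma det3_formula {k R t1 t2 t3 s1 s2 s3 : ℝ} (hR : R ≠ 0) (h1 : t1 ≠ 0) (h2 : t2 ≠ 0)
    (h3 : t3 ≠ 0) :
    det3 (s1 * ((t1 + k / t1) / 2)) s1 (s1 * ((k / t1 - t1) / (2 * R)))
      (s2 * ((t2 + k / t2) / 2)) s2 (s2 * ((k / t2 - t2) / (2 * R)))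
      (s3 * ((t3 + k / t3) / 2)) s3 (s3 * ((k / t3 - t3) / (2 * R))) * (2 * R * (t1 * t2 * t3)) =
    s1 * s2 * s3 * k * ((t1 - t2) * (t2 - t3) * (t1 - t3)) := by
  unfold det3
  field_simp
  ring

noncomputable def tauC (D u s v : ℤ) : ℝ := ((u:ℝ) - √D * v) / s

lemma tauC_facts {k D u s v : ℤ} (hk : k ≠ 0) (hD : 0 < D) (hs : 0 < s)
    (h : u ^ 2 = k * s ^ 2 + D * v ^ 2) :
    tauC D u s v ≠ 0 ∧ (u:ℝ) = s * ((tauC D u s v + k / tauC D u s v) / 2) ∧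
    (v:ℝ) = s * ((k / tauC D u s v - tauC D u s v) / (2 * √D)) ∧
    k / tauC D u s v = ((u:ℝ) + √D * v) / s := by
  have hR : 0 < √(D:ℝ) := Real.sqrt_pos.2 (by exact_mod_cast hD)
  have hRR : √(D:ℝ) ^ 2 = D := Real.sq_sqrt (by exact_mod_cast hD.le)
  set R := √(D:ℝ)
  have hsR : (0:ℝ) < s := by exact_mod_cast hs
  have hkR : (k:ℝ) ≠ 0 := by exact_mod_cast hk
  have hR2 : (u:ℝ) ^ 2 = k * s ^ 2 + R ^ 2 * v ^ 2 := by rw [hRR]; exact_mod_cast h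
  have hprod : ((u:ℝ) - R * v) * (u + R * v) = k * s ^ 2 := by linear_combination hR2
  have hne : ((u:ℝ) - R * v) ≠ 0 := by
    intro h0
    rw [h0, zero_mul] at hprod
    have : (k:ℝ) * s ^ 2 ≠ 0 := by positivity
    exact this hprod.symm
  have h0 : tauC D u s v ≠ 0 := div_ne_zero hne hsR.ne'
  have h4 : k / tauC D u s v = ((u:ℝ) + R * v) / s := by
    unfold tauC
    rw [div_div_eq_mul_div, div_eq_div_iff hne hsR.ne']
    linear_combination -hprod
  refine ⟨h0, ?_, ?_, h4⟩
  · rw [h4]; unfold tauC; field_simp; ring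
  · rw [h4]; unfold tauC; field_simp; ring

lemma three_points {k D : ℤ} (hk : k ≠ 0) (hD : 0 < D) {M t : ℝ} (ht : 1 ≤ t)
    (hM : 2 * (Int.gcd k D) * M < t * √D)
    {u1 s1 v1 u2 s2 v2 u3 s3 v3 : ℤ}
    (h1 : u1 ^ 2 = k * s1 ^ 2 + D * v1 ^ 2) (h2 : u2 ^ 2 = k * s2 ^ 2 + D * v2 ^ 2)
    (h3 : u3 ^ 2 = k * s3 ^ 2 + D * v3 ^ 2)
    (p1 : 0 < s1) (p2 : 0 < s2) (p3 : 0 < s3)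
    (m1 : (s1:ℝ) ≤ M) (m2 : (s2:ℝ) ≤ M) (m3 : (s3:ℝ) ≤ M)
    (hdvd : k * D ∣ 2 * (Int.gcd k D : ℤ) ^ 2 * det3 u1 s1 v1 u2 s2 v2 u3 s3 v3)
    (c12 : |tauC D u1 s1 v1 - tauC D u2 s2 v2| ≤ |tauC D u2 s2 v2| * (2 / t))
    (c23 : |tauC D u2 s2 v2 - tauC D u3 s3 v3| ≤ |tauC D u3 s3 v3| * (2 / t))
    (c31 : |tauC D u3 s3 v3 - tauC D u1 s1 v1| ≤ |tauC D u1 s1 v1| * (2 / t)) :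
    tauC D u1 s1 v1 = tauC D u2 s2 v2 ∨ tauC D u2 s2 v2 = tauC D u3 s3 v3 ∨
      tauC D u1 s1 v1 = tauC D u3 s3 v3 := by
  obtain ⟨n1, a1, b1, -⟩ := tauC_facts hk hD p1 h1
  obtain ⟨n2, a2, b2, -⟩ := tauC_facts hk hD p2 h2
  obtain ⟨n3, a3, b3, -⟩ := tauC_facts hk hD p3 h3
  set t1 := tauC D u1 s1 v1
  set t2 := tauC D u2 s2 v2
  set t3 := tauC D u3 s3 v3
  have hR : 0 < √(D:ℝ) := Real.sqrt_pos.2 (by exact_mod_cast hD)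
  have hRR : √(D:ℝ) ^ 2 = D := Real.sq_sqrt (by exact_mod_cast hD.le)
  set R := √(D:ℝ)
  have hform := det3_formula (k := (k:ℝ)) (R := R) (s1 := s1) (s2 := s2) (s3 := s3) hR.ne' n1 n2 n3
  rw [← a1, ← b1, ← a2, ← b2, ← a3, ← b3] at hform
  have hcast : det3 (u1:ℝ) s1 v1 u2 s2 v2 u3 s3 v3 =
      ((det3 u1 s1 v1 u2 s2 v2 u3 s3 v3 : ℤ) : ℝ) := by unfold det3; push_cast; ring
  rw [hcast] at hform
  set Δ := det3 u1 s1 v1 u2 s2 v2 u3 s3 v3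
  have q1 : (0:ℝ) < s1 := by exact_mod_cast p1
  have q2 : (0:ℝ) < s2 := by exact_mod_cast p2
  have q3 : (0:ℝ) < s3 := by exact_mod_cast p3
  have hkR : (0:ℝ) < |(k:ℝ)| := abs_pos.2 (by exact_mod_cast hk)
  have ht0 : 0 < t := by linarith
  have hM0 : 0 < M := by linarith
  have hG1 : (1:ℝ) ≤ (Int.gcd k D : ℝ) := by
    have : 0 < Int.gcd k D := Int.gcd_pos_of_ne_zero_left _ hk
    exact_mod_cast this
  set G : ℝ := (Int.gcd k D : ℝ) with hG
  by_cases hΔ : Δ = 0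
  · rw [hΔ] at hform
    simp only [Int.cast_zero, zero_mul] at hform
    have hz : (s1:ℝ) * s2 * s3 * k ≠ 0 := by
      have : (k:ℝ) ≠ 0 := by exact_mod_cast hk
      positivity
    have := (mul_eq_zero.1 hform.symm).resolve_left hz
    rcases mul_eq_zero.1 this with h | h
    · rcases mul_eq_zero.1 h with h | h
      · left; linarith
      · right; left; linarith
    · right; right; linarith
  · exfalso
    have hle : |k * D| ≤ |2 * (Int.gcd k D : ℤ) ^ 2 * Δ| := by
      apply Int.le_of_dvd
      · have : (Int.gcd k D : ℤ) ≠ 0 := by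
          have : 0 < Int.gcd k D := Int.gcd_pos_of_ne_zero_left _ hk
          exact_mod_cast this.ne'
        positivity
      · rw [abs_dvd_abs]; exact hdvd
    have hleR : |(k:ℝ)| * R ^ 2 ≤ 2 * G ^ 2 * |(Δ:ℝ)| := by
      rw [hRR]
      have : ((|k * D| : ℤ) : ℝ) ≤ ((|2 * (Int.gcd k D : ℤ) ^ 2 * Δ| : ℤ) : ℝ) := by exact_mod_cast hle
      push_cast at this
      have e1 : |(k:ℝ) * D| = |(k:ℝ)| * D := by
        rw [abs_mul, abs_of_pos (show (0:ℝ) < D by exact_mod_cast hD)]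
      have e2 : |2 * G ^ 2 * (Δ:ℝ)| = 2 * G ^ 2 * |(Δ:ℝ)| := by
        rw [abs_mul, abs_of_nonneg (show (0:ℝ) ≤ 2 * G ^ 2 by positivity)]
      rw [← e1, ← e2]
      exact this
    have habs := congrArg abs hform
    simp only [abs_mul] at habs
    rw [abs_of_pos q1, abs_of_pos q2, abs_of_pos q3, abs_of_pos hR,
      abs_of_pos (show (0:ℝ) < 2 by norm_num)] at habs
    have e1 : 0 < |t1| := abs_pos.2 n1
    have e2 : 0 < |t2| := abs_pos.2 n2
    have e3 : 0 < |t3| := abs_pos.2 n3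
    rw [abs_sub_comm] at c31
    have hT : |t1| * |t2| * |t3| * (|(Δ:ℝ)| * (2 * R)) ≤
        |t1| * |t2| * |t3| * (M ^ 3 * |(k:ℝ)| * (8 / t ^ 3)) := by
      calc |t1| * |t2| * |t3| * (|(Δ:ℝ)| * (2 * R)) =
          s1 * s2 * s3 * |(k:ℝ)| * (|t1 - t2| * |t2 - t3| * |t1 - t3|) := by rw [← habs]; ring
        _ ≤ M * M * M * |(k:ℝ)| * ((|t2| * (2 / t)) * (|t3| * (2 / t)) * (|t1| * (2 / t))) := by
          gcongr
        _ = _ := by ring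
    have hT2 : |(Δ:ℝ)| * (2 * R) ≤ M ^ 3 * |(k:ℝ)| * (8 / t ^ 3) :=
      le_of_mul_le_mul_left hT (by positivity)
    have hT3 : |(Δ:ℝ)| * (2 * R) * t ^ 3 ≤ M ^ 3 * |(k:ℝ)| * 8 := by
      rw [mul_div_assoc', le_div_iff₀ (by positivity)] at hT2
      exact hT2
    have hT4 : |(k:ℝ)| * (R ^ 3 * t ^ 3 * 2) ≤ |(k:ℝ)| * (2 * (G ^ 2 * M ^ 3 * 8)) := by
      calc |(k:ℝ)| * (R ^ 3 * t ^ 3 * 2) = (|(k:ℝ)| * R ^ 2) * (2 * R * t ^ 3) := by ring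
        _ ≤ (2 * G ^ 2 * |(Δ:ℝ)|) * (2 * R * t ^ 3) := by gcongr
        _ = 2 * G ^ 2 * (|(Δ:ℝ)| * (2 * R) * t ^ 3) := by ring
        _ ≤ 2 * G ^ 2 * (M ^ 3 * |(k:ℝ)| * 8) := by gcongr
        _ = _ := by ring
    have hT5 := le_of_mul_le_mul_left hT4 hkR
    have hcube : (2 * G * M) ^ 3 < (t * R) ^ 3 := by gcongr
    have hG23 : G ^ 2 ≤ G ^ 3 := pow_le_pow_right₀ hG1 (by norm_num)
    have hM3 : 0 < M ^ 3 := by positivity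
    have f1 : G ^ 2 * M ^ 3 ≤ G ^ 3 * M ^ 3 := by gcongr
    have f2 : (2 * G * M) ^ 3 = 8 * (G ^ 3 * M ^ 3) := by ring
    have f3 : (t * R) ^ 3 = R ^ 3 * t ^ 3 := by ring
    linarith

lemma prim_eq_of_tauC {k D : ℤ} (hk : k ≠ 0) (hD : 0 < D) {u1 s1 v1 u2 s2 v2 : ℤ}
    (h1 : u1 ^ 2 = k * s1 ^ 2 + D * v1 ^ 2) (h2 : u2 ^ 2 = k * s2 ^ 2 + D * v2 ^ 2)
    (p1 : 0 < s1) (p2 : 0 < s2)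
    (g1 : Int.gcd (Int.gcd u1 v1) s1 = 1) (g2 : Int.gcd (Int.gcd u2 v2) s2 = 1)
    (h : tauC D u1 s1 v1 = tauC D u2 s2 v2) : u1 = u2 ∧ s1 = s2 ∧ v1 = v2 := by
  obtain ⟨n1, a1, b1, -⟩ := tauC_facts hk hD p1 h1
  obtain ⟨n2, a2, b2, -⟩ := tauC_facts hk hD p2 h2
  rw [← h] at a2 b2
  have eu : u1 * s2 = u2 * s1 := by
    have : (u1:ℝ) * s2 = u2 * s1 := by rw [a1, a2]; ring
    exact_mod_cast this
  have ev : v1 * s2 = v2 * s1 := by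
    have : (v1:ℝ) * s2 = v2 * s1 := by rw [b1, b2]; ring
    exact_mod_cast this
  have key : ∀ u s v u' s' v' : ℤ, Int.gcd (Int.gcd u v) s = 1 → u * s' = u' * s → v * s' = v' * s →
      s ∣ s' := by
    intro u s v u' s' v' hg hu hv
    have hb := Int.gcd_eq_gcd_ab u v
    have hc : IsCoprime (Int.gcd u v : ℤ) s := Int.isCoprime_iff_gcd_eq_one.2 hg
    apply hc.symm.dvd_of_dvd_mul_left
    rw [hb]
    exact ⟨u' * Int.gcdA u v + v' * Int.gcdB u v, by linear_combination Int.gcdA u v * hu + Int.gcdB u v * hv⟩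
  have d1 := key u1 s1 v1 u2 s2 v2 g1 eu ev
  have d2 := key u2 s2 v2 u1 s1 v1 g2 eu.symm ev.symm
  have hs : s1 = s2 := Int.dvd_antisymm p1.le p2.le d1 d2
  subst hs
  exact ⟨mul_right_cancel₀ p1.ne' eu, rfl, mul_right_cancel₀ p1.ne' ev⟩

lemma tauC_log {k D u s v : ℤ} (hk : k ≠ 0) (hD : 0 < D) (hs : 0 < s) (hv : |v| ≤ s)
    (h : u ^ 2 = k * s ^ 2 + D * v ^ 2) :
    |Real.log (|tauC D u s v|)| ≤ Real.log (2 * (|(k:ℝ)| + D)) := by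
  obtain ⟨h0, -, -, h4⟩ := tauC_facts hk hD hs h
  have hRR : √(D:ℝ) ^ 2 = D := Real.sq_sqrt (by exact_mod_cast hD.le)
  have hR : 0 < √(D:ℝ) := Real.sqrt_pos.2 (by exact_mod_cast hD)
  set R := √(D:ℝ)
  have hsR : (0:ℝ) < s := by exact_mod_cast hs
  have hvR : |(v:ℝ)| ≤ s := by exact_mod_cast hv
  have hk1 : (1:ℝ) ≤ |(k:ℝ)| := by exact_mod_cast Int.one_le_abs hk
  have hD1 : (1:ℝ) ≤ (D:ℝ) := by exact_mod_cast hD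
  set Q : ℝ := |(k:ℝ)| + D with hQ
  have hQ1 : 1 ≤ Q := by linarith
  have hv2 : (v:ℝ) ^ 2 ≤ s ^ 2 := by
    rw [← sq_abs (v:ℝ)]; gcongr
  have hu : |(u:ℝ)| ≤ Q * s := by
    apply abs_le_of_sq_le_sq _ (by positivity)
    have h' : (u:ℝ) ^ 2 = k * s ^ 2 + D * v ^ 2 := by exact_mod_cast h
    rw [h']
    calc (k:ℝ) * s ^ 2 + D * v ^ 2 ≤ |(k:ℝ)| * s ^ 2 + D * s ^ 2 := by
          gcongr; exact le_abs_self _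
      _ = Q * s ^ 2 := by rw [hQ]; ring
      _ ≤ Q ^ 2 * s ^ 2 := by gcongr; nlinarith
      _ = _ := by ring
  have hRv : |R * v| ≤ Q * s := by
    apply abs_le_of_sq_le_sq _ (by positivity)
    calc (R * v) ^ 2 = D * v ^ 2 := by rw [mul_pow, hRR]
      _ ≤ Q * s ^ 2 := by gcongr; rw [hQ]; linarith
      _ ≤ Q ^ 2 * s ^ 2 := by gcongr; nlinarith
      _ = _ := by ring
  have b1 : |tauC D u s v| ≤ 2 * Q := by
    unfold tauC
    rw [abs_div, abs_of_pos hsR, div_le_iff₀ hsR]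
    have := abs_sub (u:ℝ) (R * v)
    linarith
  have b2 : |(k:ℝ) / tauC D u s v| ≤ 2 * Q := by
    rw [h4, abs_div, abs_of_pos hsR, div_le_iff₀ hsR]
    have := abs_add_le (u:ℝ) (R * v)
    linarith
  have hp : 0 < |tauC D u s v| := abs_pos.2 h0
  rw [abs_div, div_le_iff₀ hp] at b2
  rw [abs_le]
  constructor
  · rw [← Real.log_inv]
    apply Real.log_le_log (by positivity)
    rw [inv_le_iff_one_le_mul₀ (by positivity)]
    linarith
  · exact Real.log_le_log hp b1

open Classical in
lemma prim_count (k D : ℤ) (hk : k ≠ 0) (hD : 0 < D) (M t : ℝ) (ht : 1 ≤ t)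
    (hM : 2 * (Int.gcd k D) * M < t * √D) (T : Finset (ℤ × ℤ × ℤ))
    (hT : ∀ z ∈ T, z.1 ^ 2 = k * z.2.1 ^ 2 + D * z.2.2 ^ 2 ∧ 0 < z.2.1 ∧ (z.2.1 : ℝ) ≤ M ∧
      |z.2.2| ≤ z.2.1 ∧ Int.gcd (Int.gcd z.1 z.2.2) z.2.1 = 1) :
    (T.card : ℝ) ≤ 2 * ((k.natAbs.divisors.card : ℝ) ^ 2 * (D.natAbs.divisors.card : ℝ) ^ 2 *
      (2 * (2 * t * Real.log (2 * (|(k:ℝ)| + D)) + 2))) := by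
  obtain ⟨lab1, hl1⟩ := label_conic k D hk
  obtain ⟨lab2, hl2⟩ := label_conic D k hD.ne'
  set Λ := Real.log (2 * (|(k:ℝ)| + D)) with hΛ
  set f : ℤ × ℤ × ℤ → ((ℕ × ℕ) × (ℕ × ℕ)) × (Bool × ℤ) := fun z =>
    ((lab1 z.1 z.2.2, lab2 z.1 z.2.1),
      (decide (0 < tauC D z.1 z.2.1 z.2.2), ⌊t * Real.log |tauC D z.1 z.2.1 z.2.2|⌋)) with hf
  set P : Finset (((ℕ × ℕ) × (ℕ × ℕ)) × (Bool × ℤ)) :=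
    (((k.natAbs.divisors ×ˢ k.natAbs.divisors) ×ˢ (D.natAbs.divisors ×ˢ D.natAbs.divisors)) ×ˢ
      ((Finset.univ : Finset Bool) ×ˢ Finset.Icc ⌊-(t * Λ)⌋ ⌊t * Λ⌋)) with hP
  have ht0 : 0 < t := by linarith
  have g2 : ∀ z ∈ T, Int.gcd (Int.gcd z.1 z.2.1) z.2.2 = 1 := by
    intro z hz
    have := (hT z hz).2.2.2.2
    rw [Int.gcd_assoc] at this ⊢
    rwa [Int.gcd_comm z.2.1]
  have e1 : ∀ z ∈ T, z.1 ^ 2 - D * z.2.2 ^ 2 = k * z.2.1 ^ 2 := by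
    intro z hz; have := (hT z hz).1; linarith
  have e2 : ∀ z ∈ T, z.1 ^ 2 - k * z.2.1 ^ 2 = D * z.2.2 ^ 2 := by
    intro z hz; have := (hT z hz).1; linarith
  have hmaps : ∀ z ∈ T, f z ∈ P := by
    intro z hz
    have a1 := (hl1 z.1 z.2.1 z.2.2 (e1 z hz) (hT z hz).2.2.2.2).1
    have a2 := (hl2 z.1 z.2.2 z.2.1 (e2 z hz) (g2 z hz)).1
    have a3 := tauC_log hk hD (hT z hz).2.1 (hT z hz).2.2.2.1 (hT z hz).1
    rw [← hΛ, abs_le] at a3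
    simp only [hf, hP, Finset.mem_product, Nat.mem_divisors, Finset.mem_univ, true_and,
      Finset.mem_Icc]
    have k0 : k.natAbs ≠ 0 := by simpa using hk
    have d0 : D.natAbs ≠ 0 := by simpa using hD.ne'
    refine ⟨⟨⟨⟨a1.1, k0⟩, ⟨a1.2, k0⟩⟩, ⟨⟨a2.1, d0⟩, ⟨a2.2, d0⟩⟩⟩, ?_, ?_⟩
    · apply Int.floor_le_floor
      nlinarith [a3.1]
    · apply Int.floor_le_floor
      nlinarith [a3.2]
  have hfib : ∀ y ∈ P, (T.filter (fun z => f z = y)).card ≤ 2 := by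
    intro y _
    by_contra hcon
    push Not at hcon
    obtain ⟨z1, m1, z2, m2, z3, m3, n12, n13, n23⟩ := Finset.two_lt_card.1 hcon
    rw [Finset.mem_filter] at m1 m2 m3
    obtain ⟨i1, j1⟩ := m1
    obtain ⟨i2, j2⟩ := m2
    obtain ⟨i3, j3⟩ := m3
    have key : ∀ z z', z ∈ T → z' ∈ T → f z = f z' →
        k ∣ 2 * (Int.gcd k D) * (z.1 * z'.2.2 - z'.1 * z.2.2) ∧
        D ∣ 2 * (Int.gcd k D) * (z.1 * z'.2.1 - z'.1 * z.2.1) ∧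
        |tauC D z.1 z.2.1 z.2.2 - tauC D z'.1 z'.2.1 z'.2.2| ≤
          |tauC D z'.1 z'.2.1 z'.2.2| * (2 / t) := by
      intro z z' hz hz' hzz
      simp only [hf, Prod.mk.injEq, decide_eq_decide] at hzz
      obtain ⟨⟨q1, q2⟩, q3, q4⟩ := hzz
      refine ⟨?_, ?_, ?_⟩
      · exact (hl1 _ _ _ (e1 z hz) (hT z hz).2.2.2.2).2 _ _ _ (e1 z' hz') (hT z' hz').2.2.2.2 q1
      · have := (hl2 _ _ _ (e2 z hz) (g2 z hz)).2 _ _ _ (e2 z' hz') (g2 z' hz') q2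
        rwa [Int.gcd_comm D k] at this
      · apply close_of_log ht _ _ q3 q4
        · exact (tauC_facts hk hD (hT z hz).2.1 (hT z hz).1).1
        · exact (tauC_facts hk hD (hT z' hz').2.1 (hT z' hz').1).1
    have K12 := key z1 z2 i1 i2 (j1.trans j2.symm)
    have K23 := key z2 z3 i2 i3 (j2.trans j3.symm)
    have K13 := key z1 z3 i1 i3 (j1.trans j3.symm)
    have K31 := key z3 z1 i3 i1 (j3.trans j1.symm)
    have hd := det3_dvd (G := Int.gcd k D) rfl K12.1 K13.1 K23.1 K12.2.1 K13.2.1 K23.2.1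
    have heq : ∀ z z', z ∈ T → z' ∈ T →
        tauC D z.1 z.2.1 z.2.2 = tauC D z'.1 z'.2.1 z'.2.2 → z = z' := by
      intro z z' hz hz' h
      obtain ⟨q1, q2, q3⟩ := prim_eq_of_tauC hk hD (hT z hz).1 (hT z' hz').1 (hT z hz).2.1
        (hT z' hz').2.1 (hT z hz).2.2.2.2 (hT z' hz').2.2.2.2 h
      exact Prod.ext q1 (Prod.ext q2 q3)
    rcases three_points hk hD ht hM (hT z1 i1).1 (hT z2 i2).1 (hT z3 i3).1 (hT z1 i1).2.1
      (hT z2 i2).2.1 (hT z3 i3).2.1 (hT z1 i1).2.2.1 (hT z2 i2).2.2.1 (hT z3 i3).2.2.1 hd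
      K12.2.2 K23.2.2 K31.2.2 with h | h | h
    · exact n12 (heq _ _ i1 i2 h)
    · exact n23 (heq _ _ i2 i3 h)
    · exact n13 (heq _ _ i1 i3 h)
  have hcard := Finset.card_le_mul_card_image_of_maps_to hmaps 2 hfib
  have hPc : P.card = ((k.natAbs.divisors.card * k.natAbs.divisors.card) *
      (D.natAbs.divisors.card * D.natAbs.divisors.card)) *
      (2 * (⌊t * Λ⌋ + 1 - ⌊-(t * Λ)⌋).toNat) := by
    rw [hP]
    simp only [Finset.card_product, Int.card_Icc, Finset.card_univ, Fintype.card_bool]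
  have hΛ0 : 0 ≤ Λ := by
    apply Real.log_nonneg
    have hk1 : (1:ℝ) ≤ |(k:ℝ)| := by exact_mod_cast Int.one_le_abs hk
    have hD1 : (1:ℝ) ≤ (D:ℝ) := by exact_mod_cast hD
    linarith
  have hIcc : (((⌊t * Λ⌋ + 1 - ⌊-(t * Λ)⌋).toNat : ℕ) : ℝ) ≤ 2 * t * Λ + 2 := by
    have h0 : (0:ℤ) ≤ ⌊t * Λ⌋ + 1 - ⌊-(t * Λ)⌋ := by
      have : ⌊-(t * Λ)⌋ ≤ ⌊t * Λ⌋ := by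
        apply Int.floor_le_floor
        have : 0 ≤ t * Λ := by positivity
        linarith
      omega
    have h1 : (((⌊t * Λ⌋ + 1 - ⌊-(t * Λ)⌋).toNat : ℕ) : ℝ) = ((⌊t * Λ⌋ + 1 - ⌊-(t * Λ)⌋ : ℤ) : ℝ) := by
      rw [← Int.cast_natCast, Int.toNat_of_nonneg h0]
    rw [h1]
    push_cast
    have h2 := Int.floor_le (t * Λ)
    have h3 := Int.lt_floor_add_one (-(t * Λ))
    linarith
  calc (T.card : ℝ) ≤ ((2 * P.card : ℕ) : ℝ) := by exact_mod_cast hcard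
    _ = 2 * ((k.natAbs.divisors.card : ℝ) ^ 2 * (D.natAbs.divisors.card : ℝ) ^ 2 *
      (2 * (((⌊t * Λ⌋ + 1 - ⌊-(t * Λ)⌋).toNat : ℕ) : ℝ))) := by
        rw [hPc]; push_cast; ring
    _ ≤ _ := by gcongr

open Classical in
lemma conic_count (k D : ℤ) (hk : k ≠ 0) (hD : 0 < D) (M t : ℝ) (ht : 1 ≤ t) (E : ℕ) (hE : E ≠ 0)
    (hM : 2 * (Int.gcd k D) * M < t * √D) (T : Finset (ℤ × ℤ × ℤ))
    (hT : ∀ z ∈ T, z.1 ^ 2 = k * z.2.1 ^ 2 + D * z.2.2 ^ 2 ∧ 0 < z.2.1 ∧ (z.2.1 : ℝ) ≤ M ∧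
      |z.2.2| ≤ z.2.1 ∧ Int.gcd (Int.gcd z.1 z.2.2) z.2.1 ∣ E) :
    (T.card : ℝ) ≤ E.divisors.card * (2 * ((k.natAbs.divisors.card : ℝ) ^ 2 *
      (D.natAbs.divisors.card : ℝ) ^ 2 * (2 * (2 * t * Real.log (2 * (|(k:ℝ)| + D)) + 2)))) := by
  have hmaps : ∀ z ∈ T, Int.gcd (Int.gcd z.1 z.2.2) z.2.1 ∈ E.divisors := by
    intro z hz
    exact Nat.mem_divisors.2 ⟨(hT z hz).2.2.2.2, hE⟩
  rw [Finset.card_eq_sum_card_fiberwise hmaps]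
  push_cast
  rw [← nsmul_eq_mul]
  apply Finset.sum_le_card_nsmul
  intro g hg
  set Tg := T.filter (fun z => Int.gcd (Int.gcd z.1 z.2.2) z.2.1 = g) with hTg
  have hg0 : g ≠ 0 := (Nat.pos_of_mem_divisors hg).ne'
  have hgZ : (g:ℤ) ≠ 0 := by exact_mod_cast hg0
  have hmem : ∀ z ∈ Tg, (g:ℤ) * (z.1 / g) = z.1 ∧ (g:ℤ) * (z.2.1 / g) = z.2.1 ∧
      (g:ℤ) * (z.2.2 / g) = z.2.2 := by
    intro z hz
    have h := (Finset.mem_filter.1 hz).2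
    have h1 : (g:ℤ) ∣ (Int.gcd z.1 z.2.2 : ℤ) := by rw [← h]; exact Int.gcd_dvd_left _ _
    have h2 : (g:ℤ) ∣ z.2.1 := by rw [← h]; exact Int.gcd_dvd_right _ _
    exact ⟨Int.mul_ediv_cancel' (h1.trans (Int.gcd_dvd_left _ _)), Int.mul_ediv_cancel' h2,
      Int.mul_ediv_cancel' (h1.trans (Int.gcd_dvd_right _ _))⟩
  set φ : ℤ × ℤ × ℤ → ℤ × ℤ × ℤ := fun z => (z.1 / g, z.2.1 / g, z.2.2 / g) with hφ
  have hinj : Set.InjOn φ Tg := by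
    intro z hz z' hz' h
    simp only [hφ, Prod.mk.injEq] at h
    have a := hmem z hz
    have b := hmem z' hz'
    refine Prod.ext ?_ (Prod.ext ?_ ?_)
    · rw [← a.1, h.1, b.1]
    · rw [← a.2.1, h.2.1, b.2.1]
    · rw [← a.2.2, h.2.2, b.2.2]
  rw [← Finset.card_image_of_injOn hinj]
  apply prim_count k D hk hD M t ht hM
  intro w hw
  obtain ⟨z, hz, rfl⟩ := Finset.mem_image.1 hw
  obtain ⟨a1, a2, a3⟩ := hmem z hz
  obtain ⟨b1, b2, b3, b4, -⟩ := hT z (Finset.mem_filter.1 hz).1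
  have hgg := (Finset.mem_filter.1 hz).2
  have hgp : (0:ℤ) < g := by positivity
  have hg1 : (1:ℤ) ≤ g := hgp
  simp only [hφ]
  set x := z.1 / (g:ℤ)
  set y := z.2.1 / (g:ℤ)
  set w := z.2.2 / (g:ℤ)
  rw [← a1, ← a2, ← a3] at b1
  rw [← a2] at b2 b3 b4
  rw [← a3] at b4
  rw [← a1, ← a2, ← a3] at hgg
  have y0 : 0 < y := pos_of_mul_pos_right b2 hgp.le
  refine ⟨?_, y0, ?_, ?_, ?_⟩
  · have : (g:ℤ) ^ 2 * x ^ 2 = (g:ℤ) ^ 2 * (k * y ^ 2 + D * w ^ 2) := by linear_combination b1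
    exact mul_left_cancel₀ (by positivity) this
  · refine le_trans ?_ b3
    have : y ≤ g * y := by nlinarith
    exact_mod_cast this
  · rw [abs_mul, abs_of_pos hgp] at b4
    exact le_of_mul_le_mul_left b4 hgp
  · rw [Int.gcd_mul_left] at hgg
    simp only [Int.natAbs_natCast] at hgg
    push_cast at hgg
    rw [Int.gcd_mul_left] at hgg
    simp only [Int.natAbs_natCast] at hgg
    exact Nat.eq_of_mul_eq_mul_left (Nat.pos_of_ne_zero hg0) (by simpa using hgg)

lemma pair_k_exists {d a1 b1 c1 a2 b2 c2 : ℤ} (h1 : b1 ^ 2 - 4 * a1 * c1 = d)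
    (h2 : b2 ^ 2 - 4 * a2 * c2 = d) :
    2 * (a2 * c1 + a1 * c2 - (b1 * b2 - d) / 2) = 2 * (a2 * c1 + a1 * c2) - (b1 * b2 - d) := by
  have hev : (2:ℤ) ∣ b1 * b2 - d := by
    have p1 : (b1 ^ 2 - d) % 2 = 0 := by
      have : b1 ^ 2 - d = 2 * (2 * a1 * c1) := by linarith
      omega
    have p2 : (b2 ^ 2 - d) % 2 = 0 := by
      have : b2 ^ 2 - d = 2 * (2 * a2 * c2) := by linarith
      omega
    have e1 : Even (b1 ^ 2 - d) := Int.even_iff.2 p1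
    have e2 : Even (b2 ^ 2 - d) := Int.even_iff.2 p2
    have : Even (b1 * b2 - d) := by
      rw [Int.even_sub, Int.even_pow' (by norm_num)] at e1 e2
      rw [Int.even_sub, Int.even_mul]
      tauto
    exact this.two_dvd
  have := Int.mul_ediv_cancel' hev
  linarith

lemma pair_algebra {d : ℤ} (hd : 100 ≤ d) (hsq : ¬ IsSquare d) {X : ℝ} 
    {a1 b1 c1 a2 b2 c2 k : ℤ} (h1 : b1 ^ 2 - 4 * a1 * c1 = d)
    (h2 : b2 ^ 2 - 4 * a2 * c2 = d) (hk : 2 * k = 2 * (a2 * c1 + a1 * c2) - (b1 * b2 - d))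
    (p1 : 0 < a1) (p2 : 0 < a2) (x1 : (a1:ℝ) ≤ X) (x2 : (a2:ℝ) ≤ X) (hne : a1 ≠ a2)
    (hx : |(-b1 + √d) / (2 * a1) - (-b2 + √d) / (2 * a2)| ≤ 2 / X) :
    k ≠ 0 ∧ (k:ℝ) ^ 2 ≤ 9 * d ∧
    (a1 * b2 - a2 * b1) ^ 2 = k * (a1 + a2) ^ 2 + (d - k) * (a2 - a1) ^ 2 ∧
    Int.gcd (Int.gcd (a1 * b2 - a2 * b1) (a2 - a1)) (a1 + a2) ∣ 8 * k.natAbs * (d - k).natAbs := by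
  have hid : (a1 * b2 - a2 * b1) ^ 2 = k * (a1 + a2) ^ 2 + (d - k) * (a2 - a1) ^ 2 := by
    have : 2 * (a1 * b2 - a2 * b1) ^ 2 = 2 * k * (a1 + a2) ^ 2 + (2 * d - 2 * k) * (a2 - a1) ^ 2 := by
      rw [hk]
      linear_combination (2 * a2 ^ 2) * h1 + (2 * a1 ^ 2) * h2
    linarith
  have q1 : (0:ℝ) < a1 := by exact_mod_cast p1
  have q2 : (0:ℝ) < a2 := by exact_mod_cast p2
  have hX : 0 < X := by linarith
  refine ⟨?_, ?_, hid, ?_⟩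
  · rintro rfl
    have hv : a2 - a1 ≠ 0 := sub_ne_zero.2 hne.symm
    have hid2 : (a1 * b2 - a2 * b1) ^ 2 = d * (a2 - a1) ^ 2 := by rw [hid]; ring
    have : (a2 - a1) ^ 2 ∣ (a1 * b2 - a2 * b1) ^ 2 := ⟨d, by rw [hid2]; ring⟩
    rw [Int.pow_dvd_pow_iff (by norm_num)] at this
    obtain ⟨w, hw⟩ := this
    apply hsq
    refine ⟨w, ?_⟩
    rw [hw] at hid2
    have : (a2 - a1) ^ 2 * d = (a2 - a1) ^ 2 * (w * w) := by linear_combination -hid2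
    exact mul_left_cancel₀ (pow_ne_zero _ hv) this
  · have hdR : (100:ℝ) ≤ d := by exact_mod_cast hd
    have hrr : √(d:ℝ) ^ 2 = d := Real.sq_sqrt (by linarith)
    have hr10 : 10 ≤ √(d:ℝ) := by
      apply Real.le_sqrt_of_sq_le; linarith
    set r := √(d:ℝ)
    set δ := (-b1 + r) / (2 * a1) - (-b2 + r) / (2 * a2) with hδ
    have hδ' : 2 * a1 * a2 * δ = (a1 * b2 - a2 * b1) + r * (a2 - a1) := by
      rw [hδ]; field_simp; ring
    have hidR : ((a1:ℝ) * b2 - a2 * b1) ^ 2 = k * (a1 + a2) ^ 2 + (r ^ 2 - k) * (a2 - a1) ^ 2 := by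
      rw [hrr]; exact_mod_cast hid
    have hkf : (k:ℝ) = δ * (a1 * a2 * δ - r * (a2 - a1)) := by
      have h4 : (4 * a1 * a2 : ℝ) * k = (4 * a1 * a2 : ℝ) * (δ * (a1 * a2 * δ - r * (a2 - a1))) := by
        have : (4 * a1 * a2 : ℝ) * (δ * (a1 * a2 * δ - r * (a2 - a1))) =
            (2 * a1 * a2 * δ) * ((2 * a1 * a2 * δ) - 2 * r * (a2 - a1)) := by ring
        rw [this, hδ']
        linear_combination -hidR
      exact mul_left_cancel₀ (by positivity) h4
    have hv : |(a2:ℝ) - a1| ≤ X := by rw [abs_le]; constructor <;> linarith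
    have hkb : |(k:ℝ)| ≤ 4 + 2 * r := by
      rw [hkf, abs_mul]
      calc |δ| * |a1 * a2 * δ - r * (a2 - a1)|
          ≤ |δ| * (a1 * a2 * |δ| + r * |(a2:ℝ) - a1|) := by
            gcongr
            refine (abs_sub _ _).trans ?_
            rw [abs_mul, abs_mul, abs_mul, abs_of_pos q1, abs_of_pos q2,
              abs_of_pos (show 0 < r by linarith)]
        _ ≤ (2 / X) * (X * X * (2 / X) + r * X) := by gcongr
        _ = 4 + 2 * r := by field_simp; ring
    have : |(k:ℝ)| ≤ 3 * r := by linarith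
    rw [← sq_abs, ← hrr]
    calc |(k:ℝ)| ^ 2 ≤ (3 * r) ^ 2 := by gcongr
      _ = _ := by ring
  · set g := Int.gcd (Int.gcd (a1 * b2 - a2 * b1) (a2 - a1)) (a1 + a2) with hg
    have hs : (g:ℤ) ∣ a1 + a2 := Int.gcd_dvd_right _ _
    have hv : (g:ℤ) ∣ a2 - a1 := (Int.gcd_dvd_left _ _).trans (Int.gcd_dvd_right _ _)
    have g1 : (g:ℤ) ∣ 2 * a1 := by have := dvd_sub hs hv; ring_nf at this ⊢; exact this
    have g2 : (g:ℤ) ∣ 2 * a2 := by have := dvd_add hs hv; ring_nf at this ⊢; exact this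
    have : (g:ℤ) ∣ 8 * k * (d - k) := by
      have e : 8 * k * (d - k) = (2 * a1) * (-(4 * d * c1 + 16 * a2 * c1 * c2 - 4 * b1 * b2 * c2 + 4 * (a2 * c1 + a1 * c2) * c2))
          + (2 * a2) * (-(4 * d * c2 - 4 * b1 * b2 * c1 + 4 * (a2 * c1 + a1 * c2) * c1)) := by
        have hd2 : d - 2 * k = b1 * b2 - 2 * (a2 * c1 + a1 * c2) := by linarith
        have : 8 * k * (d - k) = 2 * d ^ 2 - 2 * (d - 2 * k) ^ 2 := by ring
        rw [this, hd2]
        have hb1 : b1 ^ 2 = d + 4 * a1 * c1 := by linarith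
        have hb2 : b2 ^ 2 = d + 4 * a2 * c2 := by linarith
        have hb : (b1 * b2) ^ 2 = (d + 4 * a1 * c1) * (d + 4 * a2 * c2) := by rw [mul_pow, hb1, hb2]
        linear_combination -2 * hb
      rw [e]
      exact dvd_add (g1.mul_right _) (g2.mul_right _)
    have h3 := Int.natAbs_dvd_natAbs.2 this
    simpa [Int.natAbs_mul] using h3

open Classical in
lemma pairs_fixed_k {d : ℤ} (hd : 100 ≤ d) (hsq : ¬ IsSquare d) {X : ℝ} (hX : √d ≤ X)
    (F : Finset ℤ) (b c : ℤ → ℤ)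
    (hF : ∀ a ∈ F, 0 < a ∧ (a:ℝ) ≤ X ∧ b a ^ 2 - 4 * a * c a = d) (k : ℤ) (hk0 : k ≠ 0)
    (hk9 : (k:ℝ) ^ 2 ≤ 9 * d)
    (P : Finset (ℤ × ℤ)) 
    (hP : ∀ p ∈ P, p.1 ∈ F ∧ p.2 ∈ F ∧ p.1 ≠ p.2 ∧
      |(-b p.1 + √d) / (2 * p.1) - (-b p.2 + √d) / (2 * p.2)| ≤ 2 / X ∧
      p.2 * c p.1 + p.1 * c p.2 - (b p.1 * b p.2 - d) / 2 = k) :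
    0 < d - k ∧ (P.card : ℝ) ≤ (8 * k.natAbs * (d - k).natAbs).divisors.card *
      (2 * ((k.natAbs.divisors.card : ℝ) ^ 2 * ((d - k).natAbs.divisors.card : ℝ) ^ 2 *
        (2 * (2 * (8 * (Int.gcd k d) * X / √d) * Real.log (2 * (|(k:ℝ)| + (d - k : ℤ))) + 2)))) := by
  have hdR : (100:ℝ) ≤ d := by exact_mod_cast hd
  have hrr : √(d:ℝ) ^ 2 = d := Real.sq_sqrt (by linarith)
  have hr10 : 10 ≤ √(d:ℝ) := by
    apply Real.le_sqrt_of_sq_le; linarith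
  set r := √(d:ℝ) with hr
  have hkr : |(k:ℝ)| ≤ 3 * r := by
    apply abs_le_of_sq_le_sq _ (by linarith)
    rw [mul_pow, hrr]; linarith
  have hDR : r ^ 2 / 4 < ((d - k : ℤ) : ℝ) := by
    push_cast
    rw [← hrr]
    have := le_abs_self (k:ℝ)
    nlinarith
  have hD : 0 < d - k := by
    have : (0:ℝ) < ((d - k : ℤ) : ℝ) := lt_of_le_of_lt (by positivity) hDR
    exact_mod_cast this
  refine ⟨hD, ?_⟩
  have hG : Int.gcd k (d - k) = Int.gcd k d := by simp
  have hG1 : (1:ℝ) ≤ (Int.gcd k d : ℝ) := by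
    have : 0 < Int.gcd k d := Int.gcd_pos_of_ne_zero_left _ hk0
    exact_mod_cast this
  set φ : ℤ × ℤ → ℤ × ℤ × ℤ := fun p =>
    (p.1 * b p.2 - p.2 * b p.1, p.1 + p.2, p.2 - p.1) with hφ
  have hinj : Set.InjOn φ P := by
    intro p _ q _ h
    simp only [hφ, Prod.mk.injEq] at h
    obtain ⟨-, h1, h2⟩ := h
    refine Prod.ext ?_ ?_ <;> omega
  rw [← Finset.card_image_of_injOn hinj]
  have hX0 : 0 < X := by linarith
  apply conic_count k (d - k) hk0 hD (2 * X) (8 * (Int.gcd k d) * X / r)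
  · rw [le_div_iff₀ (by linarith)]
    nlinarith
  · have : (d - k).natAbs ≠ 0 := by simpa using hD.ne'
    have : k.natAbs ≠ 0 := by simpa using hk0
    positivity
  · rw [hG]
    have hsD : r / 2 < √((d - k : ℤ) : ℝ) := by
      apply Real.lt_sqrt_of_sq_lt
      calc (r / 2) ^ 2 = r ^ 2 / 4 := by ring
        _ < _ := hDR
    rw [div_mul_eq_mul_div, lt_div_iff₀ (by linarith)]
    have h8 : 0 < 8 * (Int.gcd k d : ℝ) * X := by positivity
    nlinarith
  · intro z hz
    obtain ⟨p, hp, rfl⟩ := Finset.mem_image.1 hz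
    obtain ⟨m1, m2, hne, hx, hkk⟩ := hP p hp
    obtain ⟨p1, x1, e1⟩ := hF _ m1
    obtain ⟨p2, x2, e2⟩ := hF _ m2
    have hk2 := pair_k_exists e1 e2
    rw [hkk] at hk2
    obtain ⟨-, -, r1, r2⟩ := pair_algebra hd hsq e1 e2 hk2 p1 p2 x1 x2 hne hx
    refine ⟨r1, ?_, ?_, ?_, r2⟩
    · show 0 < p.1 + p.2
      omega
    · show ((p.1 + p.2 : ℤ) : ℝ) ≤ 2 * X
      push_cast; linarith
    · show |p.2 - p.1| ≤ p.1 + p.2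
      rw [abs_le]; constructor <;> omega

lemma gcd_sum_le (N d : ℕ) (hd : d ≠ 0) :
    ∑ n ∈ Finset.Ioc 0 N, Nat.gcd n d ≤ N * d.divisors.card := by
  calc ∑ n ∈ Finset.Ioc 0 N, Nat.gcd n d
      ≤ ∑ n ∈ Finset.Ioc 0 N, ∑ e ∈ d.divisors, if e ∣ n then e else 0 := by
        apply Finset.sum_le_sum
        intro n _
        have : Nat.gcd n d ∈ d.divisors := Nat.mem_divisors.2 ⟨Nat.gcd_dvd_right _ _, hd⟩
        have h := Finset.single_le_sum (f := fun e => if e ∣ n then e else 0)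
          (fun i _ => Nat.zero_le _) this
        simpa [Nat.gcd_dvd_left] using h
    _ = ∑ e ∈ d.divisors, ∑ n ∈ Finset.Ioc 0 N, if e ∣ n then e else 0 := Finset.sum_comm
    _ ≤ ∑ e ∈ d.divisors, N := by
        apply Finset.sum_le_sum
        intro e _
        rw [← Finset.sum_filter, Finset.sum_const, smul_eq_mul, Nat.Ioc_filter_dvd_card_eq_div]
        exact Nat.div_mul_le_self N e
    _ = _ := by rw [Finset.sum_const, smul_eq_mul, mul_comm]

lemma fixed_k_bound {ε C : ℝ} (hε : 0 < ε) (hC : 1 ≤ C)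
    (hdiv : ∀ n : ℕ, n ≠ 0 → (n.divisors.card : ℝ) ≤ C * (n : ℝ) ^ ε)
    {d k : ℤ} (hd : 100 ≤ d) (hk0 : k ≠ 0) (hk9 : (k:ℝ) ^ 2 ≤ 9 * d) (hD : 0 < d - k) {t : ℝ}
    (ht : 1 ≤ t) :
    ((8 * k.natAbs * (d - k).natAbs).divisors.card : ℝ) *
      (2 * ((k.natAbs.divisors.card : ℝ) ^ 2 * ((d - k).natAbs.divisors.card : ℝ) ^ 2 *
        (2 * (2 * t * Real.log (2 * (|(k:ℝ)| + (d - k : ℤ))) + 2)))) ≤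
    4 * C ^ 5 * (4 / ε + 2) * ((d:ℝ) ^ ε) ^ 10 * t := by
  have hdR : (100:ℝ) ≤ d := by exact_mod_cast hd
  have hd0 : (0:ℝ) < d := by linarith
  have hz1 : 1 ≤ (d:ℝ) ^ ε := Real.one_le_rpow (by linarith) hε.le
  set z := (d:ℝ) ^ ε with hz
  have hkd : |(k:ℝ)| ≤ d := by
    apply abs_le_of_sq_le_sq _ hd0.le
    nlinarith
  have hka : ((k.natAbs : ℕ) : ℝ) = |(k:ℝ)| := by rw [Nat.cast_natAbs]; simp
  have hDa : (((d - k).natAbs : ℕ) : ℝ) = ((d - k : ℤ) : ℝ) := by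
    rw [Nat.cast_natAbs, abs_of_pos hD]
  have hD2 : ((d - k : ℤ) : ℝ) ≤ 2 * d := by
    push_cast; have := neg_abs_le (k:ℝ); linarith
  have hD0 : (0:ℝ) < ((d - k : ℤ) : ℝ) := by exact_mod_cast hD
  have hkn : k.natAbs ≠ 0 := by simpa using hk0
  have hDn : (d - k).natAbs ≠ 0 := by simpa using hD.ne'
  have zpow : ∀ m : ℕ, ((d:ℝ) ^ m) ^ ε = z ^ m := by
    intro m
    rw [hz, ← Real.rpow_natCast, ← Real.rpow_mul hd0.le, mul_comm, Real.rpow_mul hd0.le,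
      Real.rpow_natCast]
  have t1 : ((8 * k.natAbs * (d - k).natAbs).divisors.card : ℝ) ≤ C * z ^ 3 := by
    refine (hdiv _ (by positivity)).trans ?_
    gcongr
    rw [← zpow 3]
    apply Real.rpow_le_rpow (by positivity) _ hε.le
    push_cast
    rw [hka, hDa]
    calc 8 * |(k:ℝ)| * ((d - k : ℤ) : ℝ) ≤ 8 * d * (2 * d) := by gcongr
      _ ≤ (d:ℝ) ^ 3 := by nlinarith [sq_nonneg (d:ℝ)]
  have t2 : (k.natAbs.divisors.card : ℝ) ≤ C * z := by
    refine (hdiv _ hkn).trans ?_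
    gcongr
    rw [hz]
    apply Real.rpow_le_rpow (by positivity) _ hε.le
    rw [hka]; exact hkd
  have t3 : ((d - k).natAbs.divisors.card : ℝ) ≤ C * z ^ 2 := by
    refine (hdiv _ hDn).trans ?_
    gcongr
    rw [← zpow 2]
    apply Real.rpow_le_rpow (by positivity) _ hε.le
    rw [hDa]; nlinarith
  have t4 : Real.log (2 * (|(k:ℝ)| + (d - k : ℤ))) ≤ 2 * (z / ε) := by
    have hk1 : (0:ℝ) ≤ |(k:ℝ)| := abs_nonneg _
    calc Real.log (2 * (|(k:ℝ)| + (d - k : ℤ))) ≤ Real.log ((d:ℝ) ^ 2) := by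
          apply Real.log_le_log (by positivity)
          nlinarith
      _ = 2 * Real.log d := by rw [Real.log_pow]; norm_num
      _ ≤ 2 * (z / ε) := by
          gcongr
          exact Real.log_le_rpow_div hd0.le hε
  have t0 : 0 ≤ 2 * t * Real.log (2 * (|(k:ℝ)| + (d - k : ℤ))) + 2 := by
    have : 0 ≤ Real.log (2 * (|(k:ℝ)| + (d - k : ℤ))) := by
      apply Real.log_nonneg
      have : (1:ℝ) ≤ ((d - k : ℤ) : ℝ) := by exact_mod_cast hD
      have hk1 : (0:ℝ) ≤ |(k:ℝ)| := abs_nonneg _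
      linarith
    positivity
  have t5 : 2 * t * Real.log (2 * (|(k:ℝ)| + (d - k : ℤ))) + 2 ≤ (4 / ε + 2) * z * t := by
    calc 2 * t * Real.log (2 * (|(k:ℝ)| + (d - k : ℤ))) + 2 ≤ 2 * t * (2 * (z / ε)) + 2 * (t * z) := by
          gcongr
          nlinarith
      _ = _ := by ring
  calc _ ≤ (C * z ^ 3) * (2 * ((C * z) ^ 2 * (C * z ^ 2) ^ 2 * (2 * ((4 / ε + 2) * z * t)))) := by
        gcongr
    _ = 4 * C ^ 5 * (4 / ε + 2) * z ^ 10 * t := by ring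

open Classical in
theorem pair_count (ε : ℝ) (hε : 0 < ε) : ∃ C : ℝ, 0 < C ∧
    ∀ d : ℤ, 100 ≤ d → ¬ IsSquare d → ∀ X : ℝ, √d ≤ X → ∀ (F : Finset ℤ) (b c : ℤ → ℤ),
    (∀ a ∈ F, 0 < a ∧ (a:ℝ) ≤ X ∧ b a ^ 2 - 4 * a * c a = d) →
    (((F ×ˢ F).filter (fun p => p.1 ≠ p.2 ∧
      |(-b p.1 + √d) / (2 * p.1) - (-b p.2 + √d) / (2 * p.2)| ≤ 2 / X)).card : ℝ) ≤
      C * (d:ℝ) ^ ε * X := by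
  obtain ⟨C, hC1, hdiv⟩ := divisor_bound (ε / 11) (by positivity)
  set η := ε / 11 with hη
  have hη0 : 0 < η := by positivity
  refine ⟨192 * C ^ 6 * (4 / η + 2), by positivity, ?_⟩
  intro d hd hsq X hX F b c hF
  set P := (F ×ˢ F).filter (fun p => p.1 ≠ p.2 ∧
      |(-b p.1 + √d) / (2 * p.1) - (-b p.2 + √d) / (2 * p.2)| ≤ 2 / X) with hP
  have hdR : (100:ℝ) ≤ d := by exact_mod_cast hd
  have hd0 : (0:ℝ) < d := by linarith
  have hrr : √(d:ℝ) ^ 2 = d := Real.sq_sqrt (by linarith)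
  have hr10 : 10 ≤ √(d:ℝ) := by
    apply Real.le_sqrt_of_sq_le; linarith
  have hX0 : 0 < X := by linarith
  set kf : ℤ × ℤ → ℤ := fun p => p.2 * c p.1 + p.1 * c p.2 - (b p.1 * b p.2 - d) / 2 with hkf
  have hmem : ∀ p ∈ P, p.1 ∈ F ∧ p.2 ∈ F ∧ p.1 ≠ p.2 ∧
      |(-b p.1 + √d) / (2 * p.1) - (-b p.2 + √d) / (2 * p.2)| ≤ 2 / X := by
    intro p hp
    rw [hP, Finset.mem_filter, Finset.mem_product] at hp
    exact ⟨hp.1.1, hp.1.2, hp.2.1, hp.2.2⟩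
  have hkp : ∀ p ∈ P, kf p ≠ 0 ∧ (kf p : ℝ) ^ 2 ≤ 9 * d := by
    intro p hp
    obtain ⟨m1, m2, hne, hx⟩ := hmem p hp
    obtain ⟨p1, x1, e1⟩ := hF _ m1
    obtain ⟨p2, x2, e2⟩ := hF _ m2
    obtain ⟨r1, r2, -, -⟩ := pair_algebra hd hsq e1 e2 (pair_k_exists e1 e2) p1 p2 x1 x2 hne hx
    exact ⟨r1, r2⟩
  set r := √(d:ℝ) with hr
  set N : ℕ := ⌊3 * r⌋₊ with hN
  set A : ℝ := 4 * C ^ 5 * (4 / η + 2) * ((d:ℝ) ^ η) ^ 10 * (8 * X / r) with hA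
  have hA0 : 0 ≤ A := by positivity
  have hfix : ∀ k : ℤ, ((P.filter (fun p => kf p = k)).card : ℝ) ≤ A * Int.gcd k d := by
    intro k
    rcases Finset.eq_empty_or_nonempty (P.filter (fun p => kf p = k)) with h | h
    · rw [h]; simp only [Finset.card_empty, Nat.cast_zero]; positivity
    · obtain ⟨p0, hp0⟩ := h
      rw [Finset.mem_filter] at hp0
      obtain ⟨k0, k9⟩ := hkp p0 hp0.1
      rw [hp0.2] at k0 k9
      obtain ⟨hD, hb⟩ := pairs_fixed_k hd hsq hX F b c hF k k0 k9 (P.filter (fun p => kf p = k)) (by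
        intro p hp
        rw [Finset.mem_filter] at hp
        obtain ⟨m1, m2, hne, hx⟩ := hmem p hp.1
        exact ⟨m1, m2, hne, hx, hp.2⟩)
      refine hb.trans ?_
      have hG1 : (1:ℝ) ≤ (Int.gcd k d : ℝ) := by
        have : 0 < Int.gcd k d := Int.gcd_pos_of_ne_zero_left _ k0
        exact_mod_cast this
      refine (fixed_k_bound hη0 hC1 hdiv hd k0 k9 hD ?_).trans (le_of_eq ?_)
      · rw [le_div_iff₀ (by linarith)]
        nlinarith
      · rw [hA]; ring
  have hmaps : ∀ p ∈ P, (kf p).natAbs ∈ Finset.Ioc 0 N := by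
    intro p hp
    obtain ⟨k0, k9⟩ := hkp p hp
    rw [Finset.mem_Ioc]
    refine ⟨Int.natAbs_pos.2 k0, ?_⟩
    apply Nat.le_floor
    rw [Nat.cast_natAbs, Int.cast_abs]
    apply abs_le_of_sq_le_sq _ (by linarith)
    rw [mul_pow, hrr]; linarith
  have hcount : (P.card : ℝ) ≤ ∑ n ∈ Finset.Ioc 0 N, 2 * A * (Nat.gcd n d.natAbs : ℝ) := by
    rw [Finset.card_eq_sum_card_fiberwise hmaps]
    push_cast
    apply Finset.sum_le_sum
    intro n _
    have hsub : P.filter (fun p => (kf p).natAbs = n) ⊆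
        P.filter (fun p => kf p = (n:ℤ)) ∪ P.filter (fun p => kf p = -(n:ℤ)) := by
      intro p hp
      rw [Finset.mem_filter] at hp
      rw [Finset.mem_union]
      have := hp.2
      rcases Int.natAbs_eq (kf p) with h | h
      · left; exact Finset.mem_filter.2 ⟨hp.1, by rw [h, this]⟩
      · right; exact Finset.mem_filter.2 ⟨hp.1, by rw [h, this]⟩
    have h1 := hfix n
    have h2 := hfix (-(n:ℤ))
    have h3 := (Finset.card_le_card hsub).trans (Finset.card_union_le _ _)
    have h3' : ((P.filter (fun p => (kf p).natAbs = n)).card : ℝ) ≤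
       (P.filter (fun p => kf p = (n:ℤ))).card + (P.filter (fun p => kf p = -(n:ℤ))).card := by
      exact_mod_cast h3
    rw [Int.gcd_def] at h1 h2
    simp only [Int.natAbs_natCast, Int.natAbs_neg] at h1 h2
    linarith
  refine hcount.trans ?_
  rw [← Finset.mul_sum]
  have hdn : d.natAbs ≠ 0 := by omega
  have hgs : (∑ n ∈ Finset.Ioc 0 N, (Nat.gcd n d.natAbs : ℝ)) ≤ (3 * r) * (C * (d:ℝ) ^ η) := by
    have h1 := gcd_sum_le N d.natAbs hdn
    have h2 : (∑ n ∈ Finset.Ioc 0 N, (Nat.gcd n d.natAbs : ℝ)) ≤ N * d.natAbs.divisors.card := by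
      exact_mod_cast h1
    refine h2.trans ?_
    have h3 := hdiv _ hdn
    have h4 : ((d.natAbs : ℕ) : ℝ) = d := by
      rw [Nat.cast_natAbs, abs_of_pos (by omega)]
    rw [h4] at h3
    have h5 : (N:ℝ) ≤ 3 * r := Nat.floor_le (by linarith)
    gcongr
  have hz : (d:ℝ) ^ ε = ((d:ℝ) ^ η) ^ 11 := by
    rw [← Real.rpow_natCast, ← Real.rpow_mul hd0.le, hη]
    congr 1; push_cast; ring
  calc 2 * A * ∑ n ∈ Finset.Ioc 0 N, (Nat.gcd n d.natAbs : ℝ) ≤ 2 * A * ((3 * r) * (C * (d:ℝ) ^ η)) := by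
        gcongr
    _ = 192 * C ^ 6 * (4 / η + 2) * (d:ℝ) ^ ε * X := by
        rw [hz, hA]
        have : r ≠ 0 := by linarith
        field_simp
        ring

/-- partial sums of a Dirichlet character -/
noncomputable def chS {N : ℕ} (χ : DirichletCharacter ℂ N) (K : ℕ) : ℂ :=
  ∑ n ∈ Finset.range K, χ ((n + 1 : ℕ) : ZMod N)

lemma chS_succ {N : ℕ} (χ : DirichletCharacter ℂ N) (K : ℕ) :
    chS χ (K + 1) = chS χ K + χ ((K + 1 : ℕ) : ZMod N) := by
  unfold chS; rw [Finset.sum_range_succ]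

lemma chS_norm_le_self {N : ℕ} (χ : DirichletCharacter ℂ N) (K : ℕ) : ‖chS χ K‖ ≤ K := by
  unfold chS
  refine (norm_sum_le _ _).trans ?_
  calc _ ≤ ∑ n ∈ Finset.range K, (1:ℝ) := Finset.sum_le_sum fun i _ => χ.norm_le_one _
    _ = K := by simp

lemma sum_range_char {N : ℕ} [NeZero N] (χ : DirichletCharacter ℂ N) (hχ : χ ≠ 1) :
    ∑ n ∈ Finset.range N, χ ((n : ℕ) : ZMod N) = 0 := by
  rw [← MulChar.sum_eq_zero_of_ne_one hχ]
  refine Finset.sum_bij (fun n _ => (n : ZMod N)) (fun _ _ => Finset.mem_univ _) ?_ ?_ (fun _ _ => rfl)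
  · intro a ha b hb h
    rw [ZMod.natCast_eq_natCast_iff] at h
    exact Nat.ModEq.eq_of_lt_of_lt h (Finset.mem_range.1 ha) (Finset.mem_range.1 hb)
  · intro x _
    exact ⟨x.val, Finset.mem_range.2 (ZMod.val_lt x), ZMod.natCast_zmod_val x⟩

lemma chS_period {N : ℕ} [NeZero N] (χ : DirichletCharacter ℂ N) (hχ : χ ≠ 1) : chS χ N = 0 := by
  unfold chS
  have h1 := Finset.sum_range_succ (fun n : ℕ => χ ((n : ℕ) : ZMod N)) N
  have h2 := Finset.sum_range_succ' (fun n : ℕ => χ ((n : ℕ) : ZMod N)) N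
  rw [h1, sum_range_char χ hχ] at h2
  simp only [ZMod.natCast_self, Nat.cast_zero, zero_add] at h2
  have := left_eq_add.1 (h2.trans (add_comm _ _))
  exact this

lemma chS_add {N : ℕ} [NeZero N] (χ : DirichletCharacter ℂ N) (hχ : χ ≠ 1) (K : ℕ) :
    chS χ (N + K) = chS χ K := by
  induction K with
  | zero => rw [add_zero, chS_period χ hχ]; simp [chS]
  | succ K ih =>
    rw [← add_assoc, chS_succ, chS_succ, ih]
    congr 2
    push_cast
    simp

lemma chS_norm_le {N : ℕ} [NeZero N] (χ : DirichletCharacter ℂ N) (hχ : χ ≠ 1) (K : ℕ) :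
    ‖chS χ K‖ ≤ N := by
  induction K using Nat.strong_induction_on with
  | _ K ih =>
    rcases le_total K N with h | h
    · exact (chS_norm_le_self χ K).trans (by exact_mod_cast h)
    · obtain ⟨j, rfl⟩ := Nat.exists_eq_add_of_le h
      rw [chS_add χ hχ]
      exact ih j (by have := Nat.pos_of_ne_zero (NeZero.ne N); omega)

lemma cpow_diff_le {s : ℂ} (hs : 0 < s.re) (n : ℕ) :
    ‖((n + 1 : ℕ) : ℂ) ^ (-s) - ((n + 2 : ℕ) : ℂ) ^ (-s)‖ ≤ ‖s‖ * ((n + 1 : ℕ) : ℝ) ^ (-s.re - 1) := by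
  have hs0 : -s ≠ 0 := by
    intro h
    have : s = 0 := neg_eq_zero.1 h
    rw [this] at hs; simp at hs
  have hpos : ∀ x ∈ Set.Icc ((n + 1 : ℕ) : ℝ) ((n + 2 : ℕ) : ℝ), 0 < x := by
    intro x hx
    exact lt_of_lt_of_le (by positivity) hx.1
  have h := Convex.norm_image_sub_le_of_norm_hasDerivWithin_le (𝕜 := ℝ)
    (f := fun y : ℝ => (y : ℂ) ^ (-s)) (f' := fun y : ℝ => -s * (y:ℂ) ^ (-s - 1))
    (s := Set.Icc ((n + 1 : ℕ) : ℝ) ((n + 2 : ℕ) : ℝ))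
    (C := ‖s‖ * ((n + 1 : ℕ) : ℝ) ^ (-s.re - 1))
    (x := ((n + 2 : ℕ) : ℝ)) (y := ((n + 1 : ℕ) : ℝ))
    (fun x hx => (hasDerivAt_ofReal_cpow_const (hpos x hx).ne' hs0).hasDerivWithinAt)
    (fun x hx => by
      rw [norm_mul, norm_neg, Complex.norm_cpow_eq_rpow_re_of_pos (hpos x hx)]
      gcongr
      simp only [Complex.sub_re, Complex.neg_re, Complex.one_re]
      exact Real.rpow_le_rpow_of_nonpos (by positivity) hx.1 (by linarith))
    (convex_Icc _ _) (Set.right_mem_Icc.2 (by push_cast; linarith))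
    (Set.left_mem_Icc.2 (by push_cast; linarith))
  have e : ‖((n + 1 : ℕ) : ℝ) - ((n + 2 : ℕ) : ℝ)‖ = 1 := by
    push_cast
    rw [show ((n:ℝ) + 1 - (n + 2)) = -1 by ring]; simp
  rw [e, mul_one] at h
  simpa using h

noncomputable def chE {N : ℕ} (χ : DirichletCharacter ℂ N) (s : ℂ) (n : ℕ) : ℂ :=
  chS χ (n + 1) * (((n + 1 : ℕ) : ℂ) ^ (-s) - ((n + 2 : ℕ) : ℂ) ^ (-s))

lemma chE_le {N : ℕ} [NeZero N] (χ : DirichletCharacter ℂ N) (hχ : χ ≠ 1) {s : ℂ} {σ R : ℝ}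
    (hσ : 0 < σ) (hs : σ ≤ s.re) (hR : ‖s‖ ≤ R) (n : ℕ) :
    ‖chE χ s n‖ ≤ N * R * ((n + 1 : ℕ) : ℝ) ^ (-(σ + 1)) := by
  unfold chE
  rw [norm_mul]
  calc _ ≤ (N:ℝ) * (‖s‖ * ((n + 1 : ℕ) : ℝ) ^ (-s.re - 1)) := by
        gcongr
        · exact chS_norm_le χ hχ _
        · exact cpow_diff_le (by linarith) n
    _ ≤ N * (R * ((n + 1 : ℕ) : ℝ) ^ (-(σ + 1))) := by
        gcongr
        · exact (norm_nonneg s).trans hR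
        · have : (0:ℝ) ≤ n := by positivity
          push_cast; linarith
        · linarith
    _ = _ := by ring

lemma summable_shift {σ : ℝ} (hσ : 0 < σ) : Summable fun n : ℕ => ((n + 1 : ℕ) : ℝ) ^ (-(σ + 1)) := by
  have h : Summable fun n : ℕ => ((n : ℕ) : ℝ) ^ (-(σ + 1)) :=
    Real.summable_nat_rpow.2 (by linarith)
  exact (summable_nat_add_iff (f := fun n : ℕ => ((n : ℕ) : ℝ) ^ (-(σ + 1))) 1).2 h

lemma chE_summable {N : ℕ} [NeZero N] (χ : DirichletCharacter ℂ N) (hχ : χ ≠ 1) {s : ℂ}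
    (hs : 0 < s.re) : Summable (chE χ s) :=
  Summable.of_norm_bounded ((summable_shift hs).mul_left (N * ‖s‖))
    (fun n => chE_le χ hχ hs le_rfl le_rfl n)

lemma chE_partial {N : ℕ} (χ : DirichletCharacter ℂ N) (s : ℂ) (K : ℕ) :
    ∑ n ∈ Finset.range K, χ ((n + 1 : ℕ) : ZMod N) * ((n + 1 : ℕ) : ℂ) ^ (-s) =
      ∑ n ∈ Finset.range K, chE χ s n + chS χ K * ((K + 1 : ℕ) : ℂ) ^ (-s) := by
  induction K with
  | zero => simp [chS]
  | succ K ih =>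
    rw [Finset.sum_range_succ, Finset.sum_range_succ, ih, chE, chS_succ]
    ring

lemma chS_mul_tendsto {N : ℕ} [NeZero N] (χ : DirichletCharacter ℂ N) (hχ : χ ≠ 1) {s : ℂ}
    (hs : 0 < s.re) :
    Filter.Tendsto (fun K : ℕ => chS χ K * ((K + 1 : ℕ) : ℂ) ^ (-s)) Filter.atTop (nhds 0) := by
  have h1 : Filter.Tendsto (fun K : ℕ => (N:ℝ) * ((K + 1 : ℕ) : ℝ) ^ (-s.re)) Filter.atTop (nhds 0) := by
    have := (tendsto_rpow_neg_atTop hs).comp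
      (tendsto_natCast_atTop_atTop.comp (Filter.tendsto_add_atTop_nat 1))
    simpa using this.const_mul (N:ℝ)
  refine squeeze_zero_norm ?_ h1
  intro K
  rw [norm_mul, Complex.norm_natCast_cpow_of_pos (by omega)]
  gcongr
  · exact chS_norm_le χ hχ K
  · simp
  · simp

lemma chE_tsum_of_one_lt {N : ℕ} [NeZero N] (χ : DirichletCharacter ℂ N) (hχ : χ ≠ 1) {s : ℂ}
    (hs : 1 < s.re) : DirichletCharacter.LFunction χ s = ∑' n, chE χ s n := by
  have hs0 : 0 < s.re := by linarith
  rw [DirichletCharacter.LFunction_eq_LSeries χ hs]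
  have hsum : LSeriesSummable (fun n => χ n) s := ZMod.LSeriesSummable_of_one_lt_re χ hs
  have h1 : Filter.Tendsto (fun K => ∑ n ∈ Finset.range K,
      χ ((n + 1 : ℕ) : ZMod N) * ((n + 1 : ℕ) : ℂ) ^ (-s)) Filter.atTop
      (nhds (LSeries (fun n => χ n) s)) := by
    have h2 := hsum.hasSum.tendsto_sum_nat.comp (Filter.tendsto_add_atTop_nat 1)
    refine h2.congr ?_
    intro K
    simp only [Function.comp]
    rw [Finset.sum_range_succ']
    simp only [LSeries.term_zero, add_zero]
    apply Finset.sum_congr rfl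
    intro n _
    rw [LSeries.term_of_ne_zero (by omega), Complex.cpow_neg, div_eq_mul_inv]
  have h3 : Filter.Tendsto (fun K => ∑ n ∈ Finset.range K, chE χ s n +
      chS χ K * ((K + 1 : ℕ) : ℂ) ^ (-s)) Filter.atTop (nhds (∑' n, chE χ s n + 0)) :=
    (chE_summable χ hχ hs0).hasSum.tendsto_sum_nat.add (chS_mul_tendsto χ hχ hs0)
  simp_rw [chE_partial] at h1
  rw [add_zero] at h3
  exact tendsto_nhds_unique h1 h3

lemma chE_tsum_diff {N : ℕ} [NeZero N] (χ : DirichletCharacter ℂ N) (hχ : χ ≠ 1) :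
    DifferentiableOn ℂ (fun s => ∑' n, chE χ s n) {s : ℂ | 0 < s.re} := by
  intro s hs
  have hs' : 0 < s.re := hs
  set U : Set ℂ := {z | s.re / 2 < z.re} ∩ Metric.ball 0 (‖s‖ + 1) with hU
  have hUo : IsOpen U := (isOpen_lt continuous_const Complex.continuous_re).inter Metric.isOpen_ball
  have hsU : s ∈ U := ⟨by simp only [Set.mem_ofPred_eq]; linarith, by simp⟩
  have hd : DifferentiableOn ℂ (fun z => ∑' n, chE χ z n) U := by
    refine Complex.differentiableOn_tsum_of_summable_norm
      (u := fun n => N * (‖s‖ + 1) * ((n + 1 : ℕ) : ℝ) ^ (-(s.re / 2 + 1)))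
      ((summable_shift (by linarith)).mul_left _) ?_ hUo ?_
    · intro n
      unfold chE
      apply DifferentiableOn.const_mul
      apply DifferentiableOn.sub
      · intro z _
        apply DifferentiableAt.differentiableWithinAt
        apply DifferentiableAt.const_cpow (by fun_prop)
        left; norm_cast
      · intro z _
        apply DifferentiableAt.differentiableWithinAt
        apply DifferentiableAt.const_cpow (by fun_prop)
        left; norm_cast
    · intro n z hz
      have h1 : s.re / 2 < z.re := hz.1
      have h2 : ‖z‖ < ‖s‖ + 1 := by simpa using hz.2
      exact chE_le χ hχ (by linarith) h1.le h2.le n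
  exact (hd.differentiableAt (hUo.mem_nhds hsU)).differentiableWithinAt

lemma LFunction_eq_tsum {N : ℕ} [NeZero N] (χ : DirichletCharacter ℂ N) (hχ : χ ≠ 1) {s : ℂ}
    (hs : 0 < s.re) : DirichletCharacter.LFunction χ s = ∑' n, chE χ s n := by
  have hopen : IsOpen {s : ℂ | 0 < s.re} := isOpen_lt continuous_const Complex.continuous_re
  have hpre : IsPreconnected {s : ℂ | 0 < s.re} := (convex_halfSpace_re_gt 0).isPreconnected
  have hf : AnalyticOnNhd ℂ (DirichletCharacter.LFunction χ) {s : ℂ | 0 < s.re} :=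
    (DirichletCharacter.differentiable_LFunction hχ).differentiableOn.analyticOnNhd hopen
  have hg := (chE_tsum_diff χ hχ).analyticOnNhd hopen
  have h2 : (2:ℂ) ∈ {s : ℂ | 0 < s.re} := by simp
  refine hf.eqOn_of_preconnected_of_eventuallyEq hg hpre h2 ?_ hs
  have : {s : ℂ | 1 < s.re} ∈ nhds (2:ℂ) :=
    (isOpen_lt continuous_const Complex.continuous_re).mem_nhds (by simp)
  filter_upwards [this] with z hz
  exact chE_tsum_of_one_lt χ hχ hz

/-- Polynomial bound. -/
lemma LFunction_poly_bound : ∃ Z : ℝ, 0 < Z ∧ ∀ (N : ℕ) [NeZero N] (χ : DirichletCharacter ℂ N),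
    χ ≠ 1 → ∀ s : ℂ, 1 / 2 ≤ s.re → ‖s‖ ≤ 4 → ‖DirichletCharacter.LFunction χ s‖ ≤ Z * N := by
  have hsum := summable_shift (σ := 1 / 2) (by norm_num)
  refine ⟨4 * ∑' n : ℕ, ((n + 1 : ℕ) : ℝ) ^ (-((1 / 2 : ℝ) + 1)), ?_, ?_⟩
  · apply mul_pos (by norm_num)
    exact hsum.tsum_pos (fun n => by positivity) 0 (by positivity)
  · intro N _ χ hχ s hs hs4
    rw [LFunction_eq_tsum χ hχ (by linarith)]
    refine (tsum_of_norm_bounded ((hsum.mul_left ((N:ℝ) * 4)).hasSum)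
      (fun n => chE_le χ hχ (by norm_num) hs hs4 n)).trans (le_of_eq ?_)
    rw [tsum_mul_left]; ring

/-- Upper bound at 1. -/
lemma LFunction_one_upper (ε : ℝ) (hε : 0 < ε) (hε1 : ε < 1) : ∃ C : ℝ, 1 ≤ C ∧
    ∀ (N : ℕ) [NeZero N] (χ : DirichletCharacter ℂ N),
    χ ≠ 1 → ‖DirichletCharacter.LFunction χ 1‖ ≤ C * (N:ℝ) ^ ε := by
  have hsum := summable_shift hε
  refine ⟨max 1 (∑' n : ℕ, ((n + 1 : ℕ) : ℝ) ^ (-(ε + 1))), le_max_left _ _, ?_⟩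
  intro N _ χ hχ
  have hN : (0:ℝ) < N := by exact_mod_cast Nat.pos_of_ne_zero (NeZero.ne N)
  rw [LFunction_eq_tsum χ hχ (by simp)]
  have hb : ∀ n, ‖chE χ 1 n‖ ≤ (N:ℝ) ^ ε * ((n + 1 : ℕ) : ℝ) ^ (-(ε + 1)) := by
    intro n
    unfold chE
    rw [norm_mul]
    have h1 := cpow_diff_le (s := 1) (by simp) n
    have hn : (0:ℝ) < ((n + 1 : ℕ) : ℝ) := by positivity
    simp only [norm_one, one_mul, Complex.one_re] at h1
    have h2 : ‖chS χ (n + 1)‖ ≤ (N:ℝ) ^ ε * ((n + 1 : ℕ) : ℝ) ^ (1 - ε) := by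
      have a := chS_norm_le χ hχ (n + 1)
      have b := chS_norm_le_self χ (n + 1)
      calc ‖chS χ (n + 1)‖ = ‖chS χ (n + 1)‖ ^ ε * ‖chS χ (n + 1)‖ ^ (1 - ε) := by
            rw [← Real.rpow_add' (norm_nonneg _) (by norm_num)]; simp
        _ ≤ _ := by
            gcongr
    calc _ ≤ ((N:ℝ) ^ ε * ((n + 1 : ℕ) : ℝ) ^ (1 - ε)) * ((n + 1 : ℕ) : ℝ) ^ (-1 - 1 : ℝ) := by
          gcongr
      _ = _ := by
          rw [mul_assoc, ← Real.rpow_add hn]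
          congr 2; ring
  refine (tsum_of_norm_bounded ((hsum.mul_left _).hasSum) hb).trans ?_
  rw [tsum_mul_left, mul_comm]
  gcongr
  exact le_max_right _ _

/-- Reality. -/
lemma LFunction_real {N : ℕ} [NeZero N] (χ : DirichletCharacter ℂ N) (hχ : χ ≠ 1) (h2 : χ ^ 2 = 1)
    {x : ℝ} (hx : 0 < x) : ∃ r : ℝ, DirichletCharacter.LFunction χ x = r := by
  rw [LFunction_eq_tsum χ hχ (by simpa using hx)]
  have hr : ∀ z : ZMod N, ∃ r : ℝ, χ z = r := by
    intro z
    rcases MulChar.isQuadratic_iff_sq_eq_one.mpr h2 z with h | h | h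
    · exact ⟨0, by rw [h]; simp⟩
    · exact ⟨1, by rw [h]; simp⟩
    · exact ⟨-1, by rw [h]; simp⟩
  choose c hc using hr
  refine ⟨∑' n : ℕ, (∑ m ∈ Finset.range (n + 1), c ((m + 1 : ℕ) : ZMod N)) *
    (((n + 1 : ℕ) : ℝ) ^ (-x) - ((n + 2 : ℕ) : ℝ) ^ (-x)), ?_⟩
  rw [Complex.ofReal_tsum]
  congr 1
  ext n
  unfold chE chS
  rw [Complex.ofReal_mul, Complex.ofReal_sum, Complex.ofReal_sub,
    Complex.ofReal_cpow (by positivity), Complex.ofReal_cpow (by positivity)]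
  simp only [hc]
  push_cast
  rfl

/-- Truncation at 1. -/
lemma LFunction_one_trunc {N : ℕ} [NeZero N] (χ : DirichletCharacter ℂ N) (hχ : χ ≠ 1) (Y : ℕ)
    (hY : 0 < Y) :
    ‖DirichletCharacter.LFunction χ 1 -
      ∑ n ∈ Finset.range Y, χ ((n + 1 : ℕ) : ZMod N) / ((n + 1 : ℕ) : ℂ)‖ ≤ 2 * N / Y := by
  have h1 : (0:ℝ) < (1:ℂ).re := by simp
  have hp := chE_partial χ 1 Y
  have hsum := chE_summable χ hχ h1
  have hs := hsum.sum_add_tsum_nat_add Y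
  rw [LFunction_eq_tsum χ hχ h1, ← hs]
  have e1 : ∑ n ∈ Finset.range Y, χ ((n + 1 : ℕ) : ZMod N) / ((n + 1 : ℕ) : ℂ) =
      ∑ n ∈ Finset.range Y, χ ((n + 1 : ℕ) : ZMod N) * ((n + 1 : ℕ) : ℂ) ^ (-1 : ℂ) := by
    apply Finset.sum_congr rfl
    intro n _
    rw [Complex.cpow_neg_one, div_eq_mul_inv]
  rw [e1, hp]
  have hYR : (0:ℝ) < Y := by exact_mod_cast hY
  have htail : ‖∑' n, chE χ 1 (n + Y)‖ ≤ N / Y := by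
    have hb : ∀ n, ‖chE χ 1 (n + Y)‖ ≤ N * (1 / ((n + Y : ℕ) : ℝ) - 1 / ((n + 1 + Y : ℕ) : ℝ)) := by
      intro n
      unfold chE
      rw [norm_mul]
      have hp1 : (0:ℝ) < ((n + Y : ℕ) : ℝ) := by positivity
      gcongr
      · exact chS_norm_le χ hχ _
      · rw [Complex.cpow_neg_one, Complex.cpow_neg_one]
        have : (((n + Y + 1 : ℕ) : ℂ)⁻¹ - ((n + Y + 2 : ℕ) : ℂ)⁻¹) =
            (((((n + Y + 1 : ℕ) : ℝ)⁻¹ - ((n + Y + 2 : ℕ) : ℝ)⁻¹) : ℝ) : ℂ) := by push_cast; rfl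
        rw [this, Complex.norm_real, Real.norm_eq_abs, abs_le]
        push_cast at hp1 ⊢
        constructor
        · have q1 : ((n:ℝ) + Y + 2)⁻¹ ≤ ((n:ℝ) + Y + 1)⁻¹ := by
            apply inv_anti₀ <;> linarith
          have q2 : 1 / ((n:ℝ) + 1 + Y) ≤ 1 / ((n:ℝ) + Y) := by
            apply one_div_le_one_div_of_le <;> linarith
          linarith
        · rw [← sub_nonneg]
          have q : 1 / ((n:ℝ) + Y) - 1 / ((n:ℝ) + 1 + Y) - (((n:ℝ) + Y + 1)⁻¹ - ((n:ℝ) + Y + 2)⁻¹) =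
            2 / (((n:ℝ) + Y) * ((n:ℝ) + Y + 1) * ((n:ℝ) + Y + 2)) := by
              have z1 : (n:ℝ) + Y ≠ 0 := by positivity
              have z2 : (n:ℝ) + Y + 1 ≠ 0 := by positivity
              have z3 : (n:ℝ) + Y + 2 ≠ 0 := by positivity
              have z4 : (n:ℝ) + 1 + Y = n + Y + 1 := by ring
              rw [z4]
              field_simp
              ring
          rw [q]
          positivity
    have htel : HasSum (fun n : ℕ => (N:ℝ) * (1 / ((n + Y : ℕ) : ℝ) - 1 / ((n + 1 + Y : ℕ) : ℝ)))
        (N * (1 / (Y:ℝ))) := by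
      apply HasSum.mul_left
      have hmono : ∀ n : ℕ, 0 ≤ 1 / ((n + Y : ℕ) : ℝ) - 1 / ((n + 1 + Y : ℕ) : ℝ) := by
        intro n
        have : (1:ℝ) / ((n + 1 + Y : ℕ) : ℝ) ≤ 1 / ((n + Y : ℕ) : ℝ) := by
          apply one_div_le_one_div_of_le (by positivity)
          push_cast; linarith
        linarith
      rw [hasSum_iff_tendsto_nat_of_nonneg hmono]
      have : ∀ K : ℕ, ∑ n ∈ Finset.range K, (1 / ((n + Y : ℕ) : ℝ) - 1 / ((n + 1 + Y : ℕ) : ℝ)) =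
          1 / (Y:ℝ) - 1 / ((K + Y : ℕ) : ℝ) := by
        intro K
        rw [Finset.sum_range_sub' (fun n : ℕ => 1 / ((n + Y : ℕ) : ℝ))]
        simp
      simp_rw [this]
      have h0 : Filter.Tendsto (fun K : ℕ => 1 / ((K + Y : ℕ) : ℝ)) Filter.atTop (nhds 0) :=
        tendsto_one_div_atTop_nhds_zero_nat.comp (Filter.tendsto_add_atTop_nat Y)
      simpa using (tendsto_const_nhds (x := 1 / (Y:ℝ))).sub h0
    refine (tsum_of_norm_bounded htel hb).trans (le_of_eq (by ring))
  have hbd : ‖chS χ Y * ((Y + 1 : ℕ) : ℂ) ^ (-1 : ℂ)‖ ≤ N / Y := by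
    rw [norm_mul, Complex.cpow_neg_one, norm_inv, Complex.norm_natCast, ← div_eq_mul_inv]
    gcongr
    · exact chS_norm_le χ hχ _
    · simp
  calc _ = ‖∑' n, chE χ 1 (n + Y) - chS χ Y * ((Y + 1 : ℕ) : ℂ) ^ (-1 : ℂ)‖ := by
        congr 1; ring
    _ ≤ N / Y + N / Y := (norm_sub_le _ _).trans (add_le_add htail hbd)
    _ = _ := by ring

section SiegelCoef
open scoped ComplexOrder

/-- character as arithmetic function -/
noncomputable def chA {N : ℕ} (χ : DirichletCharacter ℂ N) : ArithmeticFunction ℂ :=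
  toArithmeticFunction (χ ·)

lemma chA_apply {N : ℕ} (χ : DirichletCharacter ℂ N) {n : ℕ} (hn : n ≠ 0) : chA χ n = χ n := by
  simp [chA, toArithmeticFunction, hn]

/-- coefficients of ζ(s)L(s,χ)L(s,ψ)L(s,χψ). -/
noncomputable def siegelB {N : ℕ} (χ ψ : DirichletCharacter ℂ N) : ArithmeticFunction ℂ :=
  ((ArithmeticFunction.zeta : ArithmeticFunction ℂ) * chA χ) * (chA ψ * chA (χ * ψ))

lemma chA_mul_chA {N : ℕ} (χ ψ : DirichletCharacter ℂ N) :
    chA ψ * chA (χ * ψ) =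
      (chA ψ).pmul ((ArithmeticFunction.zeta : ArithmeticFunction ℂ) * chA χ) := by
  ext n
  rw [ArithmeticFunction.pmul_apply, ArithmeticFunction.mul_apply, ArithmeticFunction.mul_apply,
    Finset.mul_sum]
  apply Finset.sum_congr rfl
  intro p hp
  have hp' := Nat.mem_divisorsAntidiagonal.1 hp
  have h1 : p.1 ≠ 0 := by rintro h; rw [h, zero_mul] at hp'; exact hp'.2 hp'.1.symm
  have h2 : p.2 ≠ 0 := by rintro h; rw [h, mul_zero] at hp'; exact hp'.2 hp'.1.symm
  rw [chA_apply _ h1, chA_apply _ h2, chA_apply _ h2, chA_apply _ hp'.2, ← hp'.1]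
  simp [h1]
  ring

lemma siegelB_eq {N : ℕ} (χ ψ : DirichletCharacter ℂ N) :
    siegelB χ ψ = ((ArithmeticFunction.zeta : ArithmeticFunction ℂ) * chA χ) *
      (chA ψ).pmul ((ArithmeticFunction.zeta : ArithmeticFunction ℂ) * chA χ) := by
  rw [siegelB, chA_mul_chA]

lemma siegelB_symm {N : ℕ} (χ ψ : DirichletCharacter ℂ N) : siegelB χ ψ = siegelB ψ χ := by
  unfold siegelB
  rw [mul_comm ψ χ]; ring

lemma siegelB_prime_pow {N : ℕ} (χ ψ : DirichletCharacter ℂ N) {p : ℕ} (hp : p.Prime) (k : ℕ) :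
    siegelB χ ψ (p ^ k) = ∑ x ∈ Finset.HasAntidiagonal.antidiagonal k,
      χ.zetaMul (p ^ x.1) * (ψ p ^ x.2 * χ.zetaMul (p ^ x.2)) := by
  rw [siegelB_eq, ArithmeticFunction.mul_apply, Nat.sum_divisorsAntidiagonal
    (f := fun a b => ((ArithmeticFunction.zeta : ArithmeticFunction ℂ) * chA χ) a *
      ((chA ψ).pmul ((ArithmeticFunction.zeta : ArithmeticFunction ℂ) * chA χ)) b),
    Nat.sum_divisors_prime_pow hp, Finset.Nat.sum_antidiagonal_eq_sum_range_succ_mk]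
  apply Finset.sum_congr rfl
  intro i hi
  have hi' : i ≤ k := Nat.lt_succ_iff.1 (Finset.mem_range.1 hi)
  rw [Nat.pow_div hi' hp.pos, ArithmeticFunction.pmul_apply,
    chA_apply _ (pow_ne_zero _ hp.ne_zero), Nat.cast_pow, map_pow ψ]
  rfl

lemma siegelB_prime_pow_nonneg {N : ℕ} (χ ψ : DirichletCharacter ℂ N) (hχ : χ ^ 2 = 1)
    (hψ : ψ ^ 2 = 1) {p : ℕ} (hp : p.Prime) (k : ℕ) : 0 ≤ siegelB χ ψ (p ^ k) := by
  have key : ∀ χ ψ : DirichletCharacter ℂ N, χ ^ 2 = 1 → (0 ≤ ψ p) →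
      0 ≤ siegelB χ ψ (p ^ k) := by
    intro χ ψ hχ h
    rw [siegelB_prime_pow _ _ hp]
    refine Finset.sum_nonneg fun i _ => ?_
    exact mul_nonneg (DirichletCharacter.zetaMul_nonneg hχ _)
      (mul_nonneg (pow_nonneg h _) (DirichletCharacter.zetaMul_nonneg hχ _))
  rcases MulChar.isQuadratic_iff_sq_eq_one.mpr hψ p with h | h | h
  · exact key χ ψ hχ (by rw [h])
  · exact key χ ψ hχ (by rw [h]; exact zero_le_one)
  · rcases MulChar.isQuadratic_iff_sq_eq_one.mpr hχ p with h' | h' | h'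
    · rw [siegelB_symm]; exact key ψ χ hψ (by rw [h'])
    · rw [siegelB_symm]; exact key ψ χ hψ (by rw [h']; exact zero_le_one)
    · rw [siegelB_prime_pow _ _ hp]
      refine Finset.sum_nonneg fun i _ => ?_
      apply mul_nonneg (DirichletCharacter.zetaMul_nonneg hχ _)
      rcases Nat.even_or_odd i.2 with he | ho
      · rw [h, he.neg_one_pow, one_mul]
        exact DirichletCharacter.zetaMul_nonneg hχ _
      · have : χ.zetaMul (p ^ i.2) = 0 := by
          unfold DirichletCharacter.zetaMul
          rw [ArithmeticFunction.coe_zeta_mul_apply, Nat.sum_divisors_prime_pow hp]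
          have : ∀ j, (toArithmeticFunction (χ ·)) (p ^ j) = (-1 : ℂ) ^ j := by
            intro j
            have := chA_apply χ (pow_ne_zero j hp.ne_zero)
            rw [Nat.cast_pow, map_pow χ, h'] at this
            exact this
          simp only [this]
          rw [neg_one_geom_sum, if_pos]
          exact ho.add_one
        rw [this]; simp

lemma siegelB_mult {N : ℕ} (χ ψ : DirichletCharacter ℂ N) : (siegelB χ ψ).IsMultiplicative := by
  unfold siegelB
  exact (χ.isMultiplicative_zetaMul).mul
    ((DirichletCharacter.isMultiplicative_toArithmeticFunction ψ).mul
      (DirichletCharacter.isMultiplicative_toArithmeticFunction (χ * ψ)))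

lemma siegelB_nonneg {N : ℕ} (χ ψ : DirichletCharacter ℂ N) (hχ : χ ^ 2 = 1)
    (hψ : ψ ^ 2 = 1) (n : ℕ) : 0 ≤ siegelB χ ψ n := by
  rcases eq_or_ne n 0 with rfl | hn
  · simp
  · rw [(siegelB_mult χ ψ).multiplicative_factorization _ hn]
    exact Finset.prod_nonneg
        fun p hp ↦ siegelB_prime_pow_nonneg χ ψ hχ hψ (Nat.prime_of_mem_primeFactors hp) _

lemma chA_LSeriesHasSum {N : ℕ} [NeZero N] (χ : DirichletCharacter ℂ N) {s : ℂ} (hs : 1 < s.re) :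
    LSeriesHasSum (chA χ) s (χ.LFunction s) := by
  rw [χ.LFunction_eq_LSeries hs]
  have h : ∀ {n : ℕ}, n ≠ 0 → χ n = chA χ n := fun h => (chA_apply χ h).symm
  rw [LSeries_congr h]
  apply LSeriesSummable.LSeriesHasSum
  exact (LSeriesSummable_congr _ h).1 (ZMod.LSeriesSummable_of_one_lt_re χ hs)

lemma siegelB_LSeriesHasSum {N : ℕ} [NeZero N] (χ ψ : DirichletCharacter ℂ N) {s : ℂ}
    (hs : 1 < s.re) : LSeriesHasSum (siegelB χ ψ) s
      (riemannZeta s * χ.LFunction s * (ψ.LFunction s * (χ * ψ).LFunction s)) := by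
  unfold siegelB
  apply ArithmeticFunction.LSeriesHasSum_mul
  · apply ArithmeticFunction.LSeriesHasSum_mul _ (chA_LSeriesHasSum χ hs)
    exact_mod_cast ArithmeticFunction.LSeriesHasSum_zeta hs
  · exact ArithmeticFunction.LSeriesHasSum_mul (chA_LSeriesHasSum _ hs) (chA_LSeriesHasSum _ hs)

lemma siegelB_abscissa {N : ℕ} [NeZero N] (χ ψ : DirichletCharacter ℂ N) :
    LSeries.abscissaOfAbsConv (siegelB χ ψ) ≤ 1 := by
  apply LSeries.abscissaOfAbsConv_le_of_forall_lt_LSeriesSummable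
  intro y hy
  exact (siegelB_LSeriesHasSum χ ψ (by simpa using hy)).LSeriesSummable

lemma siegelB_one_le {N : ℕ} [NeZero N] (χ ψ : DirichletCharacter ℂ N) (hχ : χ ^ 2 = 1)
    (hψ : ψ ^ 2 = 1) : 1 ≤ LSeries (siegelB χ ψ) 2 := by
  have hs := (siegelB_LSeriesHasSum χ ψ (s := ((2:ℝ):ℂ)) (by simp)).LSeriesSummable
  have := hs.sum_le_tsum {1} (fun n _ => LSeries.term_nonneg (siegelB_nonneg χ ψ hχ hψ n) 2)
  rw [Finset.sum_singleton, LSeries.term_of_ne_zero one_ne_zero, (siegelB_mult χ ψ).1] at this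
  simpa [LSeries] using this

end SiegelCoef

section Estermann
open scoped ComplexOrder

/-- The entire function (s-1)ζ(s). -/
noncomputable def zH : ℂ → ℂ := Function.update (fun s ↦ (s - 1) * riemannZeta s) 1 1

lemma zH_one : zH 1 = 1 := by simp [zH]

lemma zH_of_ne {s : ℂ} (hs : s ≠ 1) : zH s = (s - 1) * riemannZeta s := by
  simp [zH, Function.update_of_ne hs]

lemma zH_diff : Differentiable ℂ zH := by
  rw [← differentiableOn_univ,
    ← Complex.differentiableOn_compl_singleton_and_continuousAt_iff (c := 1) Filter.univ_mem]
  refine ⟨DifferentiableOn.congr (f := fun s ↦ (s - 1) * riemannZeta s)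
    (fun s hs ↦ DifferentiableAt.differentiableWithinAt
      ((differentiableAt_id.sub_const _).mul (differentiableAt_riemannZeta (by simpa using hs))))
    fun _ hs ↦ Function.update_of_ne (Set.mem_sdiff_singleton.mp hs).2 ..,
    continuousWithinAt_compl_self.mp ?_⟩
  have := riemannZeta_residue_one
  unfold ContinuousWithinAt
  rw [zH_one]
  refine this.congr' ?_
  filter_upwards [self_mem_nhdsWithin] with s hs
  rw [zH_of_ne hs]

lemma real_estermann (β : ℕ → ℝ) (l B x G : ℝ) (hβ : ∀ m, 0 ≤ β m) (hβ0 : 1 ≤ β 0)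
    (hb : ∀ m, |β m - l| ≤ B * (2 / 3) ^ m) (hx : 1 < x) (hx2 : x ≤ 5 / 4)
    (hG : HasSum (fun m => (β m - l) * x ^ m) G) (hGl : G ≤ l / (x - 1)) (K : ℕ) (hK : 1 ≤ K)
    (hB : 12 * B * (5 / 6) ^ K ≤ 1) : (x - 1) / 2 ≤ l * x ^ K := by
  have hB0 : 0 ≤ B := by
    have := hb 0
    simp only [pow_zero, mul_one] at this
    exact (abs_nonneg _).trans this
  have hs := hG.summable
  have h1 := hs.sum_add_tsum_nat_add K
  rw [hG.tsum_eq] at h1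
  have hhead : 1 - l * ((x ^ K - 1) / (x - 1)) ≤ ∑ m ∈ Finset.range K, (β m - l) * x ^ m := by
    rw [← geom_sum_eq hx.ne', Finset.mul_sum]
    simp only [sub_mul, Finset.sum_sub_distrib]
    have : β 0 * x ^ 0 ≤ ∑ m ∈ Finset.range K, β m * x ^ m :=
      Finset.single_le_sum (f := fun m => β m * x ^ m)
        (fun i _ => mul_nonneg (hβ i) (by positivity)) (Finset.mem_range.2 hK)
    simp only [pow_zero, mul_one] at this
    linarith
  have htail : |∑' m, (β (m + K) - l) * x ^ (m + K)| ≤ B * (5 / 6) ^ K * 6 := by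
    have hg : HasSum (fun m : ℕ => B * (5 / 6 : ℝ) ^ K * (5 / 6) ^ m) (B * (5 / 6) ^ K * 6) := by
      have := (hasSum_geometric_of_lt_one (r := (5 / 6 : ℝ)) (by norm_num) (by norm_num)).mul_left
        (B * (5 / 6 : ℝ) ^ K)
      have e : (1 - 5 / 6 : ℝ)⁻¹ = 6 := by norm_num
      rw [e] at this
      exact this
    refine tsum_of_norm_bounded (f := fun m => (β (m + K) - l) * x ^ (m + K)) hg ?_
    intro m
    rw [Real.norm_eq_abs, abs_mul, abs_of_pos (by positivity : 0 < x ^ (m + K))]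
    calc _ ≤ B * (2 / 3) ^ (m + K) * (5 / 4) ^ (m + K) := by
          gcongr
          exact hb _
      _ = _ := by
          rw [mul_assoc, ← mul_pow, mul_assoc, ← pow_add, add_comm K m]; norm_num
  have ht := (abs_le.1 htail).1
  have h2 : 1 - l * ((x ^ K - 1) / (x - 1)) - 1 / 2 ≤ l / (x - 1) := by
    have : (∑' m, (β (m + K) - l) * x ^ (m + K)) ≥ -(1/2) := by
      have : B * (5 / 6) ^ K * 6 ≤ 1 / 2 := by linarith
      linarith
    linarith
  have hx1 : 0 < x - 1 := by linarith
  have h3 : l * ((x ^ K - 1) / (x - 1)) + l / (x - 1) = l * x ^ K / (x - 1) := by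
    field_simp; ring
  have h4 : 1 / 2 ≤ l * x ^ K / (x - 1) := by linarith
  rw [le_div_iff₀ hx1] at h4
  linarith

/-- (s-1) ζ L L L -/
noncomputable def sP {M : ℕ} [NeZero M] (χ ψ : DirichletCharacter ℂ M) (s : ℂ) : ℂ :=
  zH s * χ.LFunction s * (ψ.LFunction s * (χ * ψ).LFunction s)

lemma sP_diff {M : ℕ} [NeZero M] (χ ψ : DirichletCharacter ℂ M) (hχ : χ ≠ 1) (hψ : ψ ≠ 1)
    (hχψ : χ * ψ ≠ 1) : Differentiable ℂ (sP χ ψ) := by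
  unfold sP
  exact (zH_diff.mul (DirichletCharacter.differentiable_LFunction hχ)).mul
    ((DirichletCharacter.differentiable_LFunction hψ).mul
      (DirichletCharacter.differentiable_LFunction hχψ))

lemma sP_bound : ∃ B : ℝ, 1 ≤ B ∧ ∀ (M : ℕ) [NeZero M] (χ ψ : DirichletCharacter ℂ M),
    χ ≠ 1 → ψ ≠ 1 → χ * ψ ≠ 1 → ∀ s : ℂ, 1 / 2 ≤ s.re → ‖s‖ ≤ 4 → ‖sP χ ψ s‖ ≤ B * (M:ℝ) ^ 3 := by
  obtain ⟨Z, hZ, hL⟩ := LFunction_poly_bound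
  obtain ⟨D, hD⟩ := (isCompact_closedBall (0:ℂ) 4).exists_bound_of_continuousOn
    zH_diff.continuous.continuousOn
  refine ⟨max 1 (D * Z ^ 3), le_max_left _ _, ?_⟩
  intro M _ χ ψ h1 h2 h3 s hs hs4
  have hDs := hD s (by simpa using hs4)
  have hD0 : 0 ≤ D := (norm_nonneg _).trans hDs
  unfold sP
  rw [norm_mul, norm_mul, norm_mul]
  calc _ ≤ D * (Z * M) * ((Z * M) * (Z * M)) := by
        gcongr
        · exact hL M χ h1 s hs hs4
        · exact hL M ψ h2 s hs hs4
        · exact hL M _ h3 s hs hs4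
    _ = D * Z ^ 3 * (M:ℝ) ^ 3 := by ring
    _ ≤ _ := by
        gcongr
        exact le_max_right _ _

lemma iteratedDeriv_inv_sub_one (m : ℕ) :
    iteratedDeriv m (fun s : ℂ => (s - 1)⁻¹) 2 = (-1) ^ m * (m.factorial : ℂ) := by
  have := congrFun (iter_deriv_inv_linear_sub (𝕜 := ℂ) m 1 1) 2
  rw [← iteratedDeriv_eq_iterate] at this
  simp only [one_mul] at this
  rw [this]
  norm_num

theorem estermann : ∃ B : ℝ, 1 ≤ B ∧ ∀ (M : ℕ) [NeZero M] (χ ψ : DirichletCharacter ℂ M),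
    χ ^ 2 = 1 → ψ ^ 2 = 1 → χ ≠ 1 → ψ ≠ 1 → χ * ψ ≠ 1 → ∀ s0 : ℝ, 3 / 4 ≤ s0 → s0 < 1 →
    0 ≤ (sP χ ψ s0).re → ∀ K : ℕ, 1 ≤ K → 12 * (B * (M:ℝ) ^ 3) * (5 / 6) ^ K ≤ 1 →
    (1 - s0) / 2 ≤ ‖χ.LFunction 1‖ * ‖ψ.LFunction 1‖ * ‖(χ * ψ).LFunction 1‖ * (2 - s0) ^ K := by
  obtain ⟨B, hB1, hB⟩ := sP_bound
  refine ⟨4 * B, by linarith, ?_⟩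
  intro M _ χ ψ hχ2 hψ2 hχ hψ hχψ s0 hs0 hs1 hpos K hK hKB
  have hχψ2 : (χ * ψ) ^ 2 = 1 := by rw [mul_pow, hχ2, hψ2, one_mul]
  have hPd := sP_diff χ ψ hχ hψ hχψ
  have hBM := hB M χ ψ hχ hψ hχψ
  -- lambda real
  obtain ⟨r1, hr1⟩ := LFunction_real χ hχ hχ2 (x := 1) one_pos
  obtain ⟨r2, hr2⟩ := LFunction_real ψ hψ hψ2 (x := 1) one_pos
  obtain ⟨r3, hr3⟩ := LFunction_real (χ * ψ) hχψ hχψ2 (x := 1) one_pos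
  rw [Complex.ofReal_one] at hr1 hr2 hr3
  have hl : sP χ ψ 1 = ((r1 * r2 * r3 : ℝ) : ℂ) := by
    unfold sP; rw [zH_one, hr1, hr2, hr3]; push_cast; ring
  set l : ℝ := r1 * r2 * r3 with hldef
  have hlle : l ≤ ‖χ.LFunction 1‖ * ‖ψ.LFunction 1‖ * ‖(χ * ψ).LFunction 1‖ := by
    rw [hr1, hr2, hr3, Complex.norm_real, Complex.norm_real, Complex.norm_real,
      ← norm_mul, ← norm_mul]
    exact Real.le_norm_self _
  set g : ℂ → ℂ := dslope (sP χ ψ) 1 with hg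
  have hgd : Differentiable ℂ g := by
    rw [← differentiableOn_univ, hg, Complex.differentiableOn_dslope Filter.univ_mem]
    exact hPd.differentiableOn
  have hgne : ∀ s : ℂ, s ≠ 1 → g s = (sP χ ψ s - l) * (s - 1)⁻¹ := by
    intro s hs
    rw [hg, dslope_of_ne _ hs, slope_def_field, hl, div_eq_mul_inv]
  have hgL : ∀ s : ℂ, 1 < s.re → g s = LSeries (siegelB χ ψ) s - l * (s - 1)⁻¹ := by
    intro s hs
    have hs1 : s ≠ 1 := by rintro rfl; simp at hs
    have hs2 : s - 1 ≠ 0 := sub_ne_zero.2 hs1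
    rw [hgne s hs1, (siegelB_LSeriesHasSum χ ψ hs).LSeries_eq, sP, zH_of_ne hs1]
    field_simp
  have habs : LSeries.abscissaOfAbsConv (siegelB χ ψ) < ((2:ℝ) : EReal) :=
    lt_of_le_of_lt (siegelB_abscissa χ ψ) (by exact_mod_cast (by norm_num : (1:ℝ) < 2))
  have hder : ∀ m, iteratedDeriv m g 2 =
      iteratedDeriv m (LSeries (siegelB χ ψ)) 2 - l * ((-1) ^ m * (m.factorial : ℂ)) := by
    intro m
    have hnh : {s : ℂ | 1 < s.re} ∈ nhds (2:ℂ) :=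
      (isOpen_lt continuous_const Complex.continuous_re).mem_nhds (by simp)
    have he : g =ᶠ[nhds 2] fun s => LSeries (siegelB χ ψ) s - l * (s - 1)⁻¹ := by
      filter_upwards [hnh] with s hs using hgL s hs
    have hc2 : ContDiffAt ℂ m (fun s : ℂ => (s - 1)⁻¹) 2 := by
      apply ContDiffAt.inv
      · fun_prop
      · norm_num
    have hc1 : ContDiffAt ℂ m (LSeries (siegelB χ ψ)) 2 := by
      apply AnalyticAt.contDiffAt
      apply LSeries_analyticOnNhd
      simpa using! habs
    rw [he.iteratedDeriv_eq]
    have := iteratedDeriv_sub (n := m) hc1 ((contDiffAt_const (c := (l:ℂ))).mul hc2)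
    refine Eq.trans ?_ (this.trans ?_)
    · rfl
    · congr 1
      have h := iteratedDeriv_const_mul (n := m) (l:ℂ) hc2
      rw [iteratedDeriv_inv_sub_one] at h
      exact h
  -- Cauchy
  have hcauchy : ∀ m, ‖iteratedDeriv m g 2‖ ≤ m.factorial * (4 * B * (M:ℝ) ^ 3) / (3 / 2 : ℝ) ^ m := by
    intro m
    apply Complex.norm_iteratedDeriv_le_of_forall_mem_sphere_norm_le m (by norm_num)
      hgd.diffContOnCl
    intro z hz
    have hz1 : ‖z - 2‖ = 3 / 2 := by simpa [dist_eq_norm] using hz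
    have hz2 : 1 / 2 ≤ ‖z - 1‖ := by
      have h := norm_sub_norm_le (z - 2) (-1)
      rw [hz1, norm_neg, norm_one, show z - 2 - -1 = z - 1 by ring] at h
      linarith
    have hz3 : ‖z‖ ≤ 4 := by
      have := norm_add_le (z - 2) 2
      rw [hz1] at this
      simp only [sub_add_cancel, Complex.norm_ofNat] at this
      linarith
    have hz4 : 1 / 2 ≤ z.re := by
      have := Complex.abs_re_le_norm (z - 2)
      rw [hz1] at this
      have := (abs_le.1 this).1
      simp at this
      linarith
    have hzn : z ≠ 1 := by
      rintro rfl; norm_num at hz2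
    rw [hgne z hzn, norm_mul, norm_inv]
    have e1 : ‖sP χ ψ z - l‖ ≤ 2 * B * (M:ℝ) ^ 3 := by
      have a1 := hBM z hz4 hz3
      have a2 := hBM 1 (by norm_num) (by norm_num)
      rw [hl] at a2
      calc _ ≤ ‖sP χ ψ z‖ + ‖(l:ℂ)‖ := norm_sub_le _ _
        _ ≤ _ := by linarith
    have e2 : ‖z - 1‖⁻¹ ≤ 2 := by
      rw [inv_le_comm₀ (by linarith) (by norm_num)]; linarith
    calc _ ≤ 2 * B * (M:ℝ) ^ 3 * 2 := by gcongr
      _ = _ := by ring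
  -- Taylor
  have htay := Complex.hasSum_taylorSeries_of_entire hgd 2 (s0 : ℂ)
  set β : ℕ → ℝ := fun m => ((-1 : ℂ) ^ m * iteratedDeriv m (LSeries (siegelB χ ψ)) 2).re /
    m.factorial with hβ
  have hnn : ∀ m, 0 ≤ (-1 : ℂ) ^ m * iteratedDeriv m (LSeries (siegelB χ ψ)) 2 := by
    intro m
    have := LSeries.iteratedDeriv_alternating (a := siegelB χ ψ) (x := 2)
      (fun n => siegelB_nonneg χ ψ hχ2 hψ2 n) habs m
    simpa using this
  have hβc : ∀ m, (β m : ℂ) = (-1 : ℂ) ^ m * iteratedDeriv m (LSeries (siegelB χ ψ)) 2 /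
      m.factorial := by
    intro m
    have h := (Complex.le_def.1 (hnn m)).2
    rw [hβ]
    push_cast
    congr 1
    apply Complex.ext
    · simp
    · simpa using h
  have hcoef : ∀ m, ((β m - l : ℝ) : ℂ) = (-1) ^ m * iteratedDeriv m g 2 / m.factorial := by
    intro m
    have hf : (m.factorial : ℂ) ≠ 0 := by exact_mod_cast m.factorial_ne_zero
    have h1 : ((-1 : ℂ) ^ m) * (-1) ^ m = 1 := by
      rw [← mul_pow]; norm_num
    push_cast
    rw [hβc, hder, mul_sub, sub_div]
    congr 1
    rw [eq_div_iff hf]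
    linear_combination (-(l:ℂ) * (m.factorial : ℂ)) * h1
  have hx1 : s0 ≠ 1 := hs1.ne
  have hgs : (g s0).re ≤ l / (1 - s0) := by
    rw [hgne _ (by exact_mod_cast hx1)]
    have : ((s0:ℂ) - 1)⁻¹ = (((s0 - 1)⁻¹ : ℝ) : ℂ) := by push_cast; rfl
    rw [this, Complex.re_mul_ofReal, Complex.sub_re, Complex.ofReal_re]
    have h0 : 0 < 1 - s0 := by linarith
    rw [show (s0 - 1)⁻¹ = - (1 - s0)⁻¹ by rw [← inv_neg]; congr 1; ring, div_eq_mul_inv]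
    have : 0 ≤ (sP χ ψ s0).re * (1 - s0)⁻¹ := mul_nonneg hpos (inv_nonneg.2 h0.le)
    linarith
  have hsum : HasSum (fun m => (β m - l) * (2 - s0) ^ m) (g s0).re := by
    have := Complex.hasSum_re htay
    have heq : (fun m => (β m - l) * (2 - s0) ^ m) = fun m : ℕ =>
        ((m.factorial : ℂ)⁻¹ • ((s0:ℂ) - 2) ^ m • iteratedDeriv m g 2).re := by
      funext m
      have h1 : (m.factorial : ℂ)⁻¹ • ((s0:ℂ) - 2) ^ m • iteratedDeriv m g 2 =
          (((β m - l) * (2 - s0) ^ m : ℝ) : ℂ) := by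
        have h2 : ((s0:ℂ) - 2) ^ m = (-1) ^ m * (2 - (s0:ℂ)) ^ m := by
          rw [← mul_pow]; congr 1; ring
        rw [Complex.ofReal_mul, hcoef, h2, smul_eq_mul, smul_eq_mul]
        push_cast
        ring
      rw [h1, Complex.ofReal_re]
    rw [heq]
    exact this
  have := real_estermann β l (4 * B * (M:ℝ) ^ 3) (2 - s0) (g s0).re
    (fun m => div_nonneg (by simpa using (Complex.le_def.1 (hnn m)).1) (by positivity))
    (by
      have := (Complex.le_def.1 (siegelB_one_le χ ψ hχ2 hψ2)).1
      simpa [hβ] using this)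
    (fun m => by
      have hf : (0:ℝ) < m.factorial := by exact_mod_cast m.factorial_pos
      rw [← Real.norm_eq_abs, ← Complex.norm_real, hcoef, norm_div, norm_mul, norm_pow, norm_neg,
        norm_one, one_pow, one_mul, Complex.norm_natCast, div_le_iff₀ hf]
      refine (hcauchy m).trans (le_of_eq ?_)
      rw [div_eq_mul_inv, ← inv_pow]
      norm_num
      ring)
    (by linarith) (by linarith) hsum (by rw [show 2 - s0 - 1 = 1 - s0 by ring]; exact hgs) K hK hKB
  rw [show 2 - s0 - 1 = 1 - s0 by ring] at this
  refine this.trans ?_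
  have : 0 ≤ (2 - s0) ^ K := pow_nonneg (by linarith) _
  gcongr

end Estermann

section Siegel
open DirichletCharacter

lemma two_pow_omega_le (M : ℕ) (hM : M ≠ 0) :
    (2:ℝ) ^ M.primeFactors.card ≤ (M.divisors.card : ℝ) := by
  rw [Nat.card_divisors hM]
  push_cast
  rw [← Finset.prod_const]
  apply Finset.prod_le_prod
  · intros; norm_num
  · intro p hp
    have : 1 ≤ M.factorization p := by
      have := Nat.support_factorization M ▸ hp
      exact Nat.one_le_iff_ne_zero.2 (Finsupp.mem_support_iff.1 this)
    have : (1:ℝ) ≤ M.factorization p := by exact_mod_cast this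
    linarith

lemma euler_upper {N : ℕ} (χ : DirichletCharacter ℂ N) (M : ℕ) (hM : M ≠ 0) :
    ‖∏ p ∈ M.primeFactors, (1 - χ p * (p:ℂ) ^ (-1 : ℂ))‖ ≤ M.divisors.card := by
  refine le_trans ?_ (two_pow_omega_le M hM)
  rw [norm_prod, ← Finset.prod_const]
  apply Finset.prod_le_prod
  · intros; positivity
  · intro p hp
    have hp2 := (Nat.prime_of_mem_primeFactors hp).two_le
    have hp2' : (2:ℝ) ≤ p := by exact_mod_cast hp2
    have h1 : ‖χ p * (p:ℂ) ^ (-1 : ℂ)‖ ≤ 1 := by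
      rw [norm_mul, Complex.cpow_neg_one, norm_inv, Complex.norm_natCast]
      have := χ.norm_le_one p
      have h3 : (p:ℝ)⁻¹ ≤ 1 := inv_le_one_of_one_le₀ (by linarith)
      have : (0:ℝ) ≤ (p:ℝ)⁻¹ := by positivity
      nlinarith [norm_nonneg (χ p)]
    have := norm_sub_le 1 (χ p * (p:ℂ) ^ (-1 : ℂ))
    rw [norm_one] at this
    linarith

lemma euler_lower {N : ℕ} (χ : DirichletCharacter ℂ N) (M : ℕ) (hM : M ≠ 0) :
    1 ≤ ‖∏ p ∈ M.primeFactors, (1 - χ p * (p:ℂ) ^ (-1 : ℂ))‖ * M.divisors.card := by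
  have h : (1/2:ℝ) ^ M.primeFactors.card ≤ ‖∏ p ∈ M.primeFactors, (1 - χ p * (p:ℂ) ^ (-1 : ℂ))‖ := by
    rw [norm_prod, ← Finset.prod_const]
    apply Finset.prod_le_prod
    · intros; positivity
    · intro p hp
      have hp2 := (Nat.prime_of_mem_primeFactors hp).two_le
      have hp2' : (2:ℝ) ≤ p := by exact_mod_cast hp2
      have h1 : ‖χ p * (p:ℂ) ^ (-1 : ℂ)‖ ≤ 1 / 2 := by
        rw [norm_mul, Complex.cpow_neg_one, norm_inv, Complex.norm_natCast]
        have := χ.norm_le_one p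
        have h3 : (p:ℝ)⁻¹ ≤ 1 / 2 := by
          rw [inv_le_comm₀ (by linarith) (by norm_num)]; linarith
        have : (0:ℝ) ≤ (p:ℝ)⁻¹ := by positivity
        nlinarith [norm_nonneg (χ p)]
      have := norm_sub_norm_le 1 (χ p * (p:ℂ) ^ (-1 : ℂ))
      rw [norm_one] at this
      linarith
  calc (1:ℝ) = (1/2:ℝ) ^ M.primeFactors.card * (2:ℝ) ^ M.primeFactors.card := by
        rw [← mul_pow]; norm_num
    _ ≤ _ := by
        gcongr
        exact two_pow_omega_le M hM

lemma level_upper {N M : ℕ} [NeZero N] [NeZero M] (hd : N ∣ M) (χ : DirichletCharacter ℂ N)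
    (hχ : χ ≠ 1) :
    ‖(changeLevel hd χ).LFunction 1‖ ≤ M.divisors.card * ‖χ.LFunction 1‖ := by
  rw [LFunction_changeLevel hd χ (Or.inl hχ), norm_mul, mul_comm]
  gcongr
  exact euler_upper χ M (NeZero.ne M)

lemma level_lower {N M : ℕ} [NeZero N] [NeZero M] (hd : N ∣ M) (χ : DirichletCharacter ℂ N)
    (hχ : χ ≠ 1) :
    ‖χ.LFunction 1‖ ≤ M.divisors.card * ‖(changeLevel hd χ).LFunction 1‖ := by
  rw [LFunction_changeLevel hd χ (Or.inl hχ), norm_mul]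
  have := euler_lower χ M (NeZero.ne M)
  nlinarith [norm_nonneg (χ.LFunction 1)]

/-- choice of K -/
lemma exists_K (B : ℝ) (hB : 1 ≤ B) (M : ℝ) (hM : 1 ≤ M) (x : ℝ) (hx : 1 < x) (hx2 : x ≤ 5 / 4) :
    ∃ K : ℕ, 1 ≤ K ∧ 12 * (B * M ^ 3) * (5 / 6) ^ K ≤ 1 ∧
      x ^ K ≤ 3 * (12 * B) ^ (6 * (x - 1)) * M ^ (18 * (x - 1)) := by
  have hM3 : 1 ≤ M ^ 3 := one_le_pow₀ hM
  have hBM : 1 ≤ B * M ^ 3 := by nlinarith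
  set Q : ℝ := 12 * (B * M ^ 3) with hQ
  have hQ1 : 12 ≤ Q := by linarith
  have hlog : 0 < Real.log Q := Real.log_pos (by linarith)
  refine ⟨⌈6 * Real.log Q⌉₊, ?_, ?_, ?_⟩
  · exact Nat.one_le_iff_ne_zero.2 (Nat.ceil_pos.2 (by positivity)).ne'
  · have h1 : (5 / 6 : ℝ) ≤ Real.exp (-(1 / 6)) := by
      have := Real.add_one_le_exp (-(1 / 6 : ℝ)); linarith
    calc Q * (5 / 6) ^ ⌈6 * Real.log Q⌉₊ ≤ Q * Real.exp (-(1 / 6)) ^ ⌈6 * Real.log Q⌉₊ := by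
          gcongr
      _ = Q * Real.exp (⌈6 * Real.log Q⌉₊ * (-(1 / 6))) := by rw [← Real.exp_nat_mul]
      _ ≤ Q * Real.exp (-Real.log Q) := by
          gcongr
          have := Nat.le_ceil (6 * Real.log Q)
          linarith
      _ = 1 := by
          rw [Real.exp_neg, Real.exp_log (by linarith)]
          exact mul_inv_cancel₀ (by linarith)
  · have hK : (⌈6 * Real.log Q⌉₊ : ℝ) ≤ 6 * Real.log Q + 1 :=
      (Nat.ceil_lt_add_one (by positivity)).le
    have h1 : x ≤ Real.exp (x - 1) := by
      have := Real.add_one_le_exp (x - 1); linarith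
    have h0 : 0 < x - 1 := by linarith
    calc x ^ ⌈6 * Real.log Q⌉₊ ≤ Real.exp (x - 1) ^ ⌈6 * Real.log Q⌉₊ := by gcongr
      _ = Real.exp (⌈6 * Real.log Q⌉₊ * (x - 1)) := by rw [← Real.exp_nat_mul]
      _ ≤ Real.exp (1 + Real.log Q * (6 * (x - 1))) := by
          apply Real.exp_le_exp.2
          nlinarith
      _ = Real.exp 1 * Q ^ (6 * (x - 1)) := by
          rw [Real.exp_add, Real.rpow_def_of_pos (by linarith)]
      _ ≤ 3 * Q ^ (6 * (x - 1)) := by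
          gcongr
          exact Real.exp_one_lt_three.le
      _ = _ := by
          rw [hQ, ← mul_assoc, Real.mul_rpow (by linarith) (by linarith), ← mul_assoc,
            ← Real.rpow_natCast M 3, ← Real.rpow_mul (by linarith)]
          congr 2; push_cast; ring

lemma siegel_core (ε : ℝ) (hε : 0 < ε) (hε1 : ε < 1) (N1 : ℕ) [NeZero N1]
    (χ1 : DirichletCharacter ℂ N1) (h1 : χ1 ≠ 1) (h12 : χ1 ^ 2 = 1) (s0 : ℝ) (hs0 : 3 / 4 ≤ s0)
    (hs1 : s0 < 1) (hsε : 72 * (1 - s0) ≤ ε)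
    (hP : ∀ (M : ℕ) [NeZero M] (hd : N1 ∣ M) (ψ : DirichletCharacter ℂ M), ψ ≠ 1 → ψ ^ 2 = 1 →
      changeLevel hd χ1 * ψ ≠ 1 → 0 ≤ (sP (changeLevel hd χ1) ψ s0).re) :
    ∃ c : ℝ, 0 < c ∧ ∀ (N : ℕ) [NeZero N] (χ : DirichletCharacter ℂ N), χ ≠ 1 → χ ^ 2 = 1 →
      c * (N:ℝ) ^ (-ε) ≤ ‖χ.LFunction 1‖ := by
  obtain ⟨B, hB1, hE⟩ := estermann
  obtain ⟨D, hD1, hD⟩ := divisor_bound (ε / 4) (by linarith)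
  obtain ⟨U, hU1, hU⟩ := LFunction_one_upper (ε / 4) (by linarith) (by linarith)
  have hL1 : 0 < ‖χ1.LFunction 1‖ := norm_pos_iff.2 (LFunction_apply_one_ne_zero h1)
  set x : ℝ := 2 - s0 with hx
  set W : ℝ := 3 * (12 * B) ^ (6 * (x - 1)) with hW
  have hW0 : 0 < W := by positivity
  have hN1 : (1:ℝ) ≤ N1 := by exact_mod_cast Nat.one_le_iff_ne_zero.2 (NeZero.ne N1)
  set c1 : ℝ := min (‖χ1.LFunction 1‖ / D ^ 2) ((1 - s0) / 2 / (D * U ^ 2 * W)) with hc1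
  have hs1' : 0 < 1 - s0 := by linarith
  have hc1pos : 0 < c1 := lt_min (by positivity) (by positivity)
  refine ⟨c1 * (N1:ℝ) ^ (-ε), by positivity, ?_⟩
  intro N _ χ hχ hχ2
  haveI : NeZero (N1 * N) := ⟨mul_ne_zero (NeZero.ne N1) (NeZero.ne N)⟩
  have hN : (1:ℝ) ≤ N := by exact_mod_cast Nat.one_le_iff_ne_zero.2 (NeZero.ne N)
  have hd1 : N1 ∣ N1 * N := Dvd.intro _ rfl
  have hd2 : N ∣ N1 * N := Dvd.intro_left _ rfl
  set M : ℕ := N1 * N with hM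
  have hMr : (M:ℝ) = N1 * N := by rw [hM]; push_cast; ring
  have hM1 : (1:ℝ) ≤ M := by rw [hMr]; nlinarith
  have hM0 : (0:ℝ) < M := by linarith
  have hτ := hD M (NeZero.ne M)
  suffices hs : c1 * (M:ℝ) ^ (-ε) ≤ ‖χ.LFunction 1‖ by
    rw [hMr, Real.mul_rpow (by linarith) (by linarith), ← mul_assoc] at hs
    exact hs
  set A := changeLevel hd1 χ1 with hA
  set ψ := changeLevel hd2 χ with hψd
  have hA1 : A ≠ 1 := by
    intro h; rw [hA, changeLevel_eq_one_iff] at h; exact h1 h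
  have hψ1 : ψ ≠ 1 := by
    intro h; rw [hψd, changeLevel_eq_one_iff] at h; exact hχ h
  have hA2 : A ^ 2 = 1 := by rw [hA, ← map_pow, h12, map_one]
  have hψ2 : ψ ^ 2 = 1 := by rw [hψd, ← map_pow, hχ2, map_one]
  have lA := level_lower hd1 χ1 h1
  have lψ := level_upper hd2 χ hχ
  rw [← hA] at lA
  rw [← hψd] at lψ
  have hτ0 : (0:ℝ) ≤ M.divisors.card := by positivity
  have hMe : 0 < (M:ℝ) ^ (ε / 4) := by positivity
  by_cases hprod : A * ψ = 1
  · have hAψ : A = ψ := by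
      have : A * ψ * ψ = ψ := by rw [hprod, one_mul]
      rwa [mul_assoc, ← sq, hψ2, mul_one] at this
    rw [hAψ] at lA
    have h3 : ‖χ1.LFunction 1‖ ≤ (D * (M:ℝ) ^ (ε / 4)) ^ 2 * ‖χ.LFunction 1‖ := by
      calc _ ≤ (M.divisors.card : ℝ) * ‖ψ.LFunction 1‖ := lA
        _ ≤ (M.divisors.card : ℝ) * (M.divisors.card * ‖χ.LFunction 1‖) := by gcongr
        _ = (M.divisors.card : ℝ) ^ 2 * ‖χ.LFunction 1‖ := by ring
        _ ≤ _ := by gcongr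
    have e : ((M:ℝ) ^ (ε / 4)) ^ 2 = (M:ℝ) ^ (ε / 2) := by
      rw [← Real.rpow_natCast, ← Real.rpow_mul hM0.le]; congr 1; push_cast; ring
    rw [mul_pow, e] at h3
    calc c1 * (M:ℝ) ^ (-ε) ≤ ‖χ1.LFunction 1‖ / D ^ 2 * (M:ℝ) ^ (-(ε / 2)) := by
          gcongr
          · exact min_le_left _ _
          · linarith
      _ ≤ (D ^ 2 * (M:ℝ) ^ (ε / 2) * ‖χ.LFunction 1‖) / D ^ 2 * (M:ℝ) ^ (-(ε / 2)) := by gcongr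
      _ = ‖χ.LFunction 1‖ := by
          rw [Real.rpow_neg hM0.le]
          field_simp
  · have hpos := hP M hd1 ψ hψ1 hψ2 hprod
    obtain ⟨K, hK1, hK2, hK3⟩ := exists_K B hB1 M hM1 x (by linarith) (by linarith)
    have h := hE M A ψ hA2 hψ2 hA1 hψ1 hprod s0 hs0 hs1 hpos K hK1 hK2
    have u1 := hU M A hA1
    have u2 := hU M (A * ψ) hprod
    rw [← hx] at h
    have h3 : (1 - s0) / 2 ≤ (U * (M:ℝ) ^ (ε / 4)) * ((D * (M:ℝ) ^ (ε / 4)) * ‖χ.LFunction 1‖) *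
        (U * (M:ℝ) ^ (ε / 4)) * (W * (M:ℝ) ^ (ε / 4)) := by
      refine h.trans ?_
      have hU0 : 0 < U := by linarith
      have hD0 : 0 < D := by linarith
      gcongr
      · exact pow_nonneg (by linarith) _
      · exact lψ.trans (by gcongr)
      · refine hK3.trans ?_
        gcongr
        linarith
    have e : (M:ℝ) ^ (ε / 4) * (M:ℝ) ^ (ε / 4) * (M:ℝ) ^ (ε / 4) * (M:ℝ) ^ (ε / 4) = (M:ℝ) ^ ε := by
      rw [← Real.rpow_add hM0, ← Real.rpow_add hM0, ← Real.rpow_add hM0]; congr 1; ring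
    calc c1 * (M:ℝ) ^ (-ε) ≤ ((1 - s0) / 2 / (D * U ^ 2 * W)) * (M:ℝ) ^ (-ε) := by
          gcongr
          exact min_le_right _ _
      _ ≤ (D * U ^ 2 * W * (M:ℝ) ^ ε * ‖χ.LFunction 1‖) / (D * U ^ 2 * W) * (M:ℝ) ^ (-ε) := by
          gcongr
          refine h3.trans (le_of_eq ?_)
          rw [← e]; ring
      _ = ‖χ.LFunction 1‖ := by
          rw [Real.rpow_neg hM0.le]
          have : 0 < (M:ℝ) ^ ε := by positivity
          have : 0 < U := by linarith
          have : 0 < D := by linarith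
          field_simp

lemma sP_pos_of_nonvanishing {M : ℕ} [NeZero M] (χ ψ : DirichletCharacter ℂ M) (hχ : χ ≠ 1)
    (hψ : ψ ≠ 1) (hχψ : χ * ψ ≠ 1) (hχ2 : χ ^ 2 = 1) (hψ2 : ψ ^ 2 = 1) (s0 : ℝ) (hs0 : 0 < s0)
    (hs1 : s0 < 1) (hz : 0 < (zH s0).re)
    (hnz : ∀ χ : DirichletCharacter ℂ M, χ ≠ 1 → χ ^ 2 = 1 → ∀ β : ℝ, s0 ≤ β → β < 1 →
      χ.LFunction β ≠ 0) : 0 ≤ (sP χ ψ s0).re := by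
  have hχψ2 : (χ * ψ) ^ 2 = 1 := by rw [mul_pow, hχ2, hψ2, one_mul]
  set h : ℂ → ℂ := fun s => χ.LFunction s * (ψ.LFunction s * (χ * ψ).LFunction s) with hh
  have hreal : ∀ x : ℝ, 0 < x → ∃ r : ℝ, h x = r := by
    intro x hx
    obtain ⟨r1, hr1⟩ := LFunction_real χ hχ hχ2 hx
    obtain ⟨r2, hr2⟩ := LFunction_real ψ hψ hψ2 hx
    obtain ⟨r3, hr3⟩ := LFunction_real (χ * ψ) hχψ hχψ2 hx
    exact ⟨r1 * (r2 * r3), by simp only [hh]; rw [hr1, hr2, hr3]; push_cast; ring⟩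
  have hne : ∀ x : ℝ, s0 ≤ x → h x ≠ 0 := by
    intro x hx
    have hn : ∀ χ : DirichletCharacter ℂ M, χ ≠ 1 → χ ^ 2 = 1 → χ.LFunction x ≠ 0 := by
      intro χ h1 h2
      rcases lt_or_ge x 1 with hx1 | hx1
      · exact hnz χ h1 h2 x hx hx1
      · exact LFunction_ne_zero_of_one_le_re χ (Or.inl h1) (by simpa using hx1)
    exact mul_ne_zero (hn _ hχ hχ2) (mul_ne_zero (hn _ hψ hψ2) (hn _ hχψ hχψ2))
  have hcont : Continuous h := by
    exact (differentiable_LFunction hχ).continuous.mul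
      ((differentiable_LFunction hψ).continuous.mul (differentiable_LFunction hχψ).continuous)
  have hcr : Continuous (fun x : ℝ => (h x).re) :=
    Complex.continuous_re.comp (hcont.comp Complex.continuous_ofReal)
  have h2 : 0 < (h (2:ℝ)).re := by
    have h1 := siegelB_one_le χ ψ hχ2 hψ2
    have h3 := (siegelB_LSeriesHasSum χ ψ (s := 2) (by simp)).LSeries_eq
    rw [h3, riemannZeta_two] at h1
    have h4 := (Complex.le_def.1 h1).1
    have h5 : (Real.pi : ℂ) ^ 2 / 6 * χ.LFunction 2 * (ψ.LFunction 2 * (χ * ψ).LFunction 2) =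
      ((Real.pi ^ 2 / 6 : ℝ) : ℂ) * h (2:ℝ) := by simp only [hh]; push_cast; ring
    rw [h5, Complex.re_ofReal_mul, Complex.one_re] at h4
    by_contra hcon
    push Not at hcon
    have : Real.pi ^ 2 / 6 * (h (2:ℝ)).re ≤ 0 :=
      mul_nonpos_of_nonneg_of_nonpos (by positivity) hcon
    linarith
  have hs : 0 < (h s0).re := by
    by_contra hcon
    push Not at hcon
    obtain ⟨y, hy, hy0⟩ := intermediate_value_Icc (by linarith : s0 ≤ 2) hcr.continuousOn
      (⟨hcon, h2.le⟩ : (0:ℝ) ∈ Set.Icc (h s0).re (h (2:ℝ)).re)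
    obtain ⟨r, hr⟩ := hreal y (by linarith [hy.1])
    apply hne y hy.1
    have : (h y).re = 0 := hy0
    rw [hr, Complex.ofReal_re] at this
    rw [hr, this]; simp
  obtain ⟨r, hr⟩ := hreal s0 hs0
  have : sP χ ψ s0 = zH s0 * (r:ℂ) := by
    rw [← hr]; simp only [hh, sP]; ring
  rw [this, Complex.re_mul_ofReal]
  rw [hr, Complex.ofReal_re] at hs
  exact (mul_pos hz hs).le

theorem siegel (ε : ℝ) (hε : 0 < ε) (hε1 : ε < 1) :
    ∃ c : ℝ, 0 < c ∧ ∀ (N : ℕ) [NeZero N] (χ : DirichletCharacter ℂ N), χ ≠ 1 → χ ^ 2 = 1 →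
      c * (N:ℝ) ^ (-ε) ≤ ‖χ.LFunction 1‖ := by
  have hz : ∀ᶠ s : ℝ in nhds 1, 0 < (zH s).re := by
    have hc : Continuous (fun s : ℝ => (zH s).re) :=
      Complex.continuous_re.comp (zH_diff.continuous.comp Complex.continuous_ofReal)
    apply hc.continuousAt.eventually_const_lt
    simp [zH_one]
  obtain ⟨δ0, hδ0, hz⟩ := Metric.eventually_nhds_iff.1 hz
  set δ : ℝ := min (δ0 / 2) (ε / 72) with hδ
  have hδpos : 0 < δ := lt_min (by linarith) (by linarith)
  have hδ1 : δ ≤ ε / 72 := min_le_right _ _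
  have hδ2 : δ ≤ δ0 / 2 := min_le_left _ _
  by_cases hex : ∃ (N1 : ℕ) (_ : NeZero N1) (χ1 : DirichletCharacter ℂ N1) (β : ℝ),
      χ1 ≠ 1 ∧ χ1 ^ 2 = 1 ∧ 1 - δ ≤ β ∧ β < 1 ∧ χ1.LFunction β = 0
  · obtain ⟨N1, _, χ1, β, h1, h2, hb1, hb2, hb0⟩ := hex
    refine siegel_core ε hε hε1 N1 χ1 h1 h2 β (by linarith) hb2 (by linarith) ?_
    intro M _ hd ψ _ _ _
    rw [sP, LFunction_changeLevel hd χ1 (Or.inl h1), hb0]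
    simp
  · push Not at hex
    set χ4 : DirichletCharacter ℂ 4 := ZMod.χ₄.ringHomComp (Int.castRingHom ℂ) with hχ4
    have h1 : χ4 ≠ 1 := by
      intro h
      have := congrArg (fun f : DirichletCharacter ℂ 4 => f 3) h
      have e1 : χ4 3 = -1 := by
        rw [hχ4, MulChar.ringHomComp_apply, show ZMod.χ₄ 3 = -1 by decide]; simp
      have e2 : (1 : DirichletCharacter ℂ 4) 3 = 1 := by
        apply MulChar.one_apply
        decide
      rw [e1, e2] at this
      norm_num at this
    have h2 : χ4 ^ 2 = 1 := by
      apply MulChar.isQuadratic_iff_sq_eq_one.1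
      exact ZMod.isQuadratic_χ₄.comp _
    refine siegel_core ε hε hε1 4 χ4 h1 h2 (1 - δ) (by linarith) (by linarith) (by linarith) ?_
    intro M _ hd ψ hψ hψ2 hprod
    have hA1 : changeLevel hd χ4 ≠ 1 := by
      intro h; rw [changeLevel_eq_one_iff] at h; exact h1 h
    have hA2 : changeLevel hd χ4 ^ 2 = 1 := by rw [← map_pow, h2, map_one]
    apply sP_pos_of_nonvanishing _ ψ hA1 hψ hprod hA2 hψ2 (1 - δ) (by linarith) (by linarith)
    · apply hz
      rw [Real.dist_eq, show 1 - δ - 1 = -δ by ring, abs_neg, abs_of_pos hδpos]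
      linarith
    · intro χ hχ hχ2 β hb1 hb2
      exact hex M inferInstance χ β hχ hχ2 hb1 hb2

end Siegel

section PsiChar
open scoped NumberTheorySymbols

lemma psi_aux_odd {d n : ℕ} (h : n.Coprime (4 * d)) : Odd n := by
  have h2 : n.Coprime 2 := Nat.Coprime.coprime_dvd_right ⟨2 * d, by ring⟩ h
  exact Nat.coprime_two_right.1 h2

open Classical in
/-- The quadratic character modulo `4 d` attached to `d`. -/
noncomputable def psiChar (d : ℕ) [NeZero d] : DirichletCharacter ℂ (4 * d) where
  toFun z := if IsUnit z then ((jacobiSym (d : ℤ) z.val : ℤ) : ℂ) else 0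
  map_one' := by
    have h1 : (1 : ZMod (4 * d)).val = 1 := by
      have : Fact (1 < 4 * d) := ⟨by have := Nat.pos_of_ne_zero (NeZero.ne d); omega⟩
      exact ZMod.val_one _
    simp [h1]
  map_mul' x y := by
    by_cases hx : IsUnit x
    · by_cases hy : IsUnit y
      · rw [if_pos (hx.mul hy), if_pos hx, if_pos hy]
        have hx' : x.val.Coprime (4 * d) := ZMod.val_coe_unit_coprime hx.unit
        have hy' : y.val.Coprime (4 * d) := ZMod.val_coe_unit_coprime hy.unit
        have ox := psi_aux_odd hx'
        have oy := psi_aux_odd hy'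
        rw [ZMod.val_mul, ← jacobiSym.mod_right' d (ox.mul oy),
          jacobiSym.mul_right' _ ox.pos.ne' oy.pos.ne']
        push_cast; rfl
      · rw [if_neg (fun h => hy (isUnit_of_mul_isUnit_right h)), if_neg hy, mul_zero]
    · rw [if_neg (fun h => hx (isUnit_of_mul_isUnit_left h)), if_neg hx, zero_mul]
  map_nonunit' x hx := if_neg hx

lemma psiChar_apply (d : ℕ) [NeZero d] (n : ℕ) (h : n.Coprime (4 * d)) :
    psiChar d (n : ZMod (4 * d)) = ((jacobiSym (d : ℤ) n : ℤ) : ℂ) := by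
  have hu : IsUnit (n : ZMod (4 * d)) := (ZMod.isUnit_iff_coprime n (4 * d)).2 h
  change (if IsUnit (n : ZMod (4 * d)) then _ else _) = _
  rw [if_pos hu, ZMod.val_natCast, ← jacobiSym.mod_right' d (psi_aux_odd h)]

lemma psiChar_sq (d : ℕ) [NeZero d] : psiChar d ^ 2 = 1 := by
  apply MulChar.isQuadratic_iff_sq_eq_one.1
  intro z
  by_cases hz : IsUnit z
  · have : psiChar d z = ((jacobiSym (d : ℤ) z.val : ℤ) : ℂ) := by
      change (if IsUnit z then _ else _) = _
      rw [if_pos hz]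
    rw [this]
    rcases jacobiSym.trichotomy (d : ℤ) z.val with h | h | h <;> simp [h]
  · left; exact MulChar.map_nonunit _ hz

lemma exists_odd_factorization {d : ℕ} (hd : d ≠ 0) (h : ¬ IsSquare d) :
    ∃ p : ℕ, p.Prime ∧ Odd (d.factorization p) := by
  by_contra hcon
  push Not at hcon
  apply h
  refine ⟨d.factorization.prod (fun p k => p ^ (k / 2)), ?_⟩
  conv_lhs => rw [← Nat.prod_factorization_pow_eq_self hd]
  rw [← Finsupp.prod_mul]
  apply Finsupp.prod_congr
  intro p hp
  have hpp : p.Prime := Nat.prime_of_mem_primeFactors (Nat.support_factorization d ▸ hp)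
  have := hcon p hpp
  rw [Nat.not_odd_iff_even] at this
  obtain ⟨k, hk⟩ := this
  rw [hk, ← pow_add]
  congr 1
  omega

lemma exists_jacobi_neg {d : ℕ} (hd : d ≠ 0) (h : ¬ IsSquare d) :
    ∃ n : ℕ, n.Coprime (4 * d) ∧ jacobiSym (d : ℤ) n = -1 := by
  obtain ⟨p, hp, hodd⟩ := exists_odd_factorization hd h
  set k := d.factorization p with hk
  obtain ⟨m, hm⟩ : ∃ m, m = d / p ^ k := ⟨_, rfl⟩
  have hdm : d = p ^ k * m := by rw [hm, hk]; exact (Nat.ordProj_mul_ordCompl_eq_self d p).symm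
  have hpm : p.Coprime m := by rw [hm, hk]; exact Nat.coprime_ordCompl hp hd
  have hm0 : m ≠ 0 := by rintro rfl; simp at hdm; exact hd hdm
  have hk0 : k ≠ 0 := by rintro h0; rw [h0] at hodd; simp at hodd
  rcases hp.eq_two_or_odd' with rfl | hpo
  · have hcop : Nat.Coprime 8 m := by
      have : (8:ℕ) = 2 ^ 3 := by norm_num
      rw [this]; exact Nat.Coprime.pow_left 3 hpm
    obtain ⟨n, hn1, hn2⟩ := Nat.chineseRemainder hcop 5 1
    have hn8 : n % 8 = 5 := hn1
    have hno : Odd n := by rw [Nat.odd_iff]; omega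
    have hmo : Odd m := Nat.coprime_two_left.1 hpm
    have hnm : n.Coprime m := by
      have := hn2.gcd_eq
      rw [Nat.gcd_one_left] at this
      exact this
    refine ⟨n, ?_, ?_⟩
    · rw [hdm]
      have h2 : n.Coprime 2 := Nat.coprime_two_right.2 hno
      refine Nat.Coprime.mul_right ?_ (Nat.Coprime.mul_right (h2.pow_right k) hnm)
      exact h2.pow_right 2
    · rw [hdm]; push_cast
      rw [jacobiSym.mul_left, jacobiSym.pow_left, jacobiSym.at_two hno]
      have h1 : J((m:ℤ) | n) = 1 := by
        rw [jacobiSym.quadratic_reciprocity_one_mod_four' hmo (by omega)]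
        have : ((n:ℕ):ℤ) % m = 1 % m := by
          have := (Int.natCast_modEq_iff.2 hn2)
          push_cast at this
          exact this
        rw [jacobiSym.mod_left' this, jacobiSym.one_left]
      have h8 : ZMod.χ₈ (n : ZMod 8) = -1 := by
        rw [ZMod.χ₈_nat_eq_if_mod_eight]
        simp [hn8]; omega
      rw [h1, h8, hodd.neg_one_pow]; norm_num
  · haveI : Fact p.Prime := ⟨hp⟩
    obtain ⟨u, hu⟩ := FiniteField.exists_nonsquare (F := ZMod p) (by
      rw [ZMod.ringChar_zmod_n]; rintro rfl; exact absurd hpo (by decide))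
    have hcop : Nat.Coprime (4 * m) p := by
      refine Nat.Coprime.mul_left ?_ hpm.symm
      have : (4:ℕ) = 2 ^ 2 := by norm_num
      rw [this]; exact Nat.Coprime.pow_left 2 (Nat.coprime_two_left.2 hpo)
    obtain ⟨n, hn1, hn2⟩ := Nat.chineseRemainder hcop 1 u.val
    have hnu : (n : ZMod p) = u := by
      rw [(ZMod.natCast_eq_natCast_iff _ _ _).2 hn2]; simp
    have hn4 : n % 4 = 1 := by
      have := hn1.of_mul_right m
      exact this
    have hno : Odd n := by rw [Nat.odd_iff]; omega
    have hn4m : n.Coprime (4 * m) := by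
      have := hn1.gcd_eq
      rw [Nat.gcd_one_left] at this
      exact this
    have hJp : J((n:ℤ) | p) = -1 := by
      rw [ZMod.nonsquare_iff_jacobiSym_eq_neg_one]
      push_cast
      rw [hnu]; exact hu
    have hnp : n.Coprime p := by
      by_contra hc
      have : J((n:ℤ) | p) = 0 := by
        rw [jacobiSym.eq_zero_iff]
        refine ⟨hp.ne_zero, ?_⟩
        intro hg; apply hc; simpa [Int.gcd_natCast_natCast] using hg
      rw [this] at hJp; norm_num at hJp
    refine ⟨n, ?_, ?_⟩
    · rw [hdm]
      have : 4 * (p ^ k * m) = (4 * m) * p ^ k := by ring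
      rw [this]
      exact Nat.Coprime.mul_right hn4m (hnp.pow_right k)
    · rw [hdm]; push_cast
      rw [jacobiSym.mul_left, jacobiSym.pow_left]
      have h1 : J((m:ℤ) | n) = 1 := by
        rw [jacobiSym.mod_right' m hno]
        have : n % (4 * m) = 1 % (4 * m) := hn1
        rw [this, ← jacobiSym.mod_right' m odd_one, jacobiSym.one_right]
      rw [h1, jacobiSym.quadratic_reciprocity_one_mod_four' hpo hn4, hJp, hodd.neg_one_pow]
      norm_num

lemma psiChar_ne_one (d : ℕ) [NeZero d] (h : ¬ IsSquare d) : psiChar d ≠ 1 := by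
  obtain ⟨n, hn, hj⟩ := exists_jacobi_neg (NeZero.ne d) h
  intro h1
  have := psiChar_apply d n hn
  rw [h1, hj, MulChar.one_apply ((ZMod.isUnit_iff_coprime n (4 * d)).2 hn)] at this
  norm_num at this

end PsiChar

section ZetaMulSum
open DirichletCharacter ArithmeticFunction

lemma abel_id (A : ℕ → ℂ) (g : ℕ → ℝ) (h0 : A 0 = 0) (n : ℕ) :
    ∑ i ∈ Finset.range n, (A (i + 1) - A i) * (g i : ℂ) =
      A n * (g n : ℂ) + ∑ i ∈ Finset.range n, A (i + 1) * ((g i - g (i + 1) : ℝ) : ℂ) := by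
  induction n with
  | zero => simp [h0]
  | succ n ih =>
    rw [Finset.sum_range_succ, Finset.sum_range_succ, ih]
    push_cast; ring

lemma abel_bound (A : ℕ → ℂ) (g : ℕ → ℝ) (B : ℝ) (h0 : A 0 = 0) (hA : ∀ i, ‖A i‖ ≤ B)
    (hg : Antitone g) (hg0 : ∀ i, 0 ≤ g i) (n : ℕ) :
    ‖∑ i ∈ Finset.range n, (A (i + 1) - A i) * (g i : ℂ)‖ ≤ B * g 0 := by
  rw [abel_id A g h0]
  have h1 : ‖A n * (g n : ℂ)‖ ≤ B * g n := by
    rw [norm_mul, Complex.norm_real, Real.norm_of_nonneg (hg0 n)]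
    exact mul_le_mul_of_nonneg_right (hA n) (hg0 n)
  have h2 : ‖∑ i ∈ Finset.range n, A (i + 1) * ((g i - g (i + 1) : ℝ) : ℂ)‖ ≤
      B * (g 0 - g n) := by
    refine (norm_sum_le _ _).trans ?_
    rw [← Finset.sum_range_sub' g n, Finset.mul_sum]
    apply Finset.sum_le_sum
    intro i _
    have : 0 ≤ g i - g (i + 1) := sub_nonneg.2 (hg (Nat.le_succ i))
    rw [norm_mul, Complex.norm_real, Real.norm_of_nonneg this]
    exact mul_le_mul_of_nonneg_right (hA _) this
  refine (norm_add_le _ _).trans ?_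
  linarith

lemma zetaMul_sum_eq {N : ℕ} (χ : DirichletCharacter ℂ N) (X : ℕ) :
    ∑ n ∈ Finset.Ioc 0 X, χ.zetaMul n =
      ∑ i ∈ Finset.range X, χ ((i + 1 : ℕ) : ZMod N) * ((X / (i + 1) : ℕ) : ℂ) := by
  have : χ.zetaMul = toArithmeticFunction (χ ·) * (ArithmeticFunction.zeta : ArithmeticFunction ℂ) := by
    unfold DirichletCharacter.zetaMul; rw [mul_comm]
  rw [this, sum_Ioc_mul_zeta_eq_sum]
  rw [Finset.range_eq_Ico, Finset.sum_Ico_add' (fun n : ℕ => χ ((n : ℕ) : ZMod N) * ((X / n : ℕ) : ℂ)) 0 X 1]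
  have h2 : Finset.Ico (0 + 1) (X + 1) = Finset.Ioc 0 X := by ext; simp; omega
  rw [h2]
  apply Finset.sum_congr rfl
  intro n hn
  have hn0 : n ≠ 0 := by simp at hn; omega
  have := chA_apply χ hn0
  congr 1

lemma zetaMul_sum_approx {N : ℕ} [NeZero N] (χ : DirichletCharacter ℂ N) (hχ : χ ≠ 1)
    (X Y : ℕ) (hY : 0 < Y) (hYX : Y ≤ X) :
    ‖∑ n ∈ Finset.Ioc 0 X, χ.zetaMul n - X * χ.LFunction 1‖ ≤ Y + 4 * N * X / Y := by
  rw [zetaMul_sum_eq]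
  obtain ⟨K, rfl⟩ := Nat.exists_eq_add_of_le hYX
  set X := Y + K with hX
  rw [hX, Finset.sum_range_add, ← hX]
  -- tail
  have htail : ‖∑ j ∈ Finset.range K, χ ((Y + j + 1 : ℕ) : ZMod N) * ((X / (Y + j + 1) : ℕ) : ℂ)‖
      ≤ 2 * N * (X / Y) := by
    have := abel_bound (fun i => chS χ (Y + i) - chS χ Y) (fun i => ((X / (Y + i + 1) : ℕ) : ℝ))
      (2 * N) (by simp) (fun i => by
        refine (norm_sub_le _ _).trans ?_
        have := chS_norm_le χ hχ (Y + i)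
        have := chS_norm_le χ hχ Y
        linarith) (fun i j hij => by
          have : X / (Y + j + 1) ≤ X / (Y + i + 1) :=
            Nat.div_le_div_left (by omega) (by omega)
          exact Nat.cast_le.2 this) (fun i => Nat.cast_nonneg _) K
    have h2 : ∑ j ∈ Finset.range K, χ ((Y + j + 1 : ℕ) : ZMod N) * ((X / (Y + j + 1) : ℕ) : ℂ) =
        ∑ i ∈ Finset.range K, ((chS χ (Y + (i + 1)) - chS χ Y) - (chS χ (Y + i) - chS χ Y)) *
          ((((X / (Y + i + 1) : ℕ) : ℝ)) : ℂ) := by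
      apply Finset.sum_congr rfl
      intro i _
      rw [← add_assoc, chS_succ]
      push_cast; ring
    rw [h2]
    refine this.trans ?_
    have h3 : ((X / (Y + 0 + 1) : ℕ) : ℝ) ≤ X / Y := by
      refine Nat.cast_div_le.trans ?_
      push_cast
      gcongr
      linarith
    gcongr
  -- head
  have hhead : ‖∑ i ∈ Finset.range Y, χ ((i + 1 : ℕ) : ZMod N) *
      (((X / (i + 1) : ℕ) : ℂ) - X / ((i + 1 : ℕ) : ℂ))‖ ≤ Y := by
    refine (norm_sum_le _ _).trans ?_
    have : ∀ i ∈ Finset.range Y, ‖χ ((i + 1 : ℕ) : ZMod N) *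
      (((X / (i + 1) : ℕ) : ℂ) - X / ((i + 1 : ℕ) : ℂ))‖ ≤ 1 := by
      intro i _
      rw [norm_mul]
      have h1 := χ.norm_le_one ((i + 1 : ℕ) : ZMod N)
      have h2 : ‖(((X / (i + 1) : ℕ) : ℂ) - X / ((i + 1 : ℕ) : ℂ))‖ ≤ 1 := by
        have : (((X / (i + 1) : ℕ) : ℂ) - X / ((i + 1 : ℕ) : ℂ)) =
          ((((X / (i + 1) : ℕ) : ℝ) - X / ((i + 1 : ℕ) : ℝ) : ℝ) : ℂ) := by push_cast; rfl
        rw [this, Complex.norm_real, Real.norm_eq_abs, abs_le]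
        have h3 : ((X / (i + 1) : ℕ) : ℝ) ≤ X / ((i + 1 : ℕ) : ℝ) := Nat.cast_div_le
        have h4 : (X : ℝ) / ((i + 1 : ℕ) : ℝ) < ((X / (i + 1) : ℕ) : ℝ) + 1 := by
          rw [div_lt_iff₀ (by positivity)]
          have := Nat.lt_div_mul_add (a := X) (b := i + 1) (by omega)
          have h5 : X < (X / (i + 1) + 1) * (i + 1) := by linarith
          exact_mod_cast h5
        constructor <;> linarith
      nlinarith [norm_nonneg (χ ((i + 1 : ℕ) : ZMod N)),
        norm_nonneg (((X / (i + 1) : ℕ) : ℂ) - X / ((i + 1 : ℕ) : ℂ))]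
    refine (Finset.sum_le_sum this).trans ?_
    simp
  have hL := LFunction_one_trunc χ hχ Y hY
  have hsplit : (∑ i ∈ Finset.range Y, χ ((i + 1 : ℕ) : ZMod N) * ((X / (i + 1) : ℕ) : ℂ) +
      ∑ j ∈ Finset.range K, χ ((Y + j + 1 : ℕ) : ZMod N) * ((X / (Y + j + 1) : ℕ) : ℂ))
        - X * χ.LFunction 1 =
      (∑ i ∈ Finset.range Y, χ ((i + 1 : ℕ) : ZMod N) *
      (((X / (i + 1) : ℕ) : ℂ) - X / ((i + 1 : ℕ) : ℂ))) +
      ∑ j ∈ Finset.range K, χ ((Y + j + 1 : ℕ) : ZMod N) * ((X / (Y + j + 1) : ℕ) : ℂ)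
      - X * (χ.LFunction 1 -
      ∑ n ∈ Finset.range Y, χ ((n + 1 : ℕ) : ZMod N) / ((n + 1 : ℕ) : ℂ)) := by
    have : (X : ℂ) * ∑ n ∈ Finset.range Y, χ ((n + 1 : ℕ) : ZMod N) / ((n + 1 : ℕ) : ℂ) =
      ∑ i ∈ Finset.range Y, χ ((i + 1 : ℕ) : ZMod N) * (X / ((i + 1 : ℕ) : ℂ)) := by
      rw [Finset.mul_sum]
      apply Finset.sum_congr rfl
      intros; ring
    simp only [mul_sub, Finset.sum_sub_distrib]
    rw [this]
    ring
  rw [hsplit]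
  refine (norm_sub_le _ _).trans ?_
  have h6 : ‖(X : ℂ) * (χ.LFunction 1 -
      ∑ n ∈ Finset.range Y, χ ((n + 1 : ℕ) : ZMod N) / ((n + 1 : ℕ) : ℂ))‖ ≤ X * (2 * N / Y) := by
    rw [norm_mul, Complex.norm_natCast]
    gcongr
  have h7 := norm_add_le (∑ i ∈ Finset.range Y, χ ((i + 1 : ℕ) : ZMod N) *
      (((X / (i + 1) : ℕ) : ℂ) - X / ((i + 1 : ℕ) : ℂ)))
      (∑ j ∈ Finset.range K, χ ((Y + j + 1 : ℕ) : ZMod N) * ((X / (Y + j + 1) : ℕ) : ℂ))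
  have h8 : (2 * N * (X / Y) + X * (2 * N / Y) : ℝ) = 4 * N * X / Y := by ring
  linarith

end ZetaMulSum

section NonzeroCount
open DirichletCharacter ArithmeticFunction

lemma zetaMul_norm_le {N : ℕ} (χ : DirichletCharacter ℂ N) (n : ℕ) :
    ‖χ.zetaMul n‖ ≤ n.divisors.card := by
  unfold DirichletCharacter.zetaMul
  rw [ArithmeticFunction.coe_zeta_mul_apply]
  refine (norm_sum_le _ _).trans ?_
  have : ∀ i ∈ n.divisors, ‖(toArithmeticFunction (χ ·)) i‖ ≤ 1 := by
    intro i hi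
    have hi0 : i ≠ 0 := (Nat.pos_of_mem_divisors hi).ne'
    have := chA_apply χ hi0
    unfold chA at this
    rw [this]; exact χ.norm_le_one _
  refine (Finset.sum_le_sum this).trans ?_
  simp

lemma nonzero_count_aux (X C c q e S n : ℝ) (hq : 1 ≤ q) (hX : X = q ^ 3) (hC : 0 < C)
    (h1 : X * (c / 2 * q ^ (-(e / 2))) ≤ S)
    (h2 : S ≤ n * (C * X ^ (e / 6))) :
    c / (2 * C) * X * q ^ (-e) ≤ n := by
  have hq0 : 0 < q := by linarith
  have h3 : X ^ (e / 6) = q ^ (e / 2) := by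
    rw [hX, ← Real.rpow_natCast, ← Real.rpow_mul hq0.le]; congr 1; push_cast; ring
  rw [h3] at h2
  have h4 : X * (c / 2 * q ^ (-(e / 2))) = (c / (2 * C) * X * q ^ (-e)) * (C * q ^ (e / 2)) := by
    have : q ^ (-(e / 2)) = q ^ (-e) * q ^ (e / 2) := by
      rw [← Real.rpow_add hq0]; congr 1; ring
    rw [this]; field_simp
  rw [h4] at h1
  exact le_of_mul_le_mul_right (h1.trans h2) (by positivity)

lemma nonzero_count (ε : ℝ) (hε : 0 < ε) (hε1 : ε < 1) : ∃ c : ℝ, 0 < c ∧ ∃ D : ℕ, ∀ (N : ℕ)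
    [NeZero N] (χ : DirichletCharacter ℂ N), χ ≠ 1 → χ ^ 2 = 1 → D ≤ N →
      c * ((N ^ 3 : ℕ) : ℝ) * (N : ℝ) ^ (-ε) ≤
        (((Finset.Ioc 0 (N ^ 3)).filter (fun n => χ.zetaMul n ≠ 0)).card : ℝ) := by
  obtain ⟨c, hc, hs⟩ := siegel (ε / 2) (by linarith) (by linarith)
  obtain ⟨C, hC, hdiv⟩ := divisor_bound (ε / 6) (by linarith)
  have hlim := (tendsto_rpow_atTop (y := 1 - ε / 2) (by linarith)).comp (tendsto_natCast_atTop_atTop (R := ℝ))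
  obtain ⟨D, hD⟩ := Filter.eventually_atTop.1 (hlim.eventually_ge_atTop (10 / c))
  refine ⟨c / (2 * C), by positivity, D, ?_⟩
  intro N _ χ hχ hχ2 hN
  have hN0 : 0 < N := Nat.pos_of_ne_zero (NeZero.ne N)
  have hN1 : (1:ℝ) ≤ N := by exact_mod_cast hN0
  have hNp : (0:ℝ) < N := by linarith
  have hsi := hs N χ hχ hχ2
  have happ := zetaMul_sum_approx χ hχ (N ^ 3) (N ^ 2) (by positivity)
    (Nat.pow_le_pow_right hN0 (by norm_num))
  set S := ∑ n ∈ Finset.Ioc 0 (N ^ 3), χ.zetaMul n with hS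
  have herr : (((N ^ 2 : ℕ) : ℝ) + 4 * N * ((N ^ 3 : ℕ) : ℝ) / ((N ^ 2 : ℕ) : ℝ)) = 5 * (N:ℝ) ^ 2 := by
    push_cast; field_simp; ring
  rw [herr] at happ
  have hDN : 10 / c ≤ (N : ℝ) ^ (1 - ε / 2) := hD N hN
  have h5 : 5 * (N:ℝ) ^ 2 ≤ ((N ^ 3 : ℕ) : ℝ) * (c / 2 * (N:ℝ) ^ (-(ε / 2))) := by
    have h6 : (N:ℝ) ^ (1 - ε / 2) = N * (N:ℝ) ^ (-(ε / 2)) := by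
      rw [sub_eq_add_neg, Real.rpow_add hNp, Real.rpow_one]
    rw [h6, div_le_iff₀ hc] at hDN
    push_cast
    nlinarith [sq_nonneg (N:ℝ)]
  have hnorm : ((N ^ 3 : ℕ) : ℝ) * (c / 2 * (N:ℝ) ^ (-(ε / 2))) ≤ ‖S‖ := by
    have h7 : ‖((N ^ 3 : ℕ) : ℂ) * χ.LFunction 1‖ ≤ ‖S‖ + 5 * (N:ℝ) ^ 2 := by
      have := norm_sub_le S (S - ((N ^ 3 : ℕ) : ℂ) * χ.LFunction 1)
      rw [sub_sub_cancel] at this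
      linarith
    rw [norm_mul, Complex.norm_natCast] at h7
    have h8 := mul_le_mul_of_nonneg_left hsi (Nat.cast_nonneg (N ^ 3) : (0:ℝ) ≤ _)
    linarith
  refine nonzero_count_aux _ C c N ε ‖S‖ _ hN1 (by push_cast; rfl) (by linarith) hnorm ?_
  have h9 : S = ∑ n ∈ (Finset.Ioc 0 (N ^ 3)).filter (fun n => χ.zetaMul n ≠ 0), χ.zetaMul n :=
    (Finset.sum_filter_ne_zero _).symm
  rw [h9]
  refine (norm_sum_le _ _).trans ?_
  rw [← nsmul_eq_mul]
  apply Finset.sum_le_card_nsmul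
  intro n hn
  rw [Finset.mem_filter, Finset.mem_Ioc] at hn
  refine (zetaMul_norm_le χ n).trans ((hdiv n (by omega)).trans ?_)
  have : (n:ℝ) ≤ ((N ^ 3 : ℕ) : ℝ) := by exact_mod_cast hn.1.2
  gcongr

end NonzeroCount

section Structure
open DirichletCharacter ArithmeticFunction

lemma zetaMul_one_val {N : ℕ} (χ : DirichletCharacter ℂ N) : χ.zetaMul 1 = 1 :=
  χ.isMultiplicative_zetaMul.1

lemma zetaMul_factor_ne {N : ℕ} (χ : DirichletCharacter ℂ N) {n : ℕ} (hn : n ≠ 0)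
    (h : χ.zetaMul n ≠ 0) (p : ℕ) : χ.zetaMul (p ^ n.factorization p) ≠ 0 := by
  by_cases hp : p ∈ n.factorization.support
  · rw [χ.isMultiplicative_zetaMul.multiplicative_factorization _ hn] at h
    exact (Finset.prod_ne_zero_iff.1 h) p hp
  · rw [Finsupp.notMem_support_iff] at hp
    rw [hp, pow_zero, zetaMul_one_val]; exact one_ne_zero

lemma zetaMul_prime_odd {N : ℕ} (χ : DirichletCharacter ℂ N) {p k : ℕ} (hp : p.Prime)
    (h : χ (p : ZMod N) = -1) (hk : Odd k) : χ.zetaMul (p ^ k) = 0 := by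
  unfold DirichletCharacter.zetaMul
  rw [ArithmeticFunction.coe_zeta_mul_apply, Nat.sum_divisors_prime_pow hp]
  have : ∀ j, (toArithmeticFunction (χ ·)) (p ^ j) = (-1 : ℂ) ^ j := by
    intro j
    have := chA_apply χ (pow_ne_zero j hp.ne_zero)
    rw [Nat.cast_pow, map_pow χ, h] at this
    exact this
  simp only [this]
  rw [neg_one_geom_sum, if_pos]
  exact hk.add_one

lemma jacobi_one_of_ne {d : ℕ} [NeZero d] {m s p : ℕ} (hm : m ≠ 0) (hs : Squarefree s)
    (h : (psiChar d).zetaMul (m ^ 2 * s) ≠ 0) (hp : p.Prime) (hps : p ∣ s)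
    (hcop : p.Coprime (4 * d)) : jacobiSym (d : ℤ) p = 1 := by
  have hs0 : s ≠ 0 := hs.ne_zero
  have h1 := zetaMul_factor_ne _ (mul_ne_zero (pow_ne_zero 2 hm) hs0) h p
  have h2 : s.factorization p = 1 :=
    le_antisymm (hs.natFactorization_le_one p) (hp.factorization_pos_of_dvd hs0 hps)
  have h3 : (m ^ 2 * s).factorization p = 2 * m.factorization p + 1 := by
    rw [Nat.factorization_mul (pow_ne_zero 2 hm) hs0, Nat.factorization_pow]
    simp [h2]
  rw [h3] at h1
  have h4 : (d : ℤ).gcd p = 1 := by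
    rw [Int.gcd_natCast_natCast]
    exact (Nat.Coprime.coprime_dvd_right (Dvd.intro_left 4 rfl) hcop).symm
  rcases jacobiSym.eq_one_or_neg_one h4 with h5 | h5
  · exact h5
  · exfalso
    apply h1
    apply zetaMul_prime_odd _ hp _ ⟨_, rfl⟩
    rw [psiChar_apply d p hcop, h5]; norm_num

lemma sqrt_mod_squarefree (d : ℤ) (a : ℕ) (hsq : Squarefree a)
    (h : ∀ p : ℕ, p.Prime → p ∣ a → jacobiSym d p = 1) : ∃ b : ℕ, (a : ℤ) ∣ (b:ℤ) ^ 2 - d := by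
  induction a using Nat.recOnMul with
  | zero => exact absurd hsq not_squarefree_zero
  | one => exact ⟨0, by simp⟩
  | prime p hp =>
    have : Fact p.Prime := ⟨hp⟩
    obtain ⟨r, hr⟩ := ZMod.isSquare_of_jacobiSym_eq_one (h p hp dvd_rfl)
    refine ⟨r.val, ?_⟩
    rw [← ZMod.intCast_zmod_eq_zero_iff_dvd]
    push_cast
    rw [hr]; simp; ring
  | mul a₁ a₂ ih1 ih2 =>
    have hcop : a₁.Coprime a₂ := Nat.coprime_of_squarefree_mul hsq
    obtain ⟨b1, hb1⟩ := ih1 (hsq.squarefree_of_dvd (dvd_mul_right _ _))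
      (fun p hp hpa => h p hp (hpa.mul_right _))
    obtain ⟨b2, hb2⟩ := ih2 (hsq.squarefree_of_dvd (dvd_mul_left _ _))
      (fun p hp hpa => h p hp (hpa.mul_left _))
    obtain ⟨b, h1, h2⟩ := Nat.chineseRemainder hcop b1 b2
    refine ⟨b, ?_⟩
    push_cast
    apply IsCoprime.mul_dvd (Nat.isCoprime_iff_coprime.2 hcop)
    · have : (b:ℤ) ^ 2 - d ≡ (b1:ℤ) ^ 2 - d [ZMOD a₁] :=
        ((Int.natCast_modEq_iff.2 h1).pow 2).sub_right d
      exact this.dvd_iff.2 hb1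
    · have : (b:ℤ) ^ 2 - d ≡ (b2:ℤ) ^ 2 - d [ZMOD a₂] :=
        ((Int.natCast_modEq_iff.2 h2).pow 2).sub_right d
      exact this.dvd_iff.2 hb2

lemma four_mul_dvd (d : ℤ) (hd : d % 4 = 0 ∨ d % 4 = 1) (a : ℕ) (ha : Odd a) (b : ℕ)
    (hb : (a : ℤ) ∣ (b:ℤ) ^ 2 - d) : ∃ b : ℤ, (4 * a : ℤ) ∣ b ^ 2 - d := by
  have hcop : IsCoprime (4:ℤ) (a:ℤ) := by
    have : Nat.Coprime 4 a := by
      have h4 : (4:ℕ) = 2 ^ 2 := by norm_num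
      rw [h4]; exact Nat.Coprime.pow_left 2 (Nat.coprime_two_left.2 ha)
    exact_mod_cast Nat.isCoprime_iff_coprime.2 this
  have key : ∀ c : ℤ, c % 2 = d % 2 → (4:ℤ) ∣ c ^ 2 - d := by
    intro c hc
    rcases Int.emod_two_eq_zero_or_one c with h | h
    · obtain ⟨k, hk⟩ : ∃ k, c = 2 * k := ⟨c / 2, by omega⟩
      have : d % 4 = 0 := by omega
      obtain ⟨l, hl⟩ := Int.dvd_of_emod_eq_zero this
      exact ⟨k ^ 2 - l, by rw [hk, hl]; ring⟩
    · obtain ⟨k, hk⟩ : ∃ k, c = 2 * k + 1 := ⟨c / 2, by omega⟩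
      have : (d - 1) % 4 = 0 := by omega
      obtain ⟨l, hl⟩ := Int.dvd_of_emod_eq_zero this
      exact ⟨k ^ 2 + k - l, by
        have : d = 4 * l + 1 := by omega
        rw [hk, this]; ring⟩
  by_cases hpar : (b:ℤ) % 2 = d % 2
  · exact ⟨b, hcop.mul_dvd (key _ hpar) hb⟩
  · refine ⟨b + a, hcop.mul_dvd (key _ ?_) ?_⟩
    · have : (a:ℤ) % 2 = 1 := by
        have := Nat.odd_iff.1 ha; omega
      omega
    · have : ((b:ℤ) + a) ^ 2 - d = ((b:ℤ) ^ 2 - d) + a * (2 * b + a) := by ring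
      rw [this]
      exact dvd_add hb (dvd_mul_right _ _)

/-- leading coefficients -/
def goodA (d a : ℕ) : Prop :=
  Nat.Coprime a (2 * d) ∧ ∃ b : ℤ, (4 * a : ℤ) ∣ b ^ 2 - (d : ℤ)

lemma decomp {d : ℕ} [NeZero d] (hd4 : d % 4 = 0 ∨ d % 4 = 1) {n : ℕ} (hn : n ≠ 0)
    (h : (psiChar d).zetaMul n ≠ 0) :
    ∃ m e a : ℕ, m ≠ 0 ∧ a ≠ 0 ∧ e ∣ 2 * d ∧ n = m ^ 2 * e * a ∧ goodA d a := by
  obtain ⟨s, m, hms, hs⟩ := Nat.sq_mul_squarefree n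
  have hm : m ≠ 0 := by rintro rfl; simp at hms; exact hn hms.symm
  have hs0 : s ≠ 0 := hs.ne_zero
  obtain ⟨a, ha⟩ : s.gcd (2 * d) ∣ s := Nat.gcd_dvd_left _ _
  set e := s.gcd (2 * d) with he
  have hed : e ∣ 2 * d := Nat.gcd_dvd_right _ _
  have ha0 : a ≠ 0 := by rintro rfl; simp at ha; exact hs0 ha
  have hea : e.Coprime a := Nat.coprime_of_squarefree_mul (ha ▸ hs)
  have hasq : Squarefree a := hs.squarefree_of_dvd ⟨e, by rw [ha, mul_comm]⟩
  have hcop : a.Coprime (2 * d) := by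
    have h1 : a.gcd (2 * d) ∣ e := Nat.dvd_gcd
      ((Nat.gcd_dvd_left _ _).trans ⟨e, by rw [ha, mul_comm]⟩) (Nat.gcd_dvd_right _ _)
    have h2 : a.gcd (2 * d) ∣ e.gcd a := Nat.dvd_gcd h1 (Nat.gcd_dvd_left _ _)
    rw [Nat.Coprime.gcd_eq_one hea] at h2
    exact Nat.dvd_one.1 h2
  have haodd : Odd a := Nat.coprime_two_right.1 (Nat.Coprime.coprime_dvd_right (dvd_mul_right _ _) hcop)
  have hcop4 : a.Coprime (4 * d) := by
    have : 4 * d = 2 * (2 * d) := by ring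
    rw [this]
    exact Nat.Coprime.mul_right (Nat.coprime_two_right.2 haodd) hcop
  refine ⟨m, e, a, hm, ha0, hed, by rw [← hms, ha]; ring, hcop, ?_⟩
  obtain ⟨b, hb⟩ := sqrt_mod_squarefree (d : ℤ) a hasq (by
    intro p hp hpa
    exact jacobi_one_of_ne hm hs (by rw [hms]; exact h) hp
      (hpa.trans ⟨e, by rw [ha, mul_comm]⟩) (Nat.Coprime.coprime_dvd_left hpa hcop4))
  exact four_mul_dvd (d : ℤ) (by omega) a haodd b hb

open Classical in
lemma count_F {d : ℕ} [NeZero d] (hd4 : d % 4 = 0 ∨ d % 4 = 1) (X V : ℕ) (hV : 0 < V) :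
    (((Finset.Ioc 0 X).filter (fun n => (psiChar d).zetaMul n ≠ 0)).card : ℝ) ≤
      X / V + V * ((2 * d).divisors.card : ℝ) *
        (((Finset.Ioc 0 X).filter (fun a => goodA d a)).card : ℝ) := by
  have hd0 : d ≠ 0 := NeZero.ne d
  set F := (Finset.Ioc 0 X).filter (fun a => goodA d a) with hF
  set P := (Finset.Ioc V X).biUnion (fun m => (Finset.Ioc 0 X).filter (fun n => m ^ 2 ∣ n)) with hP
  set Q := ((Finset.Ioc 0 V) ×ˢ ((2 * d).divisors ×ˢ F)).image (fun t => t.1 ^ 2 * t.2.1 * t.2.2)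
    with hQ
  have hsub : (Finset.Ioc 0 X).filter (fun n => (psiChar d).zetaMul n ≠ 0) ⊆ P ∪ Q := by
    intro n hn
    rw [Finset.mem_filter, Finset.mem_Ioc] at hn
    obtain ⟨⟨hn0, hnX⟩, hne⟩ := hn
    obtain ⟨m, e, a, hm, ha, he, hnm, hg⟩ := decomp hd4 (by omega) hne
    have hmn : m ^ 2 ∣ n := ⟨e * a, by rw [hnm]; ring⟩
    have han : a ∣ n := ⟨m ^ 2 * e, by rw [hnm]; ring⟩
    have hmn' := Nat.le_of_dvd hn0 hmn
    have han' := Nat.le_of_dvd hn0 han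
    have hmm : m ≤ m ^ 2 := Nat.le_self_pow (by norm_num) m
    rw [Finset.mem_union]
    rcases le_or_gt m V with hmV | hmV
    · right
      rw [hQ, Finset.mem_image]
      refine ⟨(m, e, a), ?_, hnm.symm⟩
      simp only [Finset.mem_product, Finset.mem_Ioc, Nat.mem_divisors, hF, Finset.mem_filter]
      refine ⟨⟨by omega, hmV⟩, ⟨he, by omega⟩, ⟨by omega, by omega⟩, hg⟩
    · left
      rw [hP, Finset.mem_biUnion]
      refine ⟨m, Finset.mem_Ioc.2 ⟨hmV, by omega⟩, ?_⟩
      rw [Finset.mem_filter, Finset.mem_Ioc]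
      exact ⟨⟨hn0, hnX⟩, hmn⟩
  have h1 := (Finset.card_le_card hsub).trans (Finset.card_union_le _ _)
  have hPc : (P.card : ℝ) ≤ X / V := by
    have h2 : P.card ≤ ∑ m ∈ Finset.Ioc V X, X / m ^ 2 := by
      refine Finset.card_biUnion_le.trans (Finset.sum_le_sum fun m _ => ?_)
      rw [Nat.Ioc_filter_dvd_card_eq_div]
    have h3 : (P.card : ℝ) ≤ ∑ m ∈ Finset.Ioc V X, (X:ℝ) * ((m:ℝ) ^ 2)⁻¹ := by
      refine (Nat.cast_le.2 h2).trans ?_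
      push_cast
      apply Finset.sum_le_sum
      intro m _
      refine Nat.cast_div_le.trans ?_
      push_cast; rw [div_eq_mul_inv]
    refine h3.trans ?_
    rw [← Finset.mul_sum, div_eq_mul_inv]
    apply mul_le_mul_of_nonneg_left _ (Nat.cast_nonneg _)
    rcases le_total V X with hVX | hVX
    · have := sum_Ioc_inv_sq_le_sub (α := ℝ) hV.ne' hVX
      have h0 : (0:ℝ) ≤ (X:ℝ)⁻¹ := by positivity
      linarith
    · rw [Finset.Ioc_eq_empty (by omega)]; simp
  have hQc : (Q.card : ℝ) ≤ V * ((2 * d).divisors.card : ℝ) * (F.card : ℝ) := by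
    have : Q.card ≤ V * ((2 * d).divisors.card * F.card) := by
      refine Finset.card_image_le.trans ?_
      rw [Finset.card_product, Finset.card_product]; simp
    calc (Q.card : ℝ) ≤ ((V * ((2 * d).divisors.card * F.card) : ℕ) : ℝ) := Nat.cast_le.2 this
      _ = _ := by push_cast; ring
  have h4 : (((Finset.Ioc 0 X).filter (fun n => (psiChar d).zetaMul n ≠ 0)).card : ℝ) ≤
      (P.card : ℝ) + Q.card := by exact_mod_cast h1
  linarith

end Structure

section FLower

lemma F_lower_aux (N c C e X V t F K : ℝ) (hN : 1 ≤ N) (hc : 0 < c) (hC : 1 ≤ C) (hX : 0 ≤ X)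
    (hF : 0 ≤ F) (hK : K = 2 / c + 1)
    (h1 : c * X * N ^ (-(e / 3)) ≤ X / V + V * t * F)
    (hV1 : 2 / c * N ^ (e / 3) ≤ V) (hV2 : V ≤ K * N ^ (e / 3))
    (ht0 : 0 ≤ t) (ht : t ≤ C * N ^ (e / 3)) :
    c / (2 * K * C) * X * N ^ (-e) ≤ F := by
  have hN0 : 0 < N := by linarith
  set u := N ^ (e / 3) with hu
  have hu0 : 0 < u := Real.rpow_pos_of_pos hN0 _
  have hneg : N ^ (-(e / 3)) = u⁻¹ := by rw [hu, Real.rpow_neg hN0.le]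
  have hneg3 : N ^ (-e) = (u ^ 3)⁻¹ := by
    rw [hu, ← Real.rpow_natCast, ← Real.rpow_mul hN0.le, Real.rpow_neg hN0.le]
    congr 2; push_cast; ring
  have hK0 : 0 < K := by rw [hK]; positivity
  have hV0 : 0 < V := lt_of_lt_of_le (by positivity) hV1
  rw [hneg] at h1
  rw [hneg3]
  have h2 : X / V ≤ c / 2 * X * u⁻¹ := by
    have : X / V ≤ X / (2 / c * u) := div_le_div_of_nonneg_left hX (by positivity) hV1
    refine this.trans (le_of_eq ?_)
    field_simp
  have h3 : V * t * F ≤ (K * u) * (C * u) * F := by gcongr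
  have h4 : c / 2 * X * u⁻¹ ≤ (K * u) * (C * u) * F := by nlinarith
  have h5 : c / (2 * K * C) * X * (u ^ 3)⁻¹ = (c / 2 * X * u⁻¹) / ((K * u) * (C * u)) := by
    field_simp
  rw [h5, div_le_iff₀ (by positivity)]
  linarith

open Classical in
lemma F_lower (ε : ℝ) (hε : 0 < ε) (hε1 : ε < 1) : ∃ c : ℝ, 0 < c ∧ ∃ D : ℕ, ∀ d : ℕ,
    D ≤ d → d ≠ 0 → ¬ IsSquare d → (d % 4 = 0 ∨ d % 4 = 1) →
    c * (((4 * d) ^ 3 : ℕ) : ℝ) * ((4 * d : ℕ) : ℝ) ^ (-ε) ≤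
      (((Finset.Ioc 0 ((4 * d) ^ 3)).filter (fun a => goodA d a)).card : ℝ) := by
  obtain ⟨c, hc, D, hD⟩ := nonzero_count (ε / 3) (by linarith) (by linarith)
  obtain ⟨C, hC, hdiv⟩ := divisor_bound (ε / 3) (by linarith)
  refine ⟨c / (2 * (2 / c + 1) * C), by positivity, D, ?_⟩
  intro d hDd hd0 hns hd4
  have : NeZero d := ⟨hd0⟩
  have h1 := hD (4 * d) (psiChar d) (psiChar_ne_one d hns) (psiChar_sq d) (by omega)
  have hN1 : (1:ℝ) ≤ ((4 * d : ℕ) : ℝ) := by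
    have : 1 ≤ 4 * d := by omega
    exact_mod_cast this
  set N := ((4 * d : ℕ) : ℝ) with hN
  set V := ⌈2 / c * N ^ (ε / 3)⌉₊ with hV
  have hNe : 1 ≤ N ^ (ε / 3) := Real.one_le_rpow hN1 (by positivity)
  have hV0 : 0 < V := Nat.ceil_pos.2 (by positivity)
  have h2 := count_F hd4 ((4 * d) ^ 3) V hV0
  refine F_lower_aux N c C ε _ V ((2 * d).divisors.card : ℝ) _ (2 / c + 1) hN1 hc hC
    (Nat.cast_nonneg _) (Nat.cast_nonneg _) rfl (h1.trans h2) (Nat.le_ceil _) ?_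
    (Nat.cast_nonneg _) ?_
  · have := (Nat.ceil_lt_add_one (show 0 ≤ 2 / c * N ^ (ε / 3) by positivity)).le
    rw [add_mul, one_mul]
    linarith
  · refine (hdiv (2 * d) (by omega)).trans ?_
    have : ((2 * d : ℕ) : ℝ) ≤ N := by rw [hN]; exact_mod_cast (by omega : 2 * d ≤ 4 * d)
    gcongr

end FLower

section Glue

lemma SBNode.ok.path_hi_le {n : SBNode} (h : n.ok) (w : List Bool) : (n.path w).hi ≤ n.hi := by
  induction w generalizing n with
  | nil => exact le_refl _
  | cons b w ih =>
    refine (ih (h.stepOk b)).trans ?_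
    have h1 := h.q_pos; have h2 := h.q'_pos
    cases b
    · have h3 : (n.p':ℝ) * n.q - n.p * n.q' = 1 := by exact_mod_cast h.1
      simp only [SBNode.hi, SBNode.step]
      simp only [Bool.false_eq_true, if_false]
      push_cast
      rw [div_le_div_iff₀ (by linarith) (by linarith)]
      nlinarith
    · simp [SBNode.hi, SBNode.step]

open Classical in
lemma cs_pairs {ι : Type*} (F : Finset ι) (x : ι → ℝ) (T : Finset ℝ) (L : ℝ)
    (h : ∀ a ∈ F, ∃ t ∈ T, |x a - t| ≤ L) :
    (F.card : ℝ) ^ 2 ≤ (T.card : ℝ) *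
      (((F ×ˢ F).filter (fun p => |x p.1 - x p.2| ≤ 2 * L)).card : ℝ) := by
  choose! τ hτ1 hτ2 using h
  have h1 : F.card = ∑ t ∈ T, (F.filter (fun a => τ a = t)).card :=
    Finset.card_eq_sum_card_fiberwise (fun a ha => hτ1 a ha)
  set P := (F ×ˢ F).filter (fun p => τ p.1 = τ p.2) with hP
  have h2 : P.card = ∑ t ∈ T, (F.filter (fun a => τ a = t)).card ^ 2 := by
    rw [Finset.card_eq_sum_card_fiberwise (s := P) (t := T) (f := fun p => τ p.1)]
    · apply Finset.sum_congr rfl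
      intro t _
      rw [sq, ← Finset.card_product]
      congr 1
      ext ⟨a, b⟩
      simp only [hP, Finset.mem_filter, Finset.mem_product]
      constructor
      · rintro ⟨⟨⟨ha, hb⟩, hab⟩, hat⟩
        exact ⟨⟨ha, hat⟩, hb, hab ▸ hat⟩
      · rintro ⟨⟨ha, hat⟩, hb, hbt⟩
        exact ⟨⟨⟨ha, hb⟩, hat.trans hbt.symm⟩, hat⟩
    · intro p hp
      simp only [hP, Finset.coe_filter, Finset.mem_product] at hp
      exact hτ1 _ hp.1.1
  have h3 : P ⊆ (F ×ˢ F).filter (fun p => |x p.1 - x p.2| ≤ 2 * L) := by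
    intro p hp
    simp only [hP, Finset.mem_filter, Finset.mem_product] at hp ⊢
    refine ⟨hp.1, ?_⟩
    have h4 := hτ2 _ hp.1.1
    have h5 := hτ2 _ hp.1.2
    rw [← hp.2] at h5
    have : x p.1 - x p.2 = (x p.1 - τ p.1) - (x p.2 - τ p.1) := by ring
    rw [this]
    refine (abs_sub _ _).trans ?_
    linarith
  have h6 : F.card ^ 2 ≤ T.card * P.card := by
    rw [h2]; conv_lhs => rw [h1]
    exact sq_sum_le_card_mul_sum_sq
  have h7 : (F.card : ℝ) ^ 2 ≤ (T.card : ℝ) * P.card := by exact_mod_cast h6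
  refine h7.trans ?_
  have h8 : (P.card : ℝ) ≤ _ := Nat.cast_le.2 (Finset.card_le_card h3)
  gcongr

lemma form_of_goodA {d a : ℕ} (ha : 0 < a) (h : goodA d a) : ∃ b c : ℤ,
    b ^ 2 - 4 * a * c = d ∧ Int.gcd a (Int.gcd b c) = 1 ∧
      0 ≤ (-b + √(d:ℝ)) / (2 * (a:ℝ)) ∧ (-b + √(d:ℝ)) / (2 * (a:ℝ)) ≤ 1 := by
  obtain ⟨hcop, b0, hb0⟩ := h
  have ha' : (0:ℝ) < a := by exact_mod_cast ha
  set k := ⌊(-b0 + √(d:ℝ)) / (2 * (a:ℝ))⌋ with hk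
  obtain ⟨c0, hc0⟩ := hb0
  set b : ℤ := b0 + 2 * a * k with hb
  set c : ℤ := c0 + k * b0 + a * k ^ 2 with hc
  have heq : b ^ 2 - 4 * a * c = d := by
    rw [hb, hc]; linear_combination hc0
  have hx : (-(b:ℝ) + √(d:ℝ)) / (2 * (a:ℝ)) = (-b0 + √(d:ℝ)) / (2 * (a:ℝ)) - k := by
    rw [hb]; push_cast; field_simp; ring
  refine ⟨b, c, heq, ?_, ?_, ?_⟩
  · set g := Int.gcd a (Int.gcd b c) with hg
    have hga : (g:ℤ) ∣ a := Int.gcd_dvd_left _ _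
    have hgbc : (g:ℤ) ∣ (Int.gcd b c : ℤ) := Int.gcd_dvd_right _ _
    have hgb : (g:ℤ) ∣ b := hgbc.trans (Int.gcd_dvd_left _ _)
    have hgd : (g:ℤ) ∣ (d:ℤ) := by
      rw [← heq, sq]
      exact dvd_sub (hgb.mul_right _) ((hga.mul_left 4).mul_right c)
    have h1 : g ∣ a := by exact_mod_cast hga
    have h2 : g ∣ 2 * d := (by exact_mod_cast hgd : g ∣ d).mul_left 2
    have h3 : g ∣ a.gcd (2 * d) := Nat.dvd_gcd h1 h2
    rw [Nat.Coprime.gcd_eq_one hcop] at h3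
    exact Nat.dvd_one.1 h3
  · rw [hx]; linarith [Int.floor_le ((-b0 + √(d:ℝ)) / (2 * (a:ℝ)))]
  · rw [hx]; linarith [Int.lt_floor_add_one ((-b0 + √(d:ℝ)) / (2 * (a:ℝ)))]

/-- numerical contradiction -/
lemma final_num (c C1 C2 X d N f t P ε η : ℝ) (hd : 1 ≤ d) (hN : N = 4 * d) (hX : 0 < X)
    (hc : 0 < c) (hC1 : 0 < C1) (hC2 : 0 < C2) (hε : 0 < ε) (hε1 : ε ≤ 1 / 2) (hεη : 12 * ε ≤ η)
    (hf0 : 0 ≤ f) (hf : c * X * N ^ (-ε) ≤ f) (hfX : f ≤ X)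
    (ht0 : 0 ≤ t) (ht : t ≤ C1 * X * d ^ (-(η / 2)))
    (hP : P ≤ f + C2 * d ^ ε * X) (hcs : f ^ 2 ≤ t * P) :
    d ^ ε ≤ 4 * C1 * (1 + C2) / c ^ 2 := by
  have hd0 : 0 < d := by linarith
  set u := d ^ ε with hu
  have hu1 : 1 ≤ u := Real.one_le_rpow hd hε.le
  have hu0 : 0 < u := by linarith
  have hP2 : P ≤ (1 + C2) * u * X := by nlinarith [mul_le_mul_of_nonneg_right hu1 hX.le]
  have ht2 : t ≤ C1 * X * (u ^ 6)⁻¹ := by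
    refine ht.trans ?_
    have : d ^ (-(η / 2)) ≤ (u ^ 6)⁻¹ := by
      rw [hu, ← Real.rpow_natCast, ← Real.rpow_mul hd0.le, ← Real.rpow_neg hd0.le]
      apply Real.rpow_le_rpow_of_exponent_le hd
      push_cast; linarith
    gcongr
  have hN2 : (2 * u)⁻¹ ≤ N ^ (-ε) := by
    rw [hN, Real.rpow_neg (by positivity)]
    apply inv_anti₀ (by positivity)
    rw [Real.mul_rpow (by norm_num) hd0.le, ← hu]
    have : (4:ℝ) ^ ε ≤ 4 ^ (1 / 2 : ℝ) := Real.rpow_le_rpow_of_exponent_le (by norm_num) hε1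
    have h4 : (4:ℝ) ^ (1 / 2 : ℝ) = 2 := by
      rw [← Real.sqrt_eq_rpow, show (4:ℝ) = 2 ^ 2 by norm_num, Real.sqrt_sq (by norm_num)]
    rw [h4] at this
    gcongr
  have hf2 : c * X * (2 * u)⁻¹ ≤ f := le_trans (by gcongr) hf
  have h1 : (c * X * (2 * u)⁻¹) ^ 2 ≤ f ^ 2 := by
    apply pow_le_pow_left₀ (by positivity) hf2
  have h2 : t * P ≤ (C1 * X * (u ^ 6)⁻¹) * ((1 + C2) * u * X) := by
    calc t * P ≤ t * ((1 + C2) * u * X) := by gcongr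
      _ ≤ _ := by gcongr
  have h3 := (h1.trans hcs).trans h2
  have h4 : (c * X * (2 * u)⁻¹) ^ 2 = (X ^ 2 * (u ^ 5)⁻¹) * (c ^ 2 * u ^ 3 / 4) := by
    field_simp; ring
  have h5 : (C1 * X * (u ^ 6)⁻¹) * ((1 + C2) * u * X) = (X ^ 2 * (u ^ 5)⁻¹) * (C1 * (1 + C2)) := by
    field_simp
  rw [h4, h5] at h3
  have h6 := le_of_mul_le_mul_left h3 (by positivity)
  rw [le_div_iff₀ (by positivity)]
  have h7 : u ≤ u ^ 3 := le_self_pow₀ hu1 (by norm_num)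
  nlinarith [mul_le_mul_of_nonneg_left h7 (sq_nonneg c)]

end Glue

section Main

open Classical in
lemma open_hit {W : Set (ℝ × ℝ × ℝ)} (hW : IsOpen W) {A B C : ℝ} (hABC : B ^ 2 - 4 * A * C = 1)
    (hmem : (A, B, C) ∈ W) :
    ∃ D : ℕ, ∀ d : ℕ, D ≤ d → ¬ IsSquare d → (d % 4 = 0 ∨ d % 4 = 1) →
      ∃ a b c : ℤ, b ^ 2 - 4 * a * c = d ∧ Int.gcd a (Int.gcd b c) = 1 ∧
        (((a : ℝ) / √(d:ℝ), (b : ℝ) / √(d:ℝ), (c : ℝ) / √(d:ℝ)) : ℝ × ℝ × ℝ) ∈ W := by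
  obtain ⟨w, hw⟩ := exists_good_word hW hABC hmem
  obtain ⟨η, C1, hη, hC1, hcov⟩ := SBNode.covering w
  set ε := min (η / 12) (1 / 2) with hε
  have hε0 : 0 < ε := lt_min (by positivity) (by norm_num)
  have hε1 : ε ≤ 1 / 2 := min_le_right _ _
  have hεη : 12 * ε ≤ η := by have := min_le_left (η / 12) (1 / 2 : ℝ); linarith
  obtain ⟨C2, hC2, hpair⟩ := pair_count ε hε0
  obtain ⟨c, hc, D1, hF⟩ := F_lower ε hε0 (by linarith)
  have hlim := (tendsto_rpow_atTop hε0).comp (tendsto_natCast_atTop_atTop (R := ℝ))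
  obtain ⟨D2, hD2⟩ := Filter.eventually_atTop.1
    (hlim.eventually_gt_atTop (4 * C1 * (1 + C2) / c ^ 2))
  refine ⟨max (max D1 D2) 10000, ?_⟩
  intro d hd hns hd4
  have hd1 : D1 ≤ d := (le_max_left _ _).trans ((le_max_left _ _).trans hd)
  have hd2 : D2 ≤ d := (le_max_right _ _).trans ((le_max_left _ _).trans hd)
  have hd3 : 10000 ≤ d := (le_max_right _ _).trans hd
  by_contra hcon
  have hlast := hD2 d hd2
  simp only [Function.comp] at hlast
  apply absurd hlast
  rw [not_lt]
  have hdR : (10000:ℝ) ≤ d := by exact_mod_cast hd3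
  have hs100 : (100:ℝ) ≤ √(d:ℝ) := by
    rw [Real.le_sqrt (by norm_num) (by linarith)]; norm_num; linarith
  have hs0 : (0:ℝ) < √(d:ℝ) := by linarith
  have hsd : √(d:ℝ) ≤ d := by
    rw [Real.sqrt_le_left (by linarith)]; nlinarith
  set X : ℝ := (((4 * d) ^ 3 : ℕ) : ℝ) with hX
  have hdX : (d:ℝ) ≤ X := by
    rw [hX]
    have : d ≤ (4 * d) ^ 3 := (by omega : d ≤ 4 * d).trans (Nat.le_self_pow (by norm_num) _)
    exact_mod_cast this
  have hX0 : 0 < X := by linarith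
  set FN := (Finset.Ioc 0 ((4 * d) ^ 3)).filter (fun a => goodA d a) with hFN
  have hFl := hF d hd1 (by omega) hns hd4
  have hform : ∀ a : ℤ, ∃ b c : ℤ, a.toNat ∈ FN → 0 < a → b ^ 2 - 4 * a * c = d ∧
      Int.gcd a (Int.gcd b c) = 1 ∧ 0 ≤ (-b + √(d:ℝ)) / (2 * (a:ℝ)) ∧
      (-b + √(d:ℝ)) / (2 * (a:ℝ)) ≤ 1 := by
    intro a
    by_cases ha : a.toNat ∈ FN ∧ 0 < a
    · obtain ⟨n, rfl⟩ := Int.eq_ofNat_of_zero_le ha.2.le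
      have h1 := ha.1
      rw [hFN, Finset.mem_filter] at h1
      obtain ⟨b, c, h⟩ := form_of_goodA (by have := ha.2; omega) h1.2
      exact ⟨b, c, fun _ _ => h⟩
    · exact ⟨0, 0, fun h1 h2 => absurd ⟨h1, h2⟩ ha⟩
  choose b cc hbc using hform
  set F : Finset ℤ := FN.map Nat.castEmbedding with hFdef
  have hFcard : F.card = FN.card := Finset.card_map _
  have hFmem : ∀ a ∈ F, a.toNat ∈ FN ∧ 0 < a ∧ (a:ℝ) ≤ X := by
    intro a ha
    rw [hFdef, Finset.mem_map] at ha
    obtain ⟨n, hn, rfl⟩ := ha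
    have hn' := hn
    rw [hFN, Finset.mem_filter, Finset.mem_Ioc] at hn'
    refine ⟨by simpa using hn, by simpa using hn'.1.1, ?_⟩
    rw [hX]
    simp only [Nat.castEmbedding_apply, Int.cast_natCast]
    exact_mod_cast hn'.1.2
  have hFX : (F.card : ℝ) ≤ X := by
    rw [hFcard, hX, Nat.cast_le, hFN]
    refine (Finset.card_filter_le _ _).trans ?_
    simp
  set x : ℤ → ℝ := fun a => (-b a + √(d:ℝ)) / (2 * (a:ℝ)) with hx
  have hnsZ : ¬ IsSquare (d:ℤ) := by
    intro h; apply hns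
    exact_mod_cast h
  have hp := hpair (d:ℤ) (by exact_mod_cast (by omega : 100 ≤ d)) hnsZ X
    (by push_cast; linarith) F b cc (fun a ha => by
      obtain ⟨h1, h2, h3⟩ := hFmem a ha
      exact ⟨h2, h3, (hbc a h1 h2).1⟩)
  rw [Int.cast_natCast] at hp
  obtain ⟨T, hT1, hT2⟩ := hcov (F.image x) (1 / X) (√(d:ℝ) / X) (by positivity)
    (by rw [mul_one_div]; gcongr) (by rw [div_le_one hX0]; linarith)
    (by
      intro y hy
      rw [Finset.mem_image] at hy
      obtain ⟨a, ha, rfl⟩ := hy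
      obtain ⟨h1, h2, _⟩ := hFmem a ha
      exact (hbc a h1 h2).2.2)
    (by
      intro n hn hlen y hy hlo hhi
      rw [Finset.mem_image] at hy
      obtain ⟨a, ha, rfl⟩ := hy
      obtain ⟨h1, h2, h3⟩ := hFmem a ha
      obtain ⟨e1, e2, _, _⟩ := hbc a h1 h2
      have ha0 : (0:ℝ) < a := by exact_mod_cast h2
      apply hcon
      have hlt : (-(b a : ℝ) - √((d:ℤ):ℝ)) / (2 * a) < n.lo := by
        rw [Int.cast_natCast]
        have h4 : (-(b a : ℝ) - √(d:ℝ)) / (2 * a) = x a - √(d:ℝ) / a := by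
          rw [hx]; field_simp; ring
        have h5 : √(d:ℝ) / X ≤ √(d:ℝ) / a := div_le_div_of_nonneg_left hs0.le ha0 h3
        have h6 := hn.path_hi_le w
        have h7 := hn.hi_sub_lo
        rw [h4]; linarith
      obtain ⟨a', b', c', r1, r2, r3⟩ := hw n a (b a) (cc a) d hn h2 e1
        (by exact_mod_cast (by omega : 0 < d)) e2
        (by rw [Int.cast_natCast]; exact hlo) (by rw [Int.cast_natCast]; exact hhi) hlt
      rw [Int.cast_natCast] at r3
      exact ⟨a', b', c', r1, r2, r3⟩)
  have hcs := cs_pairs F x T (1 / X) (fun a ha => hT2 _ (Finset.mem_image_of_mem x ha))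
  have hPb : (((F ×ˢ F).filter (fun p => |x p.1 - x p.2| ≤ 2 * (1 / X))).card : ℝ) ≤
      F.card + C2 * (d:ℝ) ^ ε * X := by
    have hsub : (F ×ˢ F).filter (fun p => |x p.1 - x p.2| ≤ 2 * (1 / X)) ⊆ F.diag ∪
        (F ×ˢ F).filter (fun p => p.1 ≠ p.2 ∧
          |(-b p.1 + √(d:ℝ)) / (2 * p.1) - (-b p.2 + √(d:ℝ)) / (2 * p.2)| ≤ 2 / X) := by
      rintro ⟨p, q⟩ hpq
      rw [mul_one_div] at hpq
      rw [Finset.mem_filter, Finset.mem_product] at hpq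
      rw [Finset.mem_union]
      by_cases hpe : p = q
      · left; rw [Finset.mem_diag]; exact ⟨hpq.1.1, hpe⟩
      · right; rw [Finset.mem_filter, Finset.mem_product]
        exact ⟨hpq.1, hpe, hpq.2⟩
    have h1 := (Finset.card_le_card hsub).trans (Finset.card_union_le _ _)
    rw [Finset.diag_card] at h1
    have h2 := (Nat.cast_le (α := ℝ)).2 h1
    push_cast at h2
    linarith
  refine final_num c C1 C2 X d ((4 * d : ℕ) : ℝ) F.card T.card _ ε η (by linarith)
    (by push_cast; rfl) hX0 hc hC1 hC2 hε0 hε1 hεη (Nat.cast_nonneg _) ?_ hFX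
    (Nat.cast_nonneg _) ?_ hPb hcs
  · rw [hFcard]; exact hFl
  · refine hT1.trans (le_of_eq ?_)
    have h1 : (1 / X) / (√(d:ℝ) / X) = (√(d:ℝ))⁻¹ := by field_simp
    have h2 : ((√(d:ℝ))⁻¹) ^ η = (d:ℝ) ^ (-(η / 2)) := by
      rw [Real.sqrt_eq_rpow, ← Real.rpow_neg (by linarith), ← Real.rpow_mul (by linarith)]
      congr 1; ring
    rw [h1, h2]; field_simp

end Main

/-- Corollary 4.2 (point-counting consequence of Duke's theorem, via ELMV): every fixed
nonempty relatively compact open subset of the hyperboloid is met by the rescaled set of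
primitive integer triples of discriminant `d`, for all sufficiently large positive
non-square discriminants `d`. -/
theorem duke_open_hit (𝒰 : Set (ℝ × ℝ × ℝ)) (hsub : 𝒰 ⊆ hypV)
    (hne : 𝒰.Nonempty)
    (hopen : ∃ W : Set (ℝ × ℝ × ℝ), IsOpen W ∧ 𝒰 = W ∩ hypV)
    (hcpt : IsCompact (closure 𝒰)) :
    ∃ D : ℕ, ∀ d : ℤ, (D : ℤ) ≤ d → ¬ IsSquare d → (d % 4 = 0 ∨ d % 4 = 1) →
      ∃ a b c : ℤ, b ^ 2 - 4 * a * c = d ∧ Int.gcd a (Int.gcd b c) = 1 ∧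
        (((a : ℝ) / Real.sqrt d, (b : ℝ) / Real.sqrt d, (c : ℝ) / Real.sqrt d)
          : ℝ × ℝ × ℝ) ∈ 𝒰 := by
  obtain ⟨W, hW, rfl⟩ := hopen
  obtain ⟨⟨A, B, C⟩, hWm, hV⟩ := hne
  have hABC : B ^ 2 - 4 * A * C = 1 := hV
  obtain ⟨D, hD⟩ := open_hit hW hABC hWm
  refine ⟨D + 1, ?_⟩
  intro d hd hns hd4
  obtain ⟨n, rfl⟩ := Int.eq_ofNat_of_zero_le (by push_cast at hd; omega : (0:ℤ) ≤ d)
  obtain ⟨a, b, c, h1, h2, h3⟩ := hD n (by push_cast at hd; omega)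
    (fun h => hns (by exact_mod_cast h)) (by omega)
  refine ⟨a, b, c, h1, h2, ?_⟩
  rw [Int.cast_natCast]
  refine ⟨h3, ?_⟩
  have hn0 : (0:ℝ) < n := by
    have : 0 < n := by push_cast at hd; omega
    exact_mod_cast this
  have hsq : √(n:ℝ) ^ 2 = n := Real.sq_sqrt hn0.le
  have hs0 : √(n:ℝ) ≠ 0 := (Real.sqrt_pos.2 hn0).ne'
  have h1' : (b:ℝ) ^ 2 - 4 * a * c = n := by exact_mod_cast h1
  change ((b:ℝ) / √(n:ℝ)) ^ 2 - 4 * ((a:ℝ) / √(n:ℝ)) * ((c:ℝ) / √(n:ℝ)) = 1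
  have : ((b:ℝ) / √(n:ℝ)) ^ 2 - 4 * ((a:ℝ) / √(n:ℝ)) * ((c:ℝ) / √(n:ℝ)) =
      ((b:ℝ) ^ 2 - 4 * a * c) / √(n:ℝ) ^ 2 := by field_simp
  rw [this, h1', hsq, div_self hn0.ne']
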